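/- For every r ∈ ℕ and every ε > 0 there exist s ∈ ℕ and ε' > 0 such that every f ∈ Diff^∞_+([0,1]) which is ITI at 0 and at 1 and satisfies d_s(f, id) < ε' can be written as a product of five commutators [a₁,b₁][a₂,b₂][a₃,b₃][a₄,b₄][a₅,b₅], where each a_i, b_i belongs to Diff^∞_+([0,1]) and satisfies d_r(a_i, id) < ε and d_r(b_i, id) < ε. Here [a,b] = a∘b∘a⁻¹∘b⁻¹. -/

import Mathlib

open Filter Set

noncomputable section

/-- An element of `Diff^n_+([0,1])`. -/
structure DiffIcc (n : ℕ∞) where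
  toFun : ℝ → ℝ
  invFun : ℝ → ℝ
  smooth : ContDiffOn ℝ n toFun (Set.Icc 0 1)
  smooth_inv : ContDiffOn ℝ n invFun (Set.Icc 0 1)
  maps : Set.MapsTo toFun (Set.Icc 0 1) (Set.Icc 0 1)
  maps_inv : Set.MapsTo invFun (Set.Icc 0 1) (Set.Icc 0 1)
  left_inv : ∀ x ∈ Set.Icc (0:ℝ) 1, invFun (toFun x) = x
  right_inv : ∀ x ∈ Set.Icc (0:ℝ) 1, toFun (invFun x) = x
  fix0 : toFun 0 = 0
  fix1 : toFun 1 = 1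
  deriv_pos : ∀ x ∈ Set.Icc (0:ℝ) 1, 0 < derivWithin toFun (Set.Icc 0 1) x

/-- `d_r(f, g) < ε` for maps of `[0,1]`. -/
def IDistLt (r : ℕ) (ε : ℝ) (f g : ℝ → ℝ) : Prop :=
  ∀ k ≤ r, ∀ x ∈ Set.Icc (0:ℝ) 1,
    |iteratedDerivWithin k f (Set.Icc 0 1) x - iteratedDerivWithin k g (Set.Icc 0 1) x| < ε

/-- `f` is infinitely tangent to the identity (ITI) at `a`. -/
def ITIat (f : ℝ → ℝ) (a : ℝ) : Prop :=
  derivWithin f (Set.Icc 0 1) a = 1 ∧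
    ∀ k : ℕ, 2 ≤ k → iteratedDerivWithin k f (Set.Icc 0 1) a = 0

/-- The commutator `[a, b] = a∘b∘a⁻¹∘b⁻¹` of two diffeomorphisms of `[0,1]`. -/
def commFun (a b : DiffIcc ⊤) : ℝ → ℝ :=
  a.toFun ∘ b.toFun ∘ a.invFun ∘ b.invFun

open scoped ContDiff Topology

/-- The derivatives of `u` at `x` up to order `r` are bounded by `M`. -/
def BdAt (r : ℕ) (M : ℝ) (u : ℝ → ℝ) (x : ℝ) : Prop :=
  ∀ k ≤ r, |iteratedDeriv k u x| ≤ M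

/-- `u` is smooth and its derivatives up to order `r` are bounded by `M`. -/
def Bd (r : ℕ) (M : ℝ) (u : ℝ → ℝ) : Prop :=
  ContDiff ℝ ∞ u ∧ ∀ x, BdAt r M u x

section Basics

variable {r : ℕ} {M N : ℝ} {u v w : ℝ → ℝ} {x : ℝ}

theorem smooth_deriv (hu : ContDiff ℝ ∞ u) : ContDiff ℝ ∞ (deriv u) :=
  (contDiff_infty_iff_deriv.1 hu).2

theorem smooth_diff (hu : ContDiff ℝ ∞ u) : Differentiable ℝ u :=
  (contDiff_infty_iff_deriv.1 hu).1

theorem smooth_at (hu : ContDiff ℝ ∞ u) {n : ℕ} {x : ℝ} : ContDiffAt ℝ n u x :=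
  (hu.of_le (by exact_mod_cast le_top)).contDiffAt

theorem smooth_iter (hu : ContDiff ℝ ∞ u) (k : ℕ) : ContDiff ℝ ∞ (iteratedDeriv k u) := by
  induction k generalizing u with
  | zero => simpa using hu
  | succ k ih => rw [iteratedDeriv_succ']; exact ih (smooth_deriv hu)

theorem smooth_iter_hasDerivAt (hu : ContDiff ℝ ∞ u) (k : ℕ) (x : ℝ) :
    HasDerivAt (iteratedDeriv k u) (iteratedDeriv (k + 1) u x) x := by
  rw [iteratedDeriv_succ]
  exact (smooth_diff (smooth_iter hu k) x).hasDerivAt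

theorem BdAt.nonneg (h : BdAt r M u x) : 0 ≤ M := (abs_nonneg _).trans (h 0 (Nat.zero_le _))

theorem Bd.nonneg (h : Bd r M u) : 0 ≤ M := (h.2 0).nonneg

theorem BdAt.mono (h : BdAt r M u x) {s : ℕ} (hs : s ≤ r) (hM : M ≤ N) : BdAt s N u x :=
  fun k hk => (h k (hk.trans hs)).trans hM

theorem Bd.mono (h : Bd r M u) {s : ℕ} (hs : s ≤ r) (hM : M ≤ N) : Bd s N u :=
  ⟨h.1, fun x => (h.2 x).mono hs hM⟩

theorem BdAt.deriv (h : BdAt (r + 1) M u x) : BdAt r M (deriv u) x := fun k hk => by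
  rw [← iteratedDeriv_succ']; exact h _ (by omega)

theorem Bd.deriv (h : Bd (r + 1) M u) : Bd r M (deriv u) :=
  ⟨smooth_deriv h.1, fun x => (h.2 x).deriv⟩

theorem BdAt.of_deriv (h0 : |u x| ≤ M) (h : BdAt r M (_root_.deriv u) x) : BdAt (r + 1) M u x := by
  rintro (_ | k) hk
  · simpa using h0
  · rw [iteratedDeriv_succ']; exact h _ (by omega)

theorem BdAt.zero_apply (h : BdAt r M u x) : |u x| ≤ M := by
  simpa using h 0 (Nat.zero_le _)

theorem BdAt.deriv_apply (h : BdAt (r + 1) M u x) : |_root_.deriv u x| ≤ M := by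
  simpa using h 1 (by omega)

theorem BdAt.top (h : BdAt r M u x) : |iteratedDeriv r u x| ≤ M := h r le_rfl

theorem BdAt.succ (h : BdAt r M u x) (ht : |iteratedDeriv (r + 1) u x| ≤ M) :
    BdAt (r + 1) M u x := fun k hk => by
  rcases Nat.lt_or_ge k (r + 1) with h1 | h1
  · exact h k (by omega)
  · obtain rfl : k = r + 1 := by omega
    exact ht

theorem BdAt.add (hu : ContDiff ℝ ∞ u) (hv : ContDiff ℝ ∞ v) (h : BdAt r M u x)
    (h' : BdAt r N v x) : BdAt r (M + N) (fun x => u x + v x) x := fun k hk => by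
  have := iteratedDeriv_add (n := k) (x := x) (smooth_at hu) (smooth_at hv)
  rw [show (fun x => u x + v x) = u + v from rfl, this]
  exact (abs_add_le _ _).trans (add_le_add (h k hk) (h' k hk))

theorem BdAt.neg (h : BdAt r M u x) : BdAt r M (fun x => - u x) x := fun k hk => by
  have := iteratedDeriv_neg k u x
  rw [show (fun x => - u x) = -u from rfl, this, abs_neg]
  exact h k hk

theorem BdAt.sub (hu : ContDiff ℝ ∞ u) (hv : ContDiff ℝ ∞ v) (h : BdAt r M u x)
    (h' : BdAt r N v x) : BdAt r (M + N) (fun x => u x - v x) x := by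
  simpa only [sub_eq_add_neg] using h.add hu hv.neg h'.neg

theorem BdAt.const {c : ℝ} (hc : |c| ≤ M) : BdAt r M (fun _ => c) x := fun k _ => by
  rw [iteratedDeriv_const]
  split_ifs
  · exact hc
  · simpa using (abs_nonneg c).trans hc

theorem iteratedDeriv_mul_smooth (hu : ContDiff ℝ ∞ u) (hv : ContDiff ℝ ∞ v) (n : ℕ) (x : ℝ) :
    iteratedDeriv n (fun x => u x * v x) x = ∑ i ∈ Finset.range (n + 1),
      (n.choose i : ℝ) * iteratedDeriv i u x * iteratedDeriv (n - i) v x :=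
  iteratedDeriv_mul (n := n) (x := x) (smooth_at hu) (smooth_at hv)

theorem BdAt.mul (hu : ContDiff ℝ ∞ u) (hv : ContDiff ℝ ∞ v) (h : BdAt r M u x)
    (h' : BdAt r N v x) : BdAt r (2 ^ r * M * N) (fun x => u x * v x) x := fun k hk => by
  rw [iteratedDeriv_mul_smooth hu hv]
  have hM := h.nonneg
  have hN := h'.nonneg
  calc |∑ i ∈ Finset.range (k + 1),
        (k.choose i : ℝ) * iteratedDeriv i u x * iteratedDeriv (k - i) v x|
      ≤ ∑ i ∈ Finset.range (k + 1),
        |(k.choose i : ℝ) * iteratedDeriv i u x * iteratedDeriv (k - i) v x| :=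
        Finset.abs_sum_le_sum_abs _ _
    _ ≤ ∑ i ∈ Finset.range (k + 1), (k.choose i : ℝ) * (M * N) := by
        refine Finset.sum_le_sum fun i hi => ?_
        rw [abs_mul, abs_mul, Nat.abs_cast, mul_assoc]
        have hi := Finset.mem_range.1 hi
        gcongr
        · exact h i (by omega)
        · exact h' _ (by omega)
    _ = 2 ^ k * (M * N) := by
        rw [← Finset.sum_mul, ← Nat.cast_sum, Nat.sum_range_choose]; push_cast; ring
    _ ≤ 2 ^ r * M * N := by
        rw [mul_assoc]
        gcongr
        norm_num

theorem Bd.add (h : Bd r M u) (h' : Bd r N v) : Bd r (M + N) (fun x => u x + v x) :=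
  ⟨h.1.add h'.1, fun x => (h.2 x).add h.1 h'.1 (h'.2 x)⟩

theorem Bd.neg (h : Bd r M u) : Bd r M (fun x => - u x) := ⟨h.1.neg, fun x => (h.2 x).neg⟩

theorem Bd.sub (h : Bd r M u) (h' : Bd r N v) : Bd r (M + N) (fun x => u x - v x) :=
  ⟨h.1.sub h'.1, fun x => (h.2 x).sub h.1 h'.1 (h'.2 x)⟩

theorem Bd.const {c : ℝ} (hc : |c| ≤ M) : Bd r M (fun _ => c) :=
  ⟨contDiff_const, fun _ => BdAt.const hc⟩

theorem Bd.mul (h : Bd r M u) (h' : Bd r N v) : Bd r (2 ^ r * M * N) (fun x => u x * v x) :=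
  ⟨h.1.mul h'.1, fun x => (h.2 x).mul h.1 h'.1 (h'.2 x)⟩

theorem smooth_shift (hu : ContDiff ℝ ∞ u) (hw : ContDiff ℝ ∞ w) :
    ContDiff ℝ ∞ (fun x => u (x + w x)) := hu.comp (contDiff_id.add hw)

theorem deriv_shift (hu : ContDiff ℝ ∞ u) (hw : ContDiff ℝ ∞ w) :
    _root_.deriv (fun x => u (x + w x)) =
      fun x => _root_.deriv u (x + w x) * (1 + _root_.deriv w x) := by
  funext x
  have h1 : HasDerivAt (fun x => x + w x) (1 + _root_.deriv w x) x :=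
    (hasDerivAt_id x).add (smooth_diff hw x).hasDerivAt
  exact ((smooth_diff hu (x + w x)).hasDerivAt.comp x h1).deriv

theorem smooth_one_add_deriv (hw : ContDiff ℝ ∞ w) :
    ContDiff ℝ ∞ (fun x => 1 + _root_.deriv w x) := contDiff_const.add (smooth_deriv hw)

end Basics

/-- Composition bound. -/
theorem comp_bound (r : ℕ) (B : ℝ) : ∃ C, 1 ≤ C ∧ ∀ (M : ℝ) (u w : ℝ → ℝ) (x : ℝ),
    ContDiff ℝ ∞ u → ContDiff ℝ ∞ w → BdAt r M u (x + w x) → BdAt r B w x →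
    BdAt r (C * M) (fun x => u (x + w x)) x := by
  induction r with
  | zero =>
    refine ⟨1, le_rfl, fun M u w x hu hw h h' k hk => ?_⟩
    obtain rfl : k = 0 := by omega
    simpa using h 0 le_rfl
  | succ r ih =>
    obtain ⟨C, hC, ih⟩ := ih
    refine ⟨max 1 (2 ^ r * C * (1 + |B|)), le_max_left _ _, fun M u w x hu hw h h' => ?_⟩
    have hM := h.nonneg
    have hB := h'.nonneg
    refine BdAt.of_deriv ?_ ?_
    · exact h.zero_apply.trans (le_mul_of_one_le_left hM (le_max_left _ _))
    · rw [deriv_shift hu hw]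
      have h1 := ih M (deriv u) w x (smooth_deriv hu) hw h.deriv (h'.mono (Nat.le_succ _) le_rfl)
      have h2 : BdAt r (1 + B) (fun x => 1 + deriv w x) x :=
        (BdAt.const (c := 1) (by simp)).add contDiff_const (smooth_deriv hw) h'.deriv
      refine (h1.mul (smooth_shift (smooth_deriv hu) hw) (smooth_one_add_deriv hw) h2).mono
        le_rfl ?_
      rw [abs_of_nonneg hB]
      calc 2 ^ r * (C * M) * (1 + B) = (2 ^ r * C * (1 + B)) * M := by ring
        _ ≤ _ := by gcongr; exact le_max_right _ _

/-- Composition bound, with the two top order terms isolated. -/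
theorem comp_top (r : ℕ) (M : ℝ) : ∃ C, 0 ≤ C ∧ ∀ (m : ℝ) (u w : ℝ → ℝ) (x : ℝ),
    ContDiff ℝ ∞ u → ContDiff ℝ ∞ w → BdAt (r + 1) m u (x + w x) → BdAt (r + 1) M w x →
    |iteratedDeriv (r + 2) (fun x => u (x + w x)) x
      - iteratedDeriv (r + 2) u (x + w x) * (1 + deriv w x) ^ (r + 2)
      - deriv u (x + w x) * iteratedDeriv (r + 2) w x| ≤ C * m := by
  induction r with
  | zero =>
    refine ⟨0, le_rfl, fun m u w x hu hw h h' => ?_⟩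
    rw [iteratedDeriv_succ', deriv_shift hu hw, iteratedDeriv_one]
    have e2 := congrFun (deriv_shift (smooth_deriv hu) hw) x
    have e1 : deriv (fun x => deriv u (x + w x) * (1 + deriv w x)) x =
        deriv (deriv u) (x + w x) * (1 + deriv w x) * (1 + deriv w x) +
        deriv u (x + w x) * deriv (deriv w) x := by
      have a1 := (smooth_diff (smooth_shift (smooth_deriv hu) hw) x).hasDerivAt
      have a2 := (smooth_diff (smooth_one_add_deriv hw) x).hasDerivAt
      have := (a1.mul a2).deriv
      rw [e2] at this
      refine this.trans ?_
      simp
    rw [e1]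
    have e3 : ∀ f : ℝ → ℝ, iteratedDeriv 2 f = deriv (deriv f) := fun f => by
      rw [iteratedDeriv_succ', iteratedDeriv_one]
    simp only [zero_add, e3]
    rw [show ∀ a b c d : ℝ, a * b * b + c * d - a * b ^ 2 - c * d = 0 by intros; ring]
    simp
  | succ r ih =>
    obtain ⟨C, hC, ih⟩ := ih
    obtain ⟨C1, hC1, hc⟩ := comp_bound (r + 1) |M|
    refine ⟨(C + |M|) * (1 + |M|) + 2 ^ (r + 2) * (C1 * (1 + |M|)), by positivity,
      fun m u w x hu hw h h' => ?_⟩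
    have hm := h.nonneg
    have hM := h'.nonneg
    rw [abs_of_nonneg hM] at hc ⊢
    rw [iteratedDeriv_succ', deriv_shift hu hw,
      iteratedDeriv_mul_smooth (smooth_shift (smooth_deriv hu) hw) (smooth_one_add_deriv hw),
      Finset.sum_range_succ, Finset.sum_range_succ']
    have hu' := smooth_deriv hu
    have ih1 := ih m (deriv u) w x hu' hw h.deriv (h'.mono (Nat.le_succ _) le_rfl)
    have hc1 := hc m (deriv u) w x hu' hw h.deriv (h'.mono (Nat.le_succ _) le_rfl)
    have hw1 : BdAt (r + 1) (1 + M) (fun x => 1 + deriv w x) x :=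
      (BdAt.const (c := 1) (by simp)).add contDiff_const (smooth_deriv hw) h'.deriv
    have hmid : |∑ i ∈ Finset.range (r + 1), ((r + 1 + 1).choose (i + 1) : ℝ) *
        iteratedDeriv (i + 1) (fun x => deriv u (x + w x)) x *
        iteratedDeriv (r + 1 + 1 - (i + 1)) (fun x => 1 + deriv w x) x|
        ≤ 2 ^ (r + 2) * (C1 * (1 + M)) * m := by
      calc _ ≤ ∑ i ∈ Finset.range (r + 1), |((r + 1 + 1).choose (i + 1) : ℝ) *
            iteratedDeriv (i + 1) (fun x => deriv u (x + w x)) x *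
            iteratedDeriv (r + 1 + 1 - (i + 1)) (fun x => 1 + deriv w x) x| :=
            Finset.abs_sum_le_sum_abs _ _
        _ ≤ ∑ i ∈ Finset.range (r + 1), ((r + 1 + 1).choose (i + 1) : ℝ) *
            ((C1 * m) * (1 + M)) := by
            refine Finset.sum_le_sum fun i hi => ?_
            rw [abs_mul, abs_mul, Nat.abs_cast, mul_assoc]
            have hi := Finset.mem_range.1 hi
            gcongr
            · exact hc1 _ (by omega)
            · exact hw1 _ (by omega)
        _ = (∑ i ∈ Finset.range (r + 1), ((r + 1 + 1).choose (i + 1) : ℝ)) *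
            ((C1 * m) * (1 + M)) := by rw [Finset.sum_mul]
        _ ≤ 2 ^ (r + 2) * ((C1 * m) * (1 + M)) := by
            gcongr
            have h2 : ∑ i ∈ Finset.range (r + 1), ((r + 1 + 1).choose (i + 1)) ≤ 2 ^ (r + 2) := by
              have := Nat.sum_range_choose (r + 1 + 1)
              rw [Finset.sum_range_succ, Finset.sum_range_succ'] at this
              exact le_trans (by omega) this.le
            exact_mod_cast h2
        _ = _ := by ring
    set S := ∑ i ∈ Finset.range (r + 1), ((r + 1 + 1).choose (i + 1) : ℝ) *
        iteratedDeriv (i + 1) (fun x => deriv u (x + w x)) x *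
        iteratedDeriv (r + 1 + 1 - (i + 1)) (fun x => 1 + deriv w x) x with hS
    have e1 : iteratedDeriv (r + 1 + 1) (fun x => 1 + deriv w x) x =
        iteratedDeriv (r + 1 + 2) w x := by
      rw [iteratedDeriv_const_add (by omega), iteratedDeriv_succ' (n := r + 1 + 1)]
    have e2 : iteratedDeriv (r + 2) (deriv u) (x + w x) =
        iteratedDeriv (r + 1 + 2) u (x + w x) := by
      rw [iteratedDeriv_succ' (n := r + 2)]
    rw [e2] at ih1
    simp only [Nat.choose_zero_right, Nat.choose_self, Nat.cast_one, one_mul, Nat.sub_zero,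
      Nat.sub_self, iteratedDeriv_zero, e1]
    have hw0 : |deriv w x| ≤ M := h'.deriv_apply
    have hw2 : |iteratedDeriv (r + 2) w x| ≤ M := h' _ (by omega)
    have hu2 : |deriv (deriv u) (x + w x)| ≤ m := h.deriv.deriv_apply
    have hw3 : |1 + deriv w x| ≤ 1 + M := (abs_add_le _ _).trans (by simpa using hw0)
    set a := iteratedDeriv (r + 1 + 1) (fun x => deriv u (x + w x)) x
    set b := iteratedDeriv (r + 1 + 2) u (x + w x)
    set p := 1 + deriv w x
    set q := deriv (deriv u) (x + w x)
    set d := iteratedDeriv (r + 2) w x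
    set g := deriv u (x + w x) * iteratedDeriv (r + 1 + 2) w x
    have : S + g + a * p - b * p ^ (r + 1 + 2) - g = S + (a - b * p ^ (r + 2) - q * d) * p
        + q * d * p := by ring
    rw [this]
    have t1 : |(a - b * p ^ (r + 2) - q * d) * p| ≤ C * m * (1 + M) := by
      rw [abs_mul]; gcongr
    have t2 : |q * d * p| ≤ m * M * (1 + M) := by
      rw [abs_mul, abs_mul]; gcongr
    calc _ ≤ |S| + |(a - b * p ^ (r + 2) - q * d) * p| + |q * d * p| := abs_add_three _ _ _
      _ ≤ _ := by linarith

/-- Composition with a map close to the identity changes little. -/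
theorem comp_close (r : ℕ) : ∃ C, 1 ≤ C ∧ ∀ (M N : ℝ) (u w : ℝ → ℝ),
    Bd (r + 1) M u → Bd r N w → N ≤ 1 →
    Bd r (C * M * N) (fun x => u (x + w x) - u x) := by
  induction r with
  | zero =>
    refine ⟨1, le_rfl, fun M N u w h h' hN => ⟨(smooth_shift h.1 h'.1).sub h.1, ?_⟩⟩
    intro x k hk
    obtain rfl : k = 0 := by omega
    rw [iteratedDeriv_zero]
    have := Convex.norm_image_sub_le_of_norm_deriv_le (f := u) (C := M) (s := univ)
      (x := x) (y := x + w x) (fun y _ => smooth_diff h.1 y) (fun y _ => (h.2 y).deriv_apply)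
      convex_univ (mem_univ _) (mem_univ _)
    simp only [Real.norm_eq_abs, add_sub_cancel_left] at this
    refine this.trans ?_
    have := (h'.2 x).zero_apply
    have := h.nonneg
    rw [one_mul]
    gcongr
  | succ r ih =>
    obtain ⟨C, hC, ih⟩ := ih
    obtain ⟨C1, hC1, hc⟩ := comp_bound r 1
    refine ⟨C + 2 ^ r * C1 + 1, by linarith [show 0 ≤ 2 ^ r * C1 by positivity],
      fun M N u w h h' hN => ⟨(smooth_shift h.1 h'.1).sub h.1, fun x => ?_⟩⟩
    have hM := h.nonneg
    have hN0 := h'.nonneg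
    have hMN : 0 ≤ M * N := by positivity
    refine BdAt.of_deriv ?_ ?_
    · have := Convex.norm_image_sub_le_of_norm_deriv_le (f := u) (C := M) (s := univ)
        (x := x) (y := x + w x) (fun y _ => smooth_diff h.1 y) (fun y _ => (h.2 y).deriv_apply)
        convex_univ (mem_univ _) (mem_univ _)
      simp only [Real.norm_eq_abs, add_sub_cancel_left] at this
      refine this.trans ?_
      have := (h'.2 x).zero_apply
      calc M * |w x| ≤ 1 * (M * N) := by rw [one_mul]; gcongr
        _ ≤ (C + 2 ^ r * C1 + 1) * (M * N) := by
          gcongr; linarith [show 0 ≤ 2 ^ r * C1 by positivity]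
        _ = _ := by ring
    · have e : deriv (fun x => u (x + w x) - u x) = fun x =>
          (deriv u (x + w x) - deriv u x) + deriv u (x + w x) * deriv w x := by
        funext x
        have := congrFun (deriv_shift h.1 h'.1) x
        rw [show (fun x => u (x + w x) - u x) = (fun x => u (x + w x)) - u from rfl,
          deriv_sub (smooth_diff (smooth_shift h.1 h'.1) x) (smooth_diff h.1 x), this]
        ring
      rw [e]
      have h1 := ih M N (deriv u) w h.deriv (h'.mono (Nat.le_succ _) le_rfl) hN
      have h2 := hc M (deriv u) w x (smooth_deriv h.1) h'.1
        ((h.deriv.2 _).mono (Nat.le_succ _) le_rfl) ((h'.2 x).mono (Nat.le_succ _) hN)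
      have h3 := h2.mul (smooth_shift (smooth_deriv h.1) h'.1) (smooth_deriv h'.1)
        (h'.2 x).deriv
      refine ((h1.2 x).add h1.1 ((smooth_shift (smooth_deriv h.1) h'.1).mul
        (smooth_deriv h'.1)) h3).mono le_rfl ?_
      nlinarith

/-- Lipschitz dependence of a composition on the inner map. -/
theorem comp_lip (r : ℕ) (B : ℝ) : ∃ C, 1 ≤ C ∧ ∀ (M η : ℝ) (u w w' : ℝ → ℝ),
    Bd (r + 1) M u → Bd r B w → Bd r B w' → Bd r η (fun x => w x - w' x) →
    Bd r (C * M * η) (fun x => u (x + w x) - u (x + w' x)) := by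
  induction r with
  | zero =>
    refine ⟨1, le_rfl, fun M η u w w' h h1 h2 h3 =>
      ⟨(smooth_shift h.1 h1.1).sub (smooth_shift h.1 h2.1), ?_⟩⟩
    intro x k hk
    obtain rfl : k = 0 := by omega
    rw [iteratedDeriv_zero]
    have := Convex.norm_image_sub_le_of_norm_deriv_le (f := u) (C := M) (s := univ)
      (x := x + w' x) (y := x + w x) (fun y _ => smooth_diff h.1 y)
      (fun y _ => (h.2 y).deriv_apply) convex_univ (mem_univ _) (mem_univ _)
    simp only [Real.norm_eq_abs, add_sub_add_left_eq_sub] at this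
    refine this.trans ?_
    have := (h3.2 x).zero_apply
    have := h.nonneg
    rw [one_mul]
    gcongr
  | succ r ih =>
    obtain ⟨C, hC, ih⟩ := ih
    obtain ⟨C1, hC1, hc⟩ := comp_bound r B
    refine ⟨2 ^ r * C * (1 + |B|) + 2 ^ r * C1 + 1,
      by linarith [show 0 ≤ 2 ^ r * C * (1 + |B|) + 2 ^ r * C1 by positivity],
      fun M η u w w' h h1 h2 h3 =>
      ⟨(smooth_shift h.1 h1.1).sub (smooth_shift h.1 h2.1), fun x => ?_⟩⟩
    have hM := h.nonneg
    have hB := h1.nonneg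
    have hη := h3.nonneg
    have hMN : 0 ≤ M * η := by positivity
    rw [abs_of_nonneg hB]
    refine BdAt.of_deriv ?_ ?_
    · have := Convex.norm_image_sub_le_of_norm_deriv_le (f := u) (C := M) (s := univ)
        (x := x + w' x) (y := x + w x) (fun y _ => smooth_diff h.1 y)
        (fun y _ => (h.2 y).deriv_apply) convex_univ (mem_univ _) (mem_univ _)
      simp only [Real.norm_eq_abs, add_sub_add_left_eq_sub] at this
      refine this.trans ?_
      have := (h3.2 x).zero_apply
      calc M * |w x - w' x| ≤ 1 * (M * η) := by rw [one_mul]; gcongr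
        _ ≤ (2 ^ r * C * (1 + B) + 2 ^ r * C1 + 1) * (M * η) := by
          gcongr; linarith [show 0 ≤ 2 ^ r * C * (1 + B) + 2 ^ r * C1 by positivity]
        _ = _ := by ring
    · have hu' := smooth_deriv h.1
      have e : deriv (fun x => u (x + w x) - u (x + w' x)) = fun x =>
          (deriv u (x + w x) - deriv u (x + w' x)) * (1 + deriv w x)
          + deriv u (x + w' x) * (deriv (fun x => w x - w' x) x) := by
        funext x
        have e1 := congrFun (deriv_shift h.1 h1.1) x
        have e2 := congrFun (deriv_shift h.1 h2.1) x
        have e3 : deriv (fun x => w x - w' x) x = deriv w x - deriv w' x :=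
          deriv_sub (smooth_diff h1.1 x) (smooth_diff h2.1 x)
        rw [show (fun x => u (x + w x) - u (x + w' x)) =
          (fun x => u (x + w x)) - (fun x => u (x + w' x)) from rfl,
          deriv_sub (smooth_diff (smooth_shift h.1 h1.1) x)
            (smooth_diff (smooth_shift h.1 h2.1) x), e1, e2, e3]
        ring
      rw [e]
      have a1 := ih M η (deriv u) w w' h.deriv (h1.mono (Nat.le_succ _) le_rfl)
        (h2.mono (Nat.le_succ _) le_rfl) (h3.mono (Nat.le_succ _) le_rfl)
      have a2 : BdAt r (1 + B) (fun x => 1 + deriv w x) x :=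
        (BdAt.const (c := 1) (by simp)).add contDiff_const (smooth_deriv h1.1) (h1.2 x).deriv
      have a3 := (a1.2 x).mul a1.1 (smooth_one_add_deriv h1.1) a2
      have a4 := hc M (deriv u) w' x hu' h2.1
        ((h.deriv.2 _).mono (Nat.le_succ _) le_rfl) ((h2.2 x).mono (Nat.le_succ _) le_rfl)
      have a5 := a4.mul (smooth_shift hu' h2.1) (smooth_deriv h3.1) (h3.2 x).deriv
      refine (a3.add (a1.1.mul (smooth_one_add_deriv h1.1)) ((smooth_shift hu' h2.1).mul
        (smooth_deriv h3.1)) a5).mono le_rfl ?_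
      nlinarith

section Inverse

theorem exists_displacement_inv {u : ℝ → ℝ} (hu : ContDiff ℝ ∞ u) (h : ∀ x, |deriv u x| ≤ 1 / 2) :
    ∃ w : ℝ → ℝ, ContDiff ℝ ∞ w ∧ (∀ x, w (x + u x) = - u x) ∧
      (∀ x, u (x + w x) = - w x) := by
  set f : ℝ → ℝ := fun x => x + u x with hf
  have hfd : ∀ x, HasDerivAt f (1 + deriv u x) x := fun x =>
    (hasDerivAt_id x).add (smooth_diff hu x).hasDerivAt
  have hpos : ∀ x, 1 / 2 ≤ 1 + deriv u x := fun x => by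
    have := (abs_le.1 (h x)).1; linarith
  have hmono : StrictMono f := strictMono_of_deriv_pos fun x => by
    rw [(hfd x).deriv]; linarith [hpos x]
  have hfs : ContDiff ℝ ∞ f := contDiff_id.add hu
  have hg : Monotone fun x => f x - x / 2 := by
    refine monotone_of_deriv_nonneg (fun x => ?_) (fun x => ?_)
    · exact ((hfd x).sub ((hasDerivAt_id x).div_const 2)).differentiableAt
    · have := ((hfd x).sub ((hasDerivAt_id x).div_const 2)).deriv
      simp only [id] at this
      rw [show (fun x => f x - x / 2) = f - fun x => x / 2 from rfl, this]
      linarith [hpos x]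
  have htop : Tendsto f atTop atTop := by
    refine tendsto_atTop_mono' _ (f₁ := fun x => x / 2 + f 0) ?_ ?_
    · filter_upwards [eventually_ge_atTop 0] with x hx
      have := hg hx
      simp only at this
      linarith
    · exact tendsto_atTop_add_const_right _ _ (tendsto_id.atTop_div_const (by norm_num))
  have hbot : Tendsto f atBot atBot := by
    refine tendsto_atBot_mono' _ (f₁ := fun x => x / 2 + f 0) ?_ ?_
    · filter_upwards [eventually_le_atBot 0] with x hx
      have := hg hx
      simp only at this
      linarith
    · exact tendsto_atBot_add_const_right _ _ (tendsto_id.atBot_div_const (by norm_num))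
  have hsurj : Function.Surjective f := hfs.continuous.surjective htop hbot
  let e : ℝ ≃ₜ ℝ := (hmono.orderIsoOfSurjective f hsurj).toHomeomorph
  have he : ∀ x, e x = f x := fun x => rfl
  have hsm : ContDiff ℝ ∞ e.symm :=
    e.contDiff_symm_deriv (f' := fun x => 1 + deriv u x) (fun x => by linarith [hpos x])
      (fun x => hfd x) hfs
  refine ⟨fun x => e.symm x - x, hsm.sub contDiff_id, fun x => ?_, fun x => ?_⟩
  · have : e.symm (f x) = x := by rw [← he, e.symm_apply_apply]
    simp only
    rw [show x + u x = f x from rfl, this]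
    simp [hf]
  · have : f (e.symm x) = x := by rw [← he, e.apply_symm_apply]
    simp only [add_sub_cancel]
    have h2 : e.symm x + u (e.symm x) = x := this
    linarith

open Classical in
/-- The displacement of the inverse of `id + u`. -/
def dinv (u : ℝ → ℝ) : ℝ → ℝ :=
  if h : ContDiff ℝ ∞ u ∧ ∀ x, |deriv u x| ≤ 1 / 2 then
    (exists_displacement_inv h.1 h.2).choose else 0

variable {u : ℝ → ℝ}

theorem dinv_spec (hu : ContDiff ℝ ∞ u) (h : ∀ x, |deriv u x| ≤ 1 / 2) :
    ContDiff ℝ ∞ (dinv u) ∧ (∀ x, dinv u (x + u x) = - u x) ∧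
      (∀ x, u (x + dinv u x) = - dinv u x) := by
  have h' : ContDiff ℝ ∞ u ∧ ∀ x, |deriv u x| ≤ 1 / 2 := ⟨hu, h⟩
  rw [dinv, dif_pos h']
  exact (exists_displacement_inv h'.1 h'.2).choose_spec

theorem dinv_eq (hu : ContDiff ℝ ∞ u) (h : ∀ x, |deriv u x| ≤ 1 / 2) :
    dinv u = fun x => - u (x + dinv u x) := by
  funext x; rw [(dinv_spec hu h).2.2]; ring

theorem dinv_deriv (hu : ContDiff ℝ ∞ u) (h : ∀ x, |deriv u x| ≤ 1 / 4) (x : ℝ) :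
    |deriv (dinv u) x| ≤ 2 * |deriv u (x + dinv u x)| ∧ |deriv (dinv u) x| ≤ 1 := by
  have h2 : ∀ x, |deriv u x| ≤ 1 / 2 := fun x => (h x).trans (by norm_num)
  have hs := (dinv_spec hu h2).1
  have e : deriv (dinv u) x = - (deriv u (x + dinv u x) * (1 + deriv (dinv u) x)) := by
    conv_lhs => rw [dinv_eq hu h2]
    rw [show (fun x => - u (x + dinv u x)) = - (fun x => u (x + dinv u x)) from rfl,
      deriv.neg, deriv_shift hu hs]
  have e2 : |deriv (dinv u) x| ≤ |deriv u (x + dinv u x)| * (1 + |deriv (dinv u) x|) := by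
    conv_lhs => rw [e, abs_neg, abs_mul]
    gcongr
    exact (abs_add_le _ _).trans (by simp)
  have h3 := h (x + dinv u x)
  have h4 := abs_nonneg (deriv u (x + dinv u x))
  have h5 := abs_nonneg (deriv (dinv u) x)
  constructor <;> nlinarith

theorem dinv_top_aux (r : ℕ) (M : ℝ) : ∃ C, 0 ≤ C ∧ ∀ (N t : ℝ) (u : ℝ → ℝ),
    Bd (r + 1) N u → (∀ x, |deriv u x| ≤ 1 / 4) → Bd (r + 1) M (dinv u) →
    (∀ x, |iteratedDeriv (r + 2) u x| ≤ t) →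
    ∀ x, |iteratedDeriv (r + 2) (dinv u) x| ≤ 2 * (2 ^ (r + 2) * t + C * N) := by
  obtain ⟨C, hC, hc⟩ := comp_top r M
  refine ⟨C, hC, fun N t u hu h hw ht x => ?_⟩
  have h2 : ∀ x, |deriv u x| ≤ 1 / 2 := fun x => (h x).trans (by norm_num)
  have key := hc N u (dinv u) x hu.1 hw.1 (hu.2 _) (hw.2 _)
  have e : iteratedDeriv (r + 2) (dinv u) x =
      - iteratedDeriv (r + 2) (fun x => u (x + dinv u x)) x := by
    conv_lhs => rw [dinv_eq hu.1 h2]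
    exact iteratedDeriv_neg _ _ _
  rw [← neg_eq_iff_eq_neg] at e
  rw [← e] at key
  have h3 := (dinv_deriv hu.1 h x).2
  have h4 : |1 + deriv (dinv u) x| ^ (r + 2) ≤ 2 ^ (r + 2) := by
    gcongr
    exact (abs_add_le _ _).trans (by rw [abs_one]; linarith)
  have h5 : |iteratedDeriv (r + 2) u (x + dinv u x) * (1 + deriv (dinv u) x) ^ (r + 2)| ≤
      2 ^ (r + 2) * t := by
    rw [abs_mul, abs_pow, mul_comm]
    have := ht (x + dinv u x)
    gcongr
  have h6 : |deriv u (x + dinv u x) * iteratedDeriv (r + 2) (dinv u) x| ≤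
      1 / 4 * |iteratedDeriv (r + 2) (dinv u) x| := by
    rw [abs_mul]; gcongr; exact h _
  rw [abs_le] at key h5 h6
  rw [abs_le]
  have h7 : |iteratedDeriv (r + 2) (dinv u) x| ≤
    2 ^ (r + 2) * t + C * N + 1 / 4 * |iteratedDeriv (r + 2) (dinv u) x| := by
    rw [abs_le]; constructor <;> linarith
  have := le_abs_self (iteratedDeriv (r + 2) (dinv u) x)
  have := neg_abs_le (iteratedDeriv (r + 2) (dinv u) x)
  have := abs_nonneg (iteratedDeriv (r + 2) (dinv u) x)
  constructor <;> linarith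

theorem dinv_bound (r : ℕ) (M : ℝ) : ∃ C, 1 ≤ C ∧ ∀ (N : ℝ) (u : ℝ → ℝ), N ≤ M →
    Bd r N u → (∀ x, |deriv u x| ≤ 1 / 4) → Bd r (C * N) (dinv u) := by
  have hb : ∀ (r : ℕ) (N : ℝ) (u : ℝ → ℝ), Bd r N u → (∀ x, |deriv u x| ≤ 1 / 4) →
      ContDiff ℝ ∞ (dinv u) ∧ ∀ x, |dinv u x| ≤ N := fun r N u h h1 => by
    have h2 : ∀ x, |deriv u x| ≤ 1 / 2 := fun x => (h1 x).trans (by norm_num)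
    refine ⟨(dinv_spec h.1 h2).1, fun x => ?_⟩
    rw [dinv_eq h.1 h2, abs_neg]
    exact (h.2 _).zero_apply
  induction r with
  | zero =>
    refine ⟨1, le_rfl, fun N u hN h h1 => ⟨(hb 0 N u h h1).1, fun x k hk => ?_⟩⟩
    obtain rfl : k = 0 := by omega
    simpa using (hb 0 N u h h1).2 x
  | succ r ih =>
    obtain ⟨C, hC, ih⟩ := ih
    rcases r with _ | r
    · refine ⟨2, by norm_num, fun N u hN h h1 => ⟨(hb _ N u h h1).1, fun x => ?_⟩⟩
      have hN0 := h.nonneg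
      refine BdAt.of_deriv (((hb _ N u h h1).2 x).trans (by linarith)) ?_
      intro k hk
      obtain rfl : k = 0 := by omega
      rw [iteratedDeriv_zero]
      have := (dinv_deriv h.1 h1 x).1
      have := (h.2 (x + dinv u x)).deriv_apply
      linarith
    · obtain ⟨C', hC', hc⟩ := dinv_top_aux r (C * |M|)
      refine ⟨C + 2 * (2 ^ (r + 2) + C'), by linarith [show 0 ≤ 2 * (2 ^ (r + 2) + C') by positivity],
        fun N u hN h h1 => ⟨(hb _ N u h h1).1, fun x => ?_⟩⟩
      have hN0 := h.nonneg
      have h2 := ih N u hN (h.mono (Nat.le_succ _) le_rfl) h1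
      have h3 := hc N N u (h.mono (Nat.le_succ _) le_rfl) h1
        (h2.mono le_rfl (by gcongr; exact hN.trans (le_abs_self _))) (fun x => (h.2 x).top) x
      have h4 : C * N ≤ (C + 2 * (2 ^ (r + 2) + C')) * N := by
        gcongr; linarith [show 0 ≤ 2 * (2 ^ (r + 2) + C') by positivity]
      refine BdAt.succ ((h2.2 x).mono le_rfl h4) (h3.trans ?_)
      nlinarith [show 0 ≤ C * N by positivity]

theorem dinv_top (r : ℕ) (M : ℝ) : ∃ C, 0 ≤ C ∧ ∀ (N t : ℝ) (u : ℝ → ℝ), N ≤ M →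
    Bd (r + 1) N u → (∀ x, |deriv u x| ≤ 1 / 4) →
    (∀ x, |iteratedDeriv (r + 2) u x| ≤ t) →
    ∀ x, |iteratedDeriv (r + 2) (dinv u) x| ≤ 2 * (2 ^ (r + 2) * t + C * N) := by
  obtain ⟨C1, hC1, h1⟩ := dinv_bound (r + 1) M
  obtain ⟨C, hC, hc⟩ := dinv_top_aux r (C1 * |M|)
  refine ⟨C, hC, fun N t u hN hu h ht => hc N t u hu h ((h1 N u hN hu h).mono le_rfl ?_) ht⟩
  gcongr
  exact hN.trans (le_abs_self _)

theorem Bd.absorb {r : ℕ} {a η : ℝ} {f : ℝ → ℝ}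
    (h : ∀ η, Bd r η f → Bd r (a + η / 2) f) (h0 : Bd r η f) : Bd r (2 * a) f := by
  have key : ∀ n : ℕ, Bd r (2 * a + |η - 2 * a| * (1 / 2) ^ n) f := by
    intro n
    induction n with
    | zero => exact h0.mono le_rfl (by simp; linarith [le_abs_self (η - 2 * a)])
    | succ n ih => exact (h _ ih).mono le_rfl (by rw [pow_succ]; linarith)
  refine ⟨h0.1, fun x k hk => ?_⟩
  have ht : Tendsto (fun n : ℕ => 2 * a + |η - 2 * a| * (1 / 2 : ℝ) ^ n) atTop (𝓝 (2 * a)) := by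
    have := (tendsto_pow_atTop_nhds_zero_of_lt_one (r := (1 / 2 : ℝ)) (by norm_num)
      (by norm_num)).const_mul (|η - 2 * a|)
    simpa using this.const_add (2 * a)
  exact ge_of_tendsto' ht fun n => (key n).2 x k hk

theorem dinv_lip (r : ℕ) : ∃ C δ : ℝ, 1 ≤ C ∧ 0 < δ ∧ ∀ (η : ℝ) (u u' : ℝ → ℝ),
    Bd (r + 1) δ u → Bd (r + 1) δ u' → Bd r η (fun x => u x - u' x) →
    Bd r (C * η) (fun x => dinv u x - dinv u' x) := by
  obtain ⟨C1, hC1, h1⟩ := dinv_bound r (1 / 4)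
  obtain ⟨C2, hC2, h2⟩ := comp_bound r C1
  obtain ⟨C3, hC3, h3⟩ := comp_lip r C1
  refine ⟨2 * C2, min (1 / 4) (1 / (2 * C3)), by linarith, by positivity,
    fun η u u' hu hu' hd => ?_⟩
  set δ := min (1 / 4) (1 / (2 * C3)) with hδ
  have hδ1 : δ ≤ 1 / 4 := min_le_left _ _
  have hδ2 : C3 * δ ≤ 1 / 2 := by
    calc C3 * δ ≤ C3 * (1 / (2 * C3)) := by gcongr; exact min_le_right _ _
      _ = 1 / 2 := by field_simp
  have a1 : ∀ x, |deriv u x| ≤ 1 / 4 := fun x => (hu.2 x).deriv_apply.trans hδ1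
  have a2 : ∀ x, |deriv u' x| ≤ 1 / 4 := fun x => (hu'.2 x).deriv_apply.trans hδ1
  have b1 : ∀ x, |deriv u x| ≤ 1 / 2 := fun x => (a1 x).trans (by norm_num)
  have b2 : ∀ x, |deriv u' x| ≤ 1 / 2 := fun x => (a2 x).trans (by norm_num)
  have w1 := h1 (1/4) u le_rfl (hu.mono (Nat.le_succ _) hδ1) a1
  have w2 := h1 (1/4) u' le_rfl (hu'.mono (Nat.le_succ _) hδ1) a2
  have w1' := w1.mono le_rfl (show C1 * (1 / 4) ≤ C1 by linarith)
  have w2' := w2.mono le_rfl (show C1 * (1 / 4) ≤ C1 by linarith)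
  have e : (fun x => dinv u x - dinv u' x) = fun x => -(u (x + dinv u x) - u' (x + dinv u x)) -
      (u' (x + dinv u x) - u' (x + dinv u' x)) := by
    funext x
    rw [(dinv_spec hu.1 b1).2.2, (dinv_spec hu'.1 b2).2.2]
    ring
  rw [mul_assoc]
  refine Bd.absorb (f := fun x => dinv u x - dinv u' x) (fun ξ hξ => ?_) (w1.sub w2)
  have c1 : Bd r (C2 * η) (fun x => u (x + dinv u x) - u' (x + dinv u x)) :=
    ⟨smooth_shift hd.1 w1.1, fun x => h2 η (fun x => u x - u' x) (dinv u) x hd.1 w1.1 (hd.2 _)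
      (w1'.2 x)⟩
  have c2 := h3 δ ξ u' (dinv u) (dinv u') hu' w1' w2' hξ
  rw [e]
  have hξ0 := hξ.nonneg
  refine (c1.neg.sub c2).mono le_rfl ?_
  nlinarith

end Inverse

section Limit

/-- Landau's interpolation inequality, in additive form. -/
theorem landau {g g' g'' : ℝ → ℝ} (h1 : ∀ x, HasDerivAt g (g' x) x)
    (h2 : ∀ x, HasDerivAt g' (g'' x) x) {e M η : ℝ} (he : ∀ x, |g x| ≤ e)
    (hM : ∀ x, |g'' x| ≤ M) (hη : 0 < η) (x : ℝ) : |g' x| ≤ 2 * e / η + η * M := by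
  obtain ⟨c, hc, hcd⟩ := exists_hasDerivAt_eq_slope g g' (show x < x + η by linarith)
    (fun y _ => (h1 y).continuousAt.continuousWithinAt) (fun y _ => h1 y)
  have a1 : |g' c| ≤ 2 * e / η := by
    rw [hcd, abs_div, add_sub_cancel_left, abs_of_pos hη]
    gcongr
    have := abs_sub (g (x + η)) (g x)
    linarith [he x, he (x + η)]
  have a2 : |g' x - g' c| ≤ M * |x - c| := by
    have := Convex.norm_image_sub_le_of_norm_hasDerivWithin_le (f := g') (C := M) (s := univ)
      (x := c) (y := x) (fun y _ => (h2 y).hasDerivWithinAt) (fun y _ => hM y)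
      convex_univ (mem_univ _) (mem_univ _)
    simpa using this
  have a3 : |x - c| ≤ η := by rw [abs_le]; constructor <;> linarith [hc.1, hc.2]
  have hM0 : 0 ≤ M := (abs_nonneg _).trans (hM x)
  have a4 : M * |x - c| ≤ η * M := by rw [mul_comm]; gcongr
  have := abs_sub_abs_le_abs_sub (g' x) (g' c)
  linarith

theorem smooth_of_hasDerivAt_seq {v : ℕ → ℝ → ℝ} (h : ∀ k x, HasDerivAt (v k) (v (k + 1) x) x) :
    ContDiff ℝ ∞ (v 0) ∧ ∀ k, iteratedDeriv k (v 0) = v k := by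
  have e : ∀ k, iteratedDeriv k (v 0) = v k := by
    intro k
    induction k with
    | zero => simp
    | succ k ih => rw [iteratedDeriv_succ, ih]; funext x; exact (h k x).deriv
  refine ⟨?_, e⟩
  refine contDiff_of_differentiable_iteratedDeriv fun k _ => ?_
  rw [e]
  exact fun x => (h k x).differentiableAt

theorem exists_smooth_limit {p : ℕ → ℝ → ℝ} (hp : ∀ n, ContDiff ℝ ∞ (p n))
    (hb : ∀ k, ∃ M, ∀ n x, |iteratedDeriv k (p n) x| ≤ M) {C θ : ℝ} (hθ0 : 0 < θ) (hθ : θ < 1)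
    (hc : ∀ n x, |p (n + 1) x - p n x| ≤ C * θ ^ n) :
    ∃ q : ℝ → ℝ, ContDiff ℝ ∞ q ∧
      ∀ k x, Tendsto (fun n => iteratedDeriv k (p n) x) atTop (𝓝 (iteratedDeriv k q x)) := by
  have geo : ∀ k, ∃ C' ρ : ℝ, 0 < ρ ∧ ρ < 1 ∧ ∀ n x,
      |iteratedDeriv k (p (n + 1)) x - iteratedDeriv k (p n) x| ≤ C' * ρ ^ n := by
    intro k
    induction k with
    | zero => exact ⟨C, θ, hθ0, hθ, by simpa using hc⟩
    | succ k ih =>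
      obtain ⟨C', ρ, h0, h1, h⟩ := ih
      obtain ⟨M, hM⟩ := hb (k + 2)
      refine ⟨2 * C' + (M + M), √ρ, Real.sqrt_pos.2 h0, by rwa [Real.sqrt_lt' one_pos, one_pow],
        fun n x => ?_⟩
      have := landau (g := fun x => iteratedDeriv k (p (n + 1)) x - iteratedDeriv k (p n) x)
        (fun x => (smooth_iter_hasDerivAt (hp (n + 1)) k x).sub
          (smooth_iter_hasDerivAt (hp n) k x))
        (fun x => (smooth_iter_hasDerivAt (hp (n + 1)) (k + 1) x).sub
          (smooth_iter_hasDerivAt (hp n) (k + 1) x)) (h n) (M := M + M)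
        (fun x => (abs_sub _ _).trans (add_le_add (hM _ x) (hM _ x)))
        (pow_pos (Real.sqrt_pos.2 h0) n) x
      refine this.trans (le_of_eq ?_)
      have e : ρ ^ n = √ρ ^ n * √ρ ^ n := by rw [← mul_pow, Real.mul_self_sqrt h0.le]
      have : √ρ ^ n ≠ 0 := (pow_pos (Real.sqrt_pos.2 h0) n).ne'
      rw [e]
      field_simp
  have lim : ∀ k x, ∃ y, Tendsto (fun n => iteratedDeriv k (p n) x) atTop (𝓝 y) := by
    intro k x
    obtain ⟨C', ρ, h0, h1, h⟩ := geo k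
    refine cauchySeq_tendsto_of_complete (cauchySeq_of_le_geometric ρ C' h1 fun n => ?_)
    rw [dist_comm, Real.dist_eq]
    exact h n x
  choose v hv using lim
  have unif : ∀ k, TendstoUniformly (fun n => iteratedDeriv k (p n)) (v k) atTop := by
    intro k
    obtain ⟨C', ρ, h0, h1, h⟩ := geo k
    rw [Metric.tendstoUniformly_iff]
    intro ε hε
    have ht : Tendsto (fun n : ℕ => C' * ρ ^ n / (1 - ρ)) atTop (𝓝 0) := by
      have := ((tendsto_pow_atTop_nhds_zero_of_lt_one h0.le h1).const_mul C').div_const (1 - ρ)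
      simpa using this
    filter_upwards [ht.eventually_lt_const hε] with n hn x
    rw [dist_comm]
    refine (dist_le_of_le_geometric_of_tendsto ρ C' h1 (fun n => ?_) (hv k x) n).trans_lt hn
    rw [dist_comm, Real.dist_eq]
    exact h n x
  have hd : ∀ k x, HasDerivAt (v k) (v (k + 1) x) x := fun k x =>
    hasDerivAt_of_tendstoUniformly (unif (k + 1))
      (Eventually.of_forall fun n y => smooth_iter_hasDerivAt (hp n) k y)
      (fun y => hv k y) x
  obtain ⟨h1, h2⟩ := smooth_of_hasDerivAt_seq hd
  exact ⟨v 0, h1, fun k x => by rw [h2]; exact hv k x⟩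

theorem Bd.of_tendsto {p : ℕ → ℝ → ℝ} {q : ℝ → ℝ} (hq : ContDiff ℝ ∞ q)
    (h : ∀ k x, Tendsto (fun n => iteratedDeriv k (p n) x) atTop (𝓝 (iteratedDeriv k q x)))
    {r : ℕ} {M : ℝ} (hb : ∀ n, Bd r M (p n)) : Bd r M q :=
  ⟨hq, fun x k hk => le_of_tendsto' (h k x).abs fun n => (hb n).2 x k hk⟩

end Limit

section Periodic

theorem iteratedDeriv_shift_const (k : ℕ) (u : ℝ → ℝ) (c x : ℝ) :
    iteratedDeriv k (fun x => u (x + c)) x = iteratedDeriv k u (x + c) := by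
  have := iteratedDeriv_comp_add_const k u c
  exact congrFun this x

theorem Function.Periodic.iteratedDeriv' {P : ℝ → ℝ} {c : ℝ} (h : Function.Periodic P c) (k : ℕ) :
    Function.Periodic (iteratedDeriv k P) c := fun x => by
  rw [← iteratedDeriv_shift_const]
  congr 1
  funext y
  exact h y

/-- The `1`-periodic function agreeing with `U` on `[B, B + 1)`. -/
def periodize (B : ℝ) (U : ℝ → ℝ) : ℝ → ℝ := fun s => U (B + Int.fract (s - B))

theorem periodize_periodic (B : ℝ) (U : ℝ → ℝ) : Function.Periodic (periodize B U) 1 := fun s => by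
  rw [periodize, periodize, show s + 1 - B = s - B + 1 by ring, Int.fract_add_one]

theorem periodize_eq {B : ℝ} {U : ℝ → ℝ} (h : ∀ s ∈ Icc B (B + 1), U (s + 1) = U s) {s : ℝ} (n : ℤ)
    (hs : s - n ∈ Ico B (B + 2)) : periodize B U s = U (s - n) := by
  have hf := Int.floor_le (s - B)
  have hf' := Int.lt_floor_add_one (s - B)
  have : n = ⌊s - B⌋ ∨ n = ⌊s - B⌋ - 1 := by
    have h1 : (n : ℝ) < ⌊s - B⌋ + 1 := by linarith [hs.1]
    have h2 : ((⌊s - B⌋ : ℤ) : ℝ) < n + 2 := by linarith [hs.2]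
    have h1' : n < ⌊s - B⌋ + 1 := by exact_mod_cast h1
    have h2' : ⌊s - B⌋ < n + 2 := by exact_mod_cast h2
    omega
  have e : B + Int.fract (s - B) = s - ⌊s - B⌋ := by rw [Int.fract]; ring
  rw [periodize, e]
  rcases this with rfl | rfl
  · rfl
  · push_cast
    rw [show s - ((⌊s - B⌋ : ℝ) - 1) = s - ⌊s - B⌋ + 1 by ring, h]
    constructor <;> linarith

theorem periodize_smooth {B : ℝ} {U : ℝ → ℝ} (hU : ContDiff ℝ ∞ U)
    (h : ∀ s ∈ Icc B (B + 1), U (s + 1) = U s) : ContDiff ℝ ∞ (periodize B U) ∧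
      ∀ s, ∃ x ∈ Ico B (B + 2), ∀ k, iteratedDeriv k (periodize B U) s = iteratedDeriv k U x := by
  have key : ∀ s : ℝ, ∃ n : ℤ, s - (n : ℝ) ∈ Ioo B (B + 2) ∧
      periodize B U =ᶠ[𝓝 s] fun s => U (s + (-n : ℝ)) := by
    intro s
    refine ⟨⌊s - B - 1 / 2⌋, ?_, ?_⟩
    · constructor <;> linarith [Int.floor_le (s - B - 1 / 2), Int.lt_floor_add_one (s - B - 1 / 2)]
    · have ho : IsOpen {x : ℝ | x - (⌊s - B - 1 / 2⌋ : ℝ) ∈ Ioo B (B + 2)} :=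
        isOpen_Ioo.preimage (continuous_id.sub continuous_const)
      refine Filter.eventuallyEq_of_mem (ho.mem_nhds ?_) ?_
      · constructor <;>
          linarith [Int.floor_le (s - B - 1 / 2), Int.lt_floor_add_one (s - B - 1 / 2)]
      · intro x hx
        simp only
        rw [periodize_eq h ⌊s - B - 1 / 2⌋ ⟨hx.1.le, hx.2⟩, sub_eq_add_neg]
  constructor
  · rw [contDiff_iff_contDiffAt]
    intro s
    obtain ⟨n, -, hn⟩ := key s
    exact (hU.comp (contDiff_id.add contDiff_const)).contDiffAt.congr_of_eventuallyEq hn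
  · intro s
    obtain ⟨n, hs, hn⟩ := key s
    refine ⟨s - n, ⟨hs.1.le, hs.2⟩, fun k => ?_⟩
    rw [Filter.EventuallyEq.iteratedDeriv_eq k hn, iteratedDeriv_shift_const, sub_eq_add_neg]

theorem periodize_bd {B : ℝ} {U : ℝ → ℝ} (hU : ContDiff ℝ ∞ U)
    (h : ∀ s ∈ Icc B (B + 1), U (s + 1) = U s) {r : ℕ} {M : ℝ}
    (hM : ∀ x ∈ Ico B (B + 2), BdAt r M U x) :
    Bd r M (periodize B U) := by
  obtain ⟨h1, h2⟩ := periodize_smooth hU h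
  refine ⟨h1, fun s k hk => ?_⟩
  obtain ⟨x, hx, hk'⟩ := h2 s
  rw [hk']
  exact hM x hx k hk

theorem periodic_bound_of_deriv {g g' : ℝ → ℝ} (h : ∀ x, HasDerivAt g (g' x) x)
    (hper : Function.Periodic g 1) {c : ℝ} (hc : g c = 0) {t : ℝ} (ht : ∀ x, |g' x| ≤ t) (x : ℝ) :
    |g x| ≤ t := by
  have ht0 : 0 ≤ t := (abs_nonneg _).trans (ht 0)
  have e : g x = g (c + Int.fract (x - c)) := by
    rw [← hper.sub_int_mul_eq ⌊x - c⌋, Int.fract]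
    congr 1
    ring
  have := Convex.norm_image_sub_le_of_norm_hasDerivWithin_le (f := g) (C := t) (s := univ)
      (x := c) (y := c + Int.fract (x - c)) (fun y _ => (h y).hasDerivWithinAt) (fun y _ => ht y)
      convex_univ (mem_univ _) (mem_univ _)
  rw [hc, sub_zero, add_sub_cancel_left, Real.norm_eq_abs, Real.norm_eq_abs,
    abs_of_nonneg (Int.fract_nonneg (x - c))] at this
  rw [e]
  refine this.trans (mul_le_of_le_one_right ht0 (Int.fract_lt_one _).le)

theorem Bd.of_periodic {P : ℝ → ℝ} (hP : ContDiff ℝ ∞ P) (hper : Function.Periodic P 1)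
    (h0 : P 0 = 0) {r : ℕ} {t : ℝ} (ht : ∀ x, |iteratedDeriv r P x| ≤ t) : Bd r t P := by
  refine ⟨hP, fun x => ?_⟩
  have key : ∀ j ≤ r, ∀ x, |iteratedDeriv (r - j) P x| ≤ t := by
    intro j
    induction j with
    | zero => simpa using ht
    | succ j ih =>
      intro hj x
      have ih := ih (by omega)
      obtain ⟨k, hk⟩ : ∃ k, r - j = k + 1 := ⟨r - j - 1, by omega⟩
      rw [hk] at ih
      rw [show r - (j + 1) = k by omega]
      have hz : ∃ c, iteratedDeriv k P c = 0 := by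
        rcases k with _ | k
        · exact ⟨0, by simpa using h0⟩
        · obtain ⟨c, -, hc⟩ := exists_hasDerivAt_eq_zero (f := iteratedDeriv k P)
            (f' := iteratedDeriv (k + 1) P) (a := 0) (b := 1) one_pos
            (fun y _ => (smooth_iter_hasDerivAt hP k y).continuousAt.continuousWithinAt)
            (by have := hper.iteratedDeriv' k 0; simpa using this.symm)
            (fun y _ => smooth_iter_hasDerivAt hP k y)
          exact ⟨c, hc⟩
      obtain ⟨c, hc⟩ := hz
      exact periodic_bound_of_deriv (smooth_iter_hasDerivAt hP k) (hper.iteratedDeriv' k) hc ih x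
  intro k hk
  have := key (r - k) (by omega) x
  rwa [Nat.sub_sub_self hk] at this

end Periodic

section BoundedSmooth

/-- `u` is smooth with all derivatives bounded. -/
def Bb (u : ℝ → ℝ) : Prop := ∀ r, ∃ M, Bd r M u

variable {u v w : ℝ → ℝ}

theorem Bb.smooth (h : Bb u) : ContDiff ℝ ∞ u := (h 0).choose_spec.1

theorem Bd.succ {r : ℕ} {M : ℝ} (h0 : ∀ x, |u x| ≤ M) (hu : ContDiff ℝ ∞ u)
    (h : Bd r M (_root_.deriv u)) : Bd (r + 1) M u :=
  ⟨hu, fun x => (h.2 x).of_deriv (h0 x)⟩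

theorem Bb.of_deriv {c : ℝ} (hu : ContDiff ℝ ∞ u) (h0 : ∀ x, |u x| ≤ c) (h : Bb (_root_.deriv u)) :
    Bb u := fun r => by
  obtain ⟨M, hM⟩ := h r
  refine ⟨max c M, (Bd.succ (fun x => (h0 x).trans (le_max_left _ _)) hu
    (hM.mono le_rfl (le_max_right _ _))).mono (Nat.le_succ _) le_rfl⟩

theorem Bb.of_support {a b : ℝ} (hu : ContDiff ℝ ∞ u) (h : ∀ x ∉ Icc a b, u x = 0) : Bb u := by
  have hc : HasCompactSupport u := HasCompactSupport.intro isCompact_Icc h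
  have hck : ∀ k, HasCompactSupport (iteratedDeriv k u) := fun k => by
    induction k with
    | zero => simpa using hc
    | succ k ih => rw [iteratedDeriv_succ]; exact ih.deriv
  intro r
  have : ∀ k, ∃ C, ∀ x, |iteratedDeriv k u x| ≤ C := fun k =>
    (hck k).exists_bound_of_continuous (smooth_iter hu k).continuous
  choose C hC using this
  refine ⟨∑ k ∈ Finset.range (r + 1), |C k|, hu, fun x k hk => ?_⟩
  refine ((hC k x).trans (le_abs_self _)).trans ?_
  exact Finset.single_le_sum (f := fun k => |C k|) (fun i _ => abs_nonneg _)
    (Finset.mem_range.2 (by omega))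

theorem Bb.add (h : Bb u) (h' : Bb v) : Bb (fun x => u x + v x) := fun r => by
  obtain ⟨M, hM⟩ := h r
  obtain ⟨N, hN⟩ := h' r
  exact ⟨_, hM.add hN⟩

theorem Bb.mul (h : Bb u) (h' : Bb v) : Bb (fun x => u x * v x) := fun r => by
  obtain ⟨M, hM⟩ := h r
  obtain ⟨N, hN⟩ := h' r
  exact ⟨_, hM.mul hN⟩

theorem Bb.const (c : ℝ) : Bb (fun _ => c) := fun _ => ⟨|c|, Bd.const le_rfl⟩

theorem Bb.deriv (h : Bb u) : Bb (deriv u) := fun r => by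
  obtain ⟨M, hM⟩ := h (r + 1)
  exact ⟨M, hM.deriv⟩

theorem smooth_cut {κ F : ℝ → ℝ} {s : Set ℝ} (hs : IsClosed s) (hκ : ContDiff ℝ ∞ κ)
    (h0 : ∀ x ∉ s, κ x = 0) (hF : ∀ x ∈ s, ContDiffAt ℝ ∞ F x) :
    ContDiff ℝ ∞ (fun x => κ x * F x) := by
  rw [contDiff_iff_contDiffAt]
  intro x
  by_cases hx : x ∈ s
  · exact hκ.contDiffAt.mul (hF x hx)
  · have : (fun x => κ x * F x) =ᶠ[𝓝 x] fun _ => 0 := by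
      filter_upwards [hs.isOpen_compl.mem_nhds hx] with y hy
      rw [h0 y hy, zero_mul]
    exact contDiffAt_const.congr_of_eventuallyEq this

/-- Smooth step: `0` on `(-∞, a]`, `1` on `[b, ∞)`. -/
def stp (a b : ℝ) (x : ℝ) : ℝ := Real.smoothTransition ((x - a) / (b - a))

theorem stp_zero {a b x : ℝ} (hab : a < b) (h : x ≤ a) : stp a b x = 0 :=
  Real.smoothTransition.zero_of_nonpos
    (div_nonpos_of_nonpos_of_nonneg (by linarith) (by linarith))

theorem stp_one {a b x : ℝ} (hab : a < b) (h : b ≤ x) : stp a b x = 1 :=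
  Real.smoothTransition.one_of_one_le ((one_le_div (by linarith)).2 (by linarith))

theorem stp_nonneg (a b x : ℝ) : 0 ≤ stp a b x := Real.smoothTransition.nonneg _

theorem stp_le_one (a b x : ℝ) : stp a b x ≤ 1 := Real.smoothTransition.le_one _

theorem stp_smooth (a b : ℝ) : ContDiff ℝ ∞ (stp a b) :=
  Real.smoothTransition.contDiff.comp ((contDiff_id.sub contDiff_const).div_const _)

theorem stp_bb {a b : ℝ} (hab : a < b) : Bb (stp a b) := by
  refine Bb.of_deriv (c := 1) (stp_smooth a b) (fun x => ?_) ?_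
  · rw [abs_of_nonneg (stp_nonneg _ _ _)]; exact stp_le_one _ _ _
  · refine Bb.of_support (a := a) (b := b) (smooth_deriv (stp_smooth a b)) fun x hx => ?_
    rw [mem_Icc, not_and_or, not_le, not_le] at hx
    rcases hx with hx | hx
    · have : stp a b =ᶠ[𝓝 x] fun _ => 0 := by
        filter_upwards [Iio_mem_nhds hx] with y hy
        exact stp_zero hab (le_of_lt hy)
      rw [this.deriv_eq, deriv_const]
    · have : stp a b =ᶠ[𝓝 x] fun _ => 1 := by
        filter_upwards [Ioi_mem_nhds hx] with y hy
        exact stp_one hab (le_of_lt hy)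
      rw [this.deriv_eq, deriv_const]

/-- Smooth plateau: `1` on `[b, c]`, `0` off `(a, d)`. -/
def plat (a b c d : ℝ) (x : ℝ) : ℝ := stp a b x * (1 - stp c d x)

theorem plat_one {a b c d x : ℝ} (hab : a < b) (hcd : c < d) (hx : x ∈ Icc b c) :
    plat a b c d x = 1 := by
  rw [plat, stp_one hab hx.1, stp_zero hcd hx.2]; norm_num

theorem plat_zero {a b c d x : ℝ} (hab : a < b) (hcd : c < d) (hx : x ∉ Ioo a d) :
    plat a b c d x = 0 := by
  rw [mem_Ioo, not_and_or, not_lt, not_lt] at hx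
  rcases hx with hx | hx
  · rw [plat, stp_zero hab hx, zero_mul]
  · rw [plat, stp_one hcd hx, sub_self, mul_zero]

theorem plat_smooth (a b c d : ℝ) : ContDiff ℝ ∞ (plat a b c d) :=
  (stp_smooth a b).mul (contDiff_const.sub (stp_smooth c d))

theorem plat_zero_Icc {a b c d x : ℝ} (hab : a < b) (hcd : c < d) (hx : x ∉ Icc a d) :
    plat a b c d x = 0 := plat_zero hab hcd fun h => hx ⟨h.1.le, h.2.le⟩

theorem plat_bb {a b c d : ℝ} (hab : a < b) (hcd : c < d) : Bb (plat a b c d) :=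
  Bb.of_support (plat_smooth a b c d) fun _ hx => plat_zero_Icc hab hcd hx

theorem plat_nonneg (a b c d x : ℝ) : 0 ≤ plat a b c d x :=
  mul_nonneg (stp_nonneg _ _ _) (by linarith [stp_le_one c d x])

/-- A function smooth near `[b, c]` agrees there with a smooth function with bounded derivatives. -/
theorem cut_bb {a b c d : ℝ} (hab : a < b) (hcd : c < d) {F : ℝ → ℝ}
    (hF : ∀ x ∈ Icc a d, ContDiffAt ℝ ∞ F x) : Bb (fun x => plat a b c d x * F x) :=
  Bb.of_support (smooth_cut isClosed_Icc (plat_smooth a b c d)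
    (fun _ hx => plat_zero_Icc hab hcd hx) hF) fun x hx => by
      rw [plat_zero_Icc hab hcd hx, zero_mul]

theorem Bb.dinv (h : Bb u) (h' : ∀ x, |_root_.deriv u x| ≤ 1 / 4) : Bb (dinv u) := fun r => by
  obtain ⟨M, hM⟩ := h r
  obtain ⟨C, -, hC⟩ := dinv_bound r M
  exact ⟨_, hC M u le_rfl hM h'⟩

end BoundedSmooth

section SmallFamilies

variable {ι : Type*}

/-- The family `u` tends to `0` uniformly with all its derivatives along `l`. -/
def Sml (l : Filter ι) (u : ι → ℝ → ℝ) : Prop := ∀ r, ∀ ε > 0, ∀ᶠ i in l, Bd r ε (u i)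

/-- The family `u` is eventually bounded with all its derivatives along `l`. -/
def Evb (l : Filter ι) (u : ι → ℝ → ℝ) : Prop := ∀ r, ∃ M, ∀ᶠ i in l, Bd r M (u i)

variable {l : Filter ι} {u v w : ι → ℝ → ℝ}

theorem Sml.evb (h : Sml l u) : Evb l u := fun r => ⟨1, h r 1 one_pos⟩

theorem Bb.evb {a : ℝ → ℝ} (h : Bb a) : Evb l (fun _ => a) := fun r =>
  ⟨_, Eventually.of_forall fun _ => (h r).choose_spec⟩

theorem Sml.smooth (h : Sml l u) : ∀ᶠ i in l, ContDiff ℝ ∞ (u i) :=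
  (h 0 1 one_pos).mono fun _ hi => hi.1

theorem Sml.congr (h : Sml l u) (e : ∀ᶠ i in l, u i = v i) : Sml l v := fun r ε hε => by
  filter_upwards [h r ε hε, e] with i h1 h2
  rwa [← h2]

/-- If `v` is controlled linearly by `u`, then `v` is small. -/
theorem Sml.map (hu : Sml l u) (h : ∀ r, ∃ (s : ℕ) (C δ : ℝ), 0 < δ ∧
    ∀ᶠ i in l, ∀ M ≤ δ, Bd s M (u i) → Bd r (C * M) (v i)) : Sml l v := fun r ε hε => by
  obtain ⟨s, C, δ, hδ, h⟩ := h r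
  have hC : 0 < |C| + 1 := by positivity
  have hm : 0 < min δ (ε / (|C| + 1)) := by positivity
  filter_upwards [h, hu s _ hm] with i h1 h2
  refine (h1 _ (min_le_left _ _) h2).mono le_rfl ?_
  have h3 : min δ (ε / (|C| + 1)) ≤ ε / (|C| + 1) := min_le_right _ _
  calc C * min δ (ε / (|C| + 1)) ≤ (|C| + 1) * (ε / (|C| + 1)) := by
        gcongr; linarith [le_abs_self C]
    _ = ε := by field_simp

theorem Sml.add (hu : Sml l u) (hv : Sml l v) : Sml l (fun i x => u i x + v i x) :=
  fun r ε hε => by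
    filter_upwards [hu r (ε / 2) (by positivity), hv r (ε / 2) (by positivity)] with i h1 h2
    exact (h1.add h2).mono le_rfl (by linarith)

theorem Sml.neg (hu : Sml l u) : Sml l (fun i x => - u i x) :=
  fun r ε hε => (hu r ε hε).mono fun _ h => h.neg

theorem Sml.sub (hu : Sml l u) (hv : Sml l v) : Sml l (fun i x => u i x - v i x) :=
  fun r ε hε => by
    filter_upwards [hu r (ε / 2) (by positivity), hv r (ε / 2) (by positivity)] with i h1 h2
    exact (h1.sub h2).mono le_rfl (by linarith)

theorem Sml.const {c : ι → ℝ} (hc : Tendsto c l (𝓝 0)) : Sml l (fun i _ => c i) :=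
  fun r ε hε => by
    have := (tendsto_zero_iff_abs_tendsto_zero _).1 hc
    filter_upwards [this.eventually_le_const hε] with i hi
    exact Bd.const hi

theorem Sml.zero : Sml l (fun _ _ => 0) := Sml.const tendsto_const_nhds

theorem Sml.eval (hu : Sml l u) (x : ℝ) : Tendsto (fun i => u i x) l (𝓝 0) := by
  rw [Metric.tendsto_nhds]
  intro ε hε
  filter_upwards [hu 0 (ε / 2) (by positivity)] with i hi
  rw [Real.dist_eq, sub_zero]
  exact (hi.2 x).zero_apply.trans_lt (by linarith)

theorem Sml.mul_evb (hu : Sml l u) (hv : Evb l v) : Sml l (fun i x => u i x * v i x) :=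
  hu.map fun r => by
    obtain ⟨N, hN⟩ := hv r
    refine ⟨r, 2 ^ r * N, 1, one_pos, hN.mono fun i hi M _ hM => ?_⟩
    exact (hM.mul hi).mono le_rfl (by linarith)

theorem Sml.mul_bb (hu : Sml l u) {a : ℝ → ℝ} (ha : Bb a) :
    Sml l (fun i x => a x * u i x) := by
  simpa only [mul_comm] using hu.mul_evb (v := fun _ => a) ha.evb

theorem Sml.const_mul (hu : Sml l u) (c : ℝ) : Sml l (fun i x => c * u i x) :=
  hu.mul_bb (Bb.const c)

theorem Sml.comp (hu : Sml l u) (hw : Evb l w) : Sml l (fun i x => u i (x + w i x)) :=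
  hu.map fun r => by
    obtain ⟨N, hN⟩ := hw r
    obtain ⟨C, -, hC⟩ := comp_bound r N
    refine ⟨r, C, 1, one_pos, hN.mono fun i hi M _ hM => ?_⟩
    exact ⟨smooth_shift hM.1 hi.1, fun x => hC M _ _ x hM.1 hi.1 (hM.2 _) (hi.2 _)⟩

theorem Evb.comp (hu : Evb l u) (hw : Evb l w) : Evb l (fun i x => u i (x + w i x)) := fun r => by
  obtain ⟨N, hN⟩ := hw r
  obtain ⟨M, hM⟩ := hu r
  obtain ⟨C, -, hC⟩ := comp_bound r N
  refine ⟨C * M, ?_⟩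
  filter_upwards [hN, hM] with i hi hM
  exact ⟨smooth_shift hM.1 hi.1, fun x => hC M _ _ x hM.1 hi.1 (hM.2 _) (hi.2 _)⟩

theorem Evb.add (hu : Evb l u) (hw : Evb l w) : Evb l (fun i x => u i x + w i x) := fun r => by
  obtain ⟨N, hN⟩ := hw r
  obtain ⟨M, hM⟩ := hu r
  refine ⟨M + N, ?_⟩
  filter_upwards [hN, hM] with i hi hM
  exact hM.add hi

theorem Sml.comp_close (hw : Sml l w) {F : ℝ → ℝ} (hF : Bb F) :
    Sml l (fun i x => F (x + w i x) - F x) :=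
  hw.map fun r => by
    obtain ⟨M, hM⟩ := hF (r + 1)
    obtain ⟨C, -, hC⟩ := _root_.comp_close r
    exact ⟨r, C * M, 1, one_pos, Eventually.of_forall fun i N hN h => hC M N F _ hM h hN⟩

theorem Sml.dinv (hu : Sml l u) : Sml l (fun i => dinv (u i)) :=
  hu.map fun r => by
    obtain ⟨C, -, hC⟩ := dinv_bound r 1
    refine ⟨r, C, 1, one_pos, ?_⟩
    filter_upwards [hu 1 (1 / 4) (by norm_num)] with i hi M hM h
    exact hC M _ hM h fun x => (hi.2 x).deriv_apply

theorem comp_fixed_bound (r : ℕ) {a : ℝ → ℝ} (ha : ContDiff ℝ ∞ a) (ha' : Bb (deriv a)) :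
    ∃ C, 1 ≤ C ∧ ∀ (M : ℝ) (u : ℝ → ℝ), Bd r M u → Bd r (C * M) (fun x => u (a x)) := by
  induction r with
  | zero =>
    refine ⟨1, le_rfl, fun M u h => ⟨h.1.comp ha, fun x k hk => ?_⟩⟩
    obtain rfl : k = 0 := by omega
    simpa using (h.2 (a x)).zero_apply
  | succ r ih =>
    obtain ⟨C, hC, ih⟩ := ih
    obtain ⟨N, hN⟩ := ha' r
    refine ⟨max 1 (2 ^ r * C * N), le_max_left _ _, fun M u h => ?_⟩
    have hM := h.nonneg
    refine Bd.succ (fun x => ?_) (h.1.comp ha) ?_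
    · exact (h.2 (a x)).zero_apply.trans (le_mul_of_one_le_left hM (le_max_left _ _))
    · have e : deriv (fun x => u (a x)) = fun x => deriv u (a x) * deriv a x := by
        funext x
        exact ((smooth_diff h.1 (a x)).hasDerivAt.comp x (smooth_diff ha x).hasDerivAt).deriv
      rw [e]
      refine ((ih M _ h.deriv).mul hN).mono le_rfl ?_
      calc 2 ^ r * (C * M) * N = (2 ^ r * C * N) * M := by ring
        _ ≤ _ := by gcongr; exact le_max_right _ _

theorem Sml.comp_fixed (hu : Sml l u) {a : ℝ → ℝ} (ha : ContDiff ℝ ∞ a)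
    (ha' : Bb (deriv a)) : Sml l (fun i x => u i (a x)) :=
  hu.map fun r => by
    obtain ⟨C, -, hC⟩ := comp_fixed_bound r ha ha'
    exact ⟨r, C, 1, one_pos, Eventually.of_forall fun i M _ h => hC M _ h⟩

theorem Sml.comp_affine (hu : Sml l u) (p q : ℝ) : Sml l (fun i x => u i (p * x + q)) := by
  refine hu.comp_fixed (a := fun x => p * x + q)
    ((contDiff_const.mul contDiff_id).add contDiff_const) ?_
  have : deriv (fun x : ℝ => p * x + q) = fun _ => p := by
    funext x; simp
  rw [this]
  exact Bb.const p

theorem Sml.left_comp (hu : Sml l u) {F : ℝ → ℝ} (hF : ContDiff ℝ ∞ F) (h0 : F 0 = 0) :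
    Sml l (fun i x => F (u i x)) := by
  have hF1 : Bb (fun x => plat (-2) (-1) 1 2 x * F x) :=
    cut_bb (by norm_num) (by norm_num) fun x _ => hF.contDiffAt
  set F1 := fun x => plat (-2) (-1) 1 2 x * F x
  have key : ∀ (r : ℕ) (F : ℝ → ℝ), Bb F → ∃ C, 1 ≤ C ∧ ∀ u, Bd r 1 u →
      Bd r C (fun x => F (u x)) := by
    intro r
    induction r with
    | zero =>
      intro F hF
      obtain ⟨C, hC⟩ := hF 0
      refine ⟨max 1 C, le_max_left _ _, fun u hu => ⟨hF.smooth.comp hu.1, fun x k hk => ?_⟩⟩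
      obtain rfl : k = 0 := by omega
      simpa using Or.inr (hC.2 (u x)).zero_apply
    | succ r ih =>
      intro F hF
      obtain ⟨C1, hC1, h1⟩ := ih _ hF.deriv
      obtain ⟨C, hC⟩ := hF 0
      refine ⟨max 1 (max C (2 ^ r * C1 * 1)), le_max_left _ _, fun u hu => ?_⟩
      refine Bd.succ (fun x => ?_) (hF.smooth.comp hu.1) ?_
      · exact (hC.2 (u x)).zero_apply.trans (le_max_of_le_right (le_max_left _ _))
      · have e : deriv (fun x => F (u x)) = fun x => deriv F (u x) * deriv u x := by
          funext x
          exact ((smooth_diff hF.smooth (u x)).hasDerivAt.comp x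
            (smooth_diff hu.1 x).hasDerivAt).deriv
        rw [e]
        exact ((h1 u (hu.mono (Nat.le_succ _) le_rfl)).mul hu.deriv).mono le_rfl
          (le_max_of_le_right (le_max_right _ _))
  have h1 : Sml l (fun i x => F1 (u i x)) := hu.map fun r => by
    obtain ⟨C, hC, h⟩ := key r _ hF1.deriv
    refine ⟨r + 1, 2 ^ r * C, 1, one_pos, Eventually.of_forall fun i M hM1 hM => ?_⟩
    have hM0 := hM.nonneg
    refine Bd.mono (r := r + 1) ?_ (Nat.le_succ _) le_rfl
    refine Bd.succ (fun x => ?_) (hF1.smooth.comp hM.1) ?_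
    · have := Convex.norm_image_sub_le_of_norm_deriv_le (f := F1) (C := C) (s := Icc (-1) 1)
        (x := 0) (y := u i x) (fun y _ => smooth_diff hF1.smooth y) (fun y hy => ?_)
        (convex_Icc _ _) (by norm_num)
        (by have := abs_le.1 ((hM.2 x).zero_apply.trans hM1); exact this)
      · have e : F1 0 = 0 := by simp [F1, h0]
        rw [e, sub_zero, sub_zero, Real.norm_eq_abs, Real.norm_eq_abs] at this
        have h2 := (hM.2 x).zero_apply
        calc |F1 (u i x)| ≤ C * |u i x| := this
          _ ≤ C * M := by gcongr
          _ ≤ 2 ^ r * C * M := by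
            gcongr
            exact le_mul_of_one_le_left (by linarith) (one_le_pow₀ (by norm_num))
      · have := (h (fun _ => y) (Bd.const (abs_le.2 hy))).2 0
        exact this.zero_apply
    · have e : deriv (fun x => F1 (u i x)) = fun x => deriv F1 (u i x) * deriv (u i) x := by
        funext x
        exact ((smooth_diff hF1.smooth (u i x)).hasDerivAt.comp x
          (smooth_diff hM.1 x).hasDerivAt).deriv
      rw [e]
      exact (h _ (hM.mono (Nat.le_succ _) hM1)).mul hM.deriv
  refine h1.congr ?_
  filter_upwards [hu 0 1 one_pos] with i hi
  funext x
  have := abs_le.1 (hi.2 x).zero_apply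
  simp only [F1]
  rw [plat_one (by norm_num) (by norm_num) this, one_mul]

theorem Sml.left_comp_at (hu : Sml l u) {F : ℝ → ℝ} {a : ℝ} (ha : 0 < a)
    (hF : ∀ x ∈ Icc (-a) a, ContDiffAt ℝ ∞ F x) (h0 : F 0 = 0) :
    Sml l (fun i x => F (u i x)) := by
  have hF1 := cut_bb (a := -a) (b := -a / 2) (c := a / 2) (d := a) (by linarith) (by linarith) hF
  have := hu.left_comp hF1.smooth (by simp [h0])
  refine this.congr ?_
  filter_upwards [hu 0 (a / 2) (by positivity)] with i hi
  funext x
  have := abs_le.1 (hi.2 x).zero_apply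
  rw [plat_one (by linarith) (by linarith) ⟨by linarith, this.2⟩, one_mul]

/-- Conjugating a fixed diffeomorphism by a small one changes it little. -/
theorem Sml.conj_fixed (hw : Sml l w) {d : ℝ → ℝ} (hd : Bb d) :
    Sml l (fun i x => (_root_.dinv (w i) x + d (x + _root_.dinv (w i) x) +
      w i (x + (_root_.dinv (w i) x + d (x + _root_.dinv (w i) x)))) - d x) := by
  have h1 := hw.dinv
  have h2 := h1.comp_close hd
  have h3 := hw.comp (h1.evb.add (hd.evb.comp h1.evb))
  refine ((h1.add h2).add h3).congr (Eventually.of_forall fun i => ?_)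
  funext x
  ring

/-- Conjugating a small diffeomorphism by a fixed one keeps it small. -/
theorem Sml.conj_by_fixed (hw : Sml l w) {d : ℝ → ℝ} (hd : Bb d)
    (hd' : ∀ x, |deriv d x| ≤ 1 / 4) :
    Sml l (fun i x => w i (x + _root_.dinv d x) + (d (x + _root_.dinv d x +
      w i (x + _root_.dinv d x)) - d (x + _root_.dinv d x))) :=
  (hw.add (hw.comp_close hd)).comp (w := fun _ => _root_.dinv d) (hd.dinv hd').evb

end SmallFamilies

section MoreBounds

theorem Bd.comp {r : ℕ} {B : ℝ} {C : ℝ}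
    (hc : ∀ (M : ℝ) (u w : ℝ → ℝ) (x : ℝ), ContDiff ℝ ∞ u → ContDiff ℝ ∞ w →
      BdAt r M u (x + w x) → BdAt r B w x → BdAt r (C * M) (fun x => u (x + w x)) x)
    {M : ℝ} {u w : ℝ → ℝ} (hu : Bd r M u) (hw : Bd r B w) :
    Bd r (C * M) (fun x => u (x + w x)) :=
  ⟨smooth_shift hu.1 hw.1, fun x => hc M u w x hu.1 hw.1 (hu.2 _) (hw.2 x)⟩

theorem Bd.shift {r : ℕ} {M : ℝ} {u : ℝ → ℝ} (hu : Bd r M u) (c : ℝ) :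
    Bd r M (fun x => u (x + c)) :=
  ⟨hu.1.comp (contDiff_id.add contDiff_const), fun x k hk => by
    rw [iteratedDeriv_shift_const]; exact hu.2 _ k hk⟩

theorem iteratedDeriv_add_smooth {u v : ℝ → ℝ} (hu : ContDiff ℝ ∞ u) (hv : ContDiff ℝ ∞ v) (k : ℕ)
    (x : ℝ) : iteratedDeriv k (fun x => u x + v x) x = iteratedDeriv k u x + iteratedDeriv k v x :=
  iteratedDeriv_add (smooth_at hu) (smooth_at hv)

theorem iteratedDeriv_sub_smooth {u v : ℝ → ℝ} (hu : ContDiff ℝ ∞ u) (hv : ContDiff ℝ ∞ v) (k : ℕ)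
    (x : ℝ) : iteratedDeriv k (fun x => u x - v x) x = iteratedDeriv k u x - iteratedDeriv k v x :=
  iteratedDeriv_sub (smooth_at hu) (smooth_at hv)

/-- Top derivative of a composition with a map close to the identity, without loss. -/
theorem comp_top_close (r : ℕ) : ∃ C, 0 ≤ C ∧ ∀ (M N : ℝ) (u w : ℝ → ℝ),
    Bd r M u → Bd r N w → N ≤ 1 → ∀ x,
    |iteratedDeriv r (fun x => u (x + w x)) x - iteratedDeriv r u (x + w x)| ≤ C * M * N := by
  induction r with
  | zero =>
    refine ⟨0, le_rfl, fun M N u w _ _ _ x => by simp⟩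
  | succ r ih =>
    obtain ⟨C, hC, ih⟩ := ih
    obtain ⟨C1, hC1, hc⟩ := comp_bound r 1
    refine ⟨C + 2 ^ r * C1, by positivity, fun M N u w hu hw hN x => ?_⟩
    have hu' := smooth_deriv hu.1
    have hw0 := hw.mono (Nat.le_succ _) le_rfl
    have h1 := ih M N (deriv u) w hu.deriv hw0 hN x
    have h2 := (Bd.comp hc hu.deriv (hw0.mono le_rfl hN)).mul hw.deriv
    have e : (fun x => deriv u (x + w x) * (1 + deriv w x)) =
        fun x => deriv u (x + w x) + deriv u (x + w x) * deriv w x := by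
      funext x; ring
    rw [iteratedDeriv_succ', deriv_shift hu.1 hw.1, e,
      iteratedDeriv_add_smooth (smooth_shift hu' hw.1) h2.1, iteratedDeriv_succ']
    have h3 := (h2.2 x).top
    rw [add_sub_right_comm]
    refine (abs_add_le _ _).trans ?_
    nlinarith

theorem cutoff_top {χ : ℝ → ℝ} (r : ℕ) (hχ : Bb χ) : ∃ C, 0 ≤ C ∧ ∀ (N : ℝ) (P : ℝ → ℝ),
    Bd r N P → ∀ x,
    |iteratedDeriv (r + 1) (fun x => χ x * P x) x - χ x * iteratedDeriv (r + 1) P x| ≤ C * N := by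
  have e : ∀ P : ℝ → ℝ, ContDiff ℝ ∞ P → deriv (fun x => χ x * P x) =
      fun x => deriv χ x * P x + χ x * deriv P x := fun P hP => by
    funext x
    exact ((smooth_diff hχ.smooth x).hasDerivAt.mul (smooth_diff hP x).hasDerivAt).deriv
  induction r with
  | zero =>
    obtain ⟨M, hM⟩ := hχ.deriv 0
    refine ⟨M, hM.nonneg, fun N P hP x => ?_⟩
    simp only [zero_add, iteratedDeriv_one]
    rw [e P hP.1, add_sub_cancel_right, abs_mul]
    have := (hM.2 x).zero_apply
    have := (hP.2 x).zero_apply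
    have := hM.nonneg
    gcongr
  | succ r ih =>
    obtain ⟨C, hC, ih⟩ := ih
    obtain ⟨M, hM⟩ := hχ.deriv (r + 1)
    have hM0 := hM.nonneg
    refine ⟨C + 2 ^ (r + 1) * M, by positivity, fun N P hP x => ?_⟩
    have h1 := ih N (deriv P) hP.deriv x
    have h2 := hM.mul hP
    rw [iteratedDeriv_succ', e P hP.1, iteratedDeriv_add_smooth h2.1
      (hχ.smooth.mul (smooth_deriv hP.1)), iteratedDeriv_succ' (n := r + 1) (f := P), add_sub_assoc]
    refine (abs_add_le _ _).trans ?_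
    have := (h2.2 x).top
    linarith

end MoreBounds

section Zeta

/-- The displacement of the cut-off lift `id + χP`. -/
def cutW (P : ℝ → ℝ) : ℝ → ℝ := fun s => stp 0 1 s * P s

/-- The displacement of `T ψ⁻¹ T⁻¹ ψ`, where `ψ = id + cutW P` and `T` is the unit translation. -/
def zeta (P : ℝ → ℝ) : ℝ → ℝ := fun s => cutW P s + dinv (cutW P) (s + (cutW P s + (-1)))

theorem cutW_small : ∃ δ : ℝ, 0 < δ ∧ δ ≤ 1 ∧ ∀ P : ℝ → ℝ, Bd 1 δ P →
    ∀ x, |deriv (cutW P) x| ≤ 1 / 4 := by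
  obtain ⟨M, hM⟩ := stp_bb zero_lt_one 1
  refine ⟨min 1 (1 / (8 * (|M| + 1))), by positivity, min_le_left _ _, fun P hP x => ?_⟩
  have hd := ((hM.mul hP).2 x).deriv_apply
  refine hd.trans ?_
  calc 2 ^ 1 * M * min 1 (1 / (8 * (|M| + 1))) ≤ 2 ^ 1 * (|M| + 1) * (1 / (8 * (|M| + 1))) := by
        gcongr
        · linarith [le_abs_self M]
        · exact min_le_right _ _
    _ = 1 / 4 := by field_simp; norm_num

theorem zeta_bound (r : ℕ) (M : ℝ) : ∃ C, 1 ≤ C ∧ ∀ (N : ℝ) (P : ℝ → ℝ), N ≤ M → Bd r N P →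
    (∀ x, |deriv (cutW P) x| ≤ 1 / 4) →
    Bd r (C * N) (cutW P) ∧ Bd r (C * N) (dinv (cutW P)) ∧ Bd r (C * N) (zeta P) := by
  obtain ⟨K, hK⟩ := stp_bb zero_lt_one r
  have hK0 := hK.nonneg
  set K1 := 2 ^ r * K + 1
  have hK1 : 1 ≤ K1 := le_add_of_nonneg_left (by positivity)
  obtain ⟨C1, hC1, h1⟩ := dinv_bound r (K1 * |M|)
  obtain ⟨C2, hC2, h2⟩ := comp_bound r (K1 * |M| + 1)
  have hm : 1 ≤ C1 * K1 := one_le_mul_of_one_le_of_one_le hC1 hK1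
  have hn : 1 ≤ C2 * (C1 * K1) := one_le_mul_of_one_le_of_one_le hC2 hm
  refine ⟨K1 + C1 * K1 + C2 * (C1 * K1), by linarith, fun N P hN hP hP' => ?_⟩
  have hN0 := hP.nonneg
  have hNM : N ≤ |M| := hN.trans (le_abs_self _)
  have a1 : Bd r (K1 * N) (cutW P) := (hK.mul hP).mono le_rfl (by
    gcongr; exact le_add_of_nonneg_right zero_le_one)
  have a2 := h1 (K1 * N) _ (by gcongr) a1 hP'
  have a3 : Bd r (K1 * |M| + 1) (fun s => cutW P s + (-1)) :=
    (a1.mono le_rfl (by gcongr)).add (Bd.const (by simp))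
  have a4 := Bd.comp h2 a2 a3
  refine ⟨a1.mono le_rfl ?_, a2.mono le_rfl ?_, (a1.add a4).mono le_rfl ?_⟩
  · gcongr; linarith
  · rw [← mul_assoc]; gcongr; linarith
  · nlinarith

theorem zeta_top (r : ℕ) (M : ℝ) : ∃ C, 0 ≤ C ∧ ∀ (N t : ℝ) (P : ℝ → ℝ), N ≤ M → Bd (r + 1) N P →
    (∀ x, |deriv (cutW P) x| ≤ 1 / 4) → (∀ x, |iteratedDeriv (r + 2) P x| ≤ t) →
    ∀ x, |iteratedDeriv (r + 2) (zeta P) x| ≤ 4 * 4 ^ (r + 2) * t + C * N := by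
  obtain ⟨C1, hC1, h1⟩ := zeta_bound (r + 1) M
  obtain ⟨C2, hC2, h2⟩ := cutoff_top (r + 1) (stp_bb zero_lt_one)
  obtain ⟨C3, hC3, h3⟩ := dinv_top r (C1 * |M|)
  obtain ⟨C4, hC4, h4⟩ := comp_top r (C1 * |M| + 1)
  refine ⟨4 * 4 ^ (r + 2) * C2 + 4 ^ (r + 2) * C3 * C1 + C4 * C1, by positivity,
    fun N t P hN hP hP' ht x => ?_⟩
  obtain ⟨a1, a2, a3⟩ := h1 N P hN hP hP'
  have hN0 := hP.nonneg
  have ht0 : 0 ≤ t := (abs_nonneg _).trans (ht 0)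
  have hNM : N ≤ |M| := hN.trans (le_abs_self _)
  set tW := t + C2 * N with htW
  have htW0 : 0 ≤ tW := by positivity
  have b1 : ∀ x, |iteratedDeriv (r + 2) (cutW P) x| ≤ tW := fun x => by
    have c1 := h2 N P hP x
    have c2 : |stp 0 1 x * iteratedDeriv (r + 2) P x| ≤ t := by
      rw [abs_mul, abs_of_nonneg (stp_nonneg _ _ _)]
      exact (mul_le_of_le_one_left (abs_nonneg _) (stp_le_one _ _ _)).trans (ht x)
    have c3 := abs_sub_abs_le_abs_sub (iteratedDeriv (r + 2) (cutW P) x)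
      (stp 0 1 x * iteratedDeriv (r + 2) P x)
    have c1' : |iteratedDeriv (r + 2) (cutW P) x - stp 0 1 x * iteratedDeriv (r + 2) P x|
      ≤ C2 * N := c1
    linarith
  have b2 := h3 (C1 * N) tW (cutW P) (by gcongr) a1 hP' b1
  set w1 : ℝ → ℝ := fun s => cutW P s + (-1) with hw1
  have a4 : Bd (r + 1) (C1 * |M| + 1) w1 :=
    (a1.mono le_rfl (by gcongr)).add (Bd.const (by simp))
  have b3 := h4 (C1 * N) (dinv (cutW P)) w1 x a2.1 a4.1 (a2.2 _) (a4.2 x)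
  have e1 : deriv w1 = deriv (cutW P) := by funext y; simp [hw1]
  have e2 : iteratedDeriv (r + 2) w1 x = iteratedDeriv (r + 2) (cutW P) x := by
    rw [iteratedDeriv_succ', e1, ← iteratedDeriv_succ']
  have b4 : |iteratedDeriv (r + 2) (dinv (cutW P)) (x + w1 x) * (1 + deriv w1 x) ^ (r + 2)| ≤
      2 * (2 ^ (r + 2) * tW + C3 * (C1 * N)) * (2 : ℝ) ^ (r + 2) / 2 := by
    rw [abs_mul, abs_pow, e1]
    have c1 := b2 (x + w1 x)
    have c2 : |1 + deriv (cutW P) x| ≤ 5 / 4 := by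
      refine (abs_add_le _ _).trans ?_
      rw [abs_one]; linarith [hP' x]
    have c3 : |1 + deriv (cutW P) x| ^ (r + 2) ≤ 2 ^ (r + 2) / 2 := by
      calc _ ≤ (5 / 4 : ℝ) ^ (r + 2) := by gcongr
        _ = (5 / 4) ^ r * (25 / 16) := by ring
        _ ≤ 2 ^ r * 2 := by gcongr <;> norm_num
        _ = _ := by ring
    calc _ ≤ 2 * (2 ^ (r + 2) * tW + C3 * (C1 * N)) * (2 ^ (r + 2) / 2) := by gcongr
      _ = _ := by ring
  have b5 : |deriv (dinv (cutW P)) (x + w1 x) * iteratedDeriv (r + 2) w1 x| ≤ tW := by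
    rw [abs_mul, e2]
    exact (mul_le_of_le_one_left (abs_nonneg _) (dinv_deriv a1.1 hP' _).2).trans (b1 x)
  have b6 : iteratedDeriv (r + 2) (zeta P) x = iteratedDeriv (r + 2) (cutW P) x +
      iteratedDeriv (r + 2) (fun x => dinv (cutW P) (x + w1 x)) x :=
    iteratedDeriv_add_smooth a1.1 (smooth_shift a2.1 a4.1) _ _
  have e4 : (4 : ℝ) ^ (r + 2) = 2 ^ (r + 2) * 2 ^ (r + 2) := by rw [← mul_pow]; norm_num
  have e5 : (1 : ℝ) ≤ 4 ^ (r + 2) := one_le_pow₀ (by norm_num)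
  have b7 : |iteratedDeriv (r + 2) (fun x => dinv (cutW P) (x + w1 x)) x| ≤
      C4 * (C1 * N) + (4 ^ (r + 2) * tW + 4 ^ (r + 2) * (C3 * (C1 * N))) + tW := by
    have c1 : 2 * (2 ^ (r + 2) * tW + C3 * (C1 * N)) * (2 : ℝ) ^ (r + 2) / 2 ≤
        4 ^ (r + 2) * tW + 4 ^ (r + 2) * (C3 * (C1 * N)) := by
      have : (2 : ℝ) ^ (r + 2) ≤ 4 ^ (r + 2) := by gcongr; norm_num
      have h0 : 0 ≤ C3 * (C1 * N) := by positivity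
      rw [e4] at *
      nlinarith [mul_le_mul_of_nonneg_right this h0]
    have c2 := b4.trans c1
    rw [abs_le] at b3 c2 b5 ⊢
    constructor <;> linarith
  rw [b6]
  refine (abs_add_le _ _).trans ?_
  have c1 : tW ≤ 4 ^ (r + 2) * tW := le_mul_of_one_le_left htW0 e5
  have c2 := b1 x
  have c3 : 4 * 4 ^ (r + 2) * tW = 4 * 4 ^ (r + 2) * t + 4 * 4 ^ (r + 2) * C2 * N := by
    rw [htW]; ring
  nlinarith [show 0 ≤ (4 : ℝ) ^ (r + 2) * tW by positivity]

theorem zeta_lip (r : ℕ) : ∃ C δ : ℝ, 1 ≤ C ∧ 0 < δ ∧ ∀ (η : ℝ) (P P' : ℝ → ℝ),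
    Bd (r + 1) δ P → Bd (r + 1) δ P' → Bd r η (fun x => P x - P' x) →
    Bd r (C * η) (fun x => zeta P x - zeta P' x) := by
  obtain ⟨δ1, hδ1, hδ1', h1⟩ := cutW_small
  obtain ⟨C2, hC2, h2⟩ := zeta_bound (r + 1) 1
  obtain ⟨C3, δ3, hC3, hδ3, h3⟩ := dinv_lip r
  obtain ⟨C4, hC4, h4⟩ := comp_bound r (C2 + 1)
  obtain ⟨C5, hC5, h5⟩ := comp_lip r (C2 + 1)
  obtain ⟨K, hK⟩ := stp_bb zero_lt_one r
  have hK0 := hK.nonneg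
  have hC : 0 ≤ C4 * (C3 * (2 ^ r * K)) + C5 * C2 * (2 ^ r * K) := by positivity
  refine ⟨1 + 2 ^ r * K + (C4 * (C3 * (2 ^ r * K)) + C5 * C2 * (2 ^ r * K)),
    min δ1 (δ3 / C2), by linarith [show 0 ≤ 2 ^ r * K by positivity], by positivity,
    fun η P P' hP hP' hd => ?_⟩
  set δ := min δ1 (δ3 / C2) with hδ
  have hδ0 : 0 ≤ δ := hP.nonneg
  have hδa : δ ≤ δ1 := min_le_left _ _
  have hδb : C2 * δ ≤ δ3 := by
    calc C2 * δ ≤ C2 * (δ3 / C2) := by gcongr; exact min_le_right _ _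
      _ = δ3 := by field_simp
  have hδc : δ ≤ 1 := hδa.trans hδ1'
  have q1 := h1 P (hP.mono (by omega) hδa)
  have q2 := h1 P' (hP'.mono (by omega) hδa)
  obtain ⟨a1, a2, -⟩ := h2 δ P hδc hP q1
  obtain ⟨b1, b2, -⟩ := h2 δ P' hδc hP' q2
  have hη := hd.nonneg
  have c1 : Bd r (2 ^ r * K * η) (fun x => cutW P x - cutW P' x) := by
    have : (fun x => cutW P x - cutW P' x) = fun x => stp 0 1 x * (P x - P' x) := by
      funext x; simp only [cutW]; ring
    rw [this]
    exact hK.mul hd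
  have c2 := h3 _ _ _ (a1.mono le_rfl hδb) (b1.mono le_rfl hδb) c1
  have le1 : C2 * δ ≤ C2 := mul_le_of_le_one_right (by linarith) hδc
  have s1 : Bd r (C2 + 1) (fun s => cutW P s + (-1)) :=
    (a1.mono (Nat.le_succ _) le1).add (Bd.const (by simp))
  have s2 : Bd r (C2 + 1) (fun s => cutW P' s + (-1)) :=
    (b1.mono (Nat.le_succ _) le1).add (Bd.const (by simp))
  have c3 := Bd.comp h4 c2 s1
  have c4 := h5 C2 (2 ^ r * K * η) (dinv (cutW P')) _ _ (b2.mono le_rfl le1) s1 s2 (by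
    simpa only [add_sub_add_right_eq_sub] using c1)
  have e : (fun x => zeta P x - zeta P' x) = fun x => (cutW P x - cutW P' x) +
      (dinv (cutW P) (x + (cutW P x + (-1))) - dinv (cutW P') (x + (cutW P x + (-1)))) +
      (dinv (cutW P') (x + (cutW P x + (-1))) - dinv (cutW P') (x + (cutW P' x + (-1)))) := by
    funext x; simp only [zeta]; ring
  rw [e]
  refine ((c1.add c3).add c4).mono le_rfl ?_
  nlinarith

theorem cutW_of_nonpos (P : ℝ → ℝ) {s : ℝ} (hs : s ≤ 0) : cutW P s = 0 := by
  rw [cutW, stp_zero one_pos hs, zero_mul]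

theorem cutW_of_one_le (P : ℝ → ℝ) {s : ℝ} (hs : 1 ≤ s) : cutW P s = P s := by
  rw [cutW, stp_one one_pos hs, one_mul]

variable {P : ℝ → ℝ}

theorem zeta_of_nonpos (hP : ContDiff ℝ ∞ P) (h : ∀ x, |deriv (cutW P) x| ≤ 1 / 2) {s : ℝ}
    (hs : s ≤ 0) : zeta P s = 0 := by
  have hW : ContDiff ℝ ∞ (cutW P) := (stp_smooth 0 1).mul hP
  have h1 := (dinv_spec hW h).2.1 (s - 1)
  rw [cutW_of_nonpos P (by linarith : s - 1 ≤ 0), add_zero, neg_zero] at h1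
  rw [zeta, cutW_of_nonpos P hs, zero_add, zero_add, ← sub_eq_add_neg, h1]

theorem zeta_of_two_le (hP : ContDiff ℝ ∞ P) (hper : Function.Periodic P 1)
    (h : ∀ x, |deriv (cutW P) x| ≤ 1 / 2) {s : ℝ} (hs : 2 ≤ s) : zeta P s = 0 := by
  have hW : ContDiff ℝ ∞ (cutW P) := (stp_smooth 0 1).mul hP
  have h1 := (dinv_spec hW h).2.1 (s - 1)
  rw [cutW_of_one_le P (by linarith : 1 ≤ s - 1), hper.sub_eq] at h1
  rw [zeta, cutW_of_one_le P (by linarith : 1 ≤ s),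
    show s + (P s + -1) = s - 1 + P s by ring, h1]
  ring

end Zeta

section Scaling

/-- The displacement of a conjugate by the homothety of ratio `A`. -/
def scal (A : ℝ) (u : ℝ → ℝ) : ℝ → ℝ := fun s => A * u (A⁻¹ * s)

theorem iteratedDeriv_scal (A : ℝ) {u : ℝ → ℝ} (hu : ContDiff ℝ ∞ u) (k : ℕ) (s : ℝ) :
    iteratedDeriv k (scal A u) s = A * ((A⁻¹) ^ k * iteratedDeriv k u (A⁻¹ * s)) := by
  have h1 := iteratedDeriv_comp_const_mul (n := k) (f := u) (hu.of_le (by exact_mod_cast le_top)) A⁻¹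
  have : scal A u = fun s => A * (fun x => u (A⁻¹ * x)) s := rfl
  rw [this, iteratedDeriv_const_mul_field, h1]

theorem scal_smooth (A : ℝ) {u : ℝ → ℝ} (hu : ContDiff ℝ ∞ u) : ContDiff ℝ ∞ (scal A u) :=
  contDiff_const.mul (hu.comp (contDiff_const.mul contDiff_id))

theorem scal_top {A : ℝ} (hA : 1 ≤ A) {u : ℝ → ℝ} (hu : ContDiff ℝ ∞ u) {k : ℕ} {t : ℝ}
    (ht : ∀ s, |iteratedDeriv (k + 1) u s| ≤ t) (s : ℝ) :
    |iteratedDeriv (k + 1) (scal A u) s| ≤ (A⁻¹) ^ k * t := by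
  have hA0 : 0 < A := by linarith
  rw [iteratedDeriv_scal A hu, pow_succ,
    show A * (A⁻¹ ^ k * A⁻¹ * iteratedDeriv (k + 1) u (A⁻¹ * s)) =
      A⁻¹ ^ k * iteratedDeriv (k + 1) u (A⁻¹ * s) by field_simp, abs_mul,
    abs_of_nonneg (by positivity)]
  gcongr
  exact ht _

theorem Bd.scal {A : ℝ} (hA : 1 ≤ A) {r : ℕ} {N : ℝ} {u : ℝ → ℝ} (hu : Bd r N u) :
    Bd r (A * N) (scal A u) := ⟨scal_smooth A hu.1, fun s k hk => by
  have hA0 : 0 < A := by linarith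
  rw [iteratedDeriv_scal A hu.1, abs_mul, abs_mul, abs_of_pos hA0, abs_pow,
    abs_of_pos (inv_pos.2 hA0)]
  gcongr
  refine (mul_le_of_le_one_left (abs_nonneg _) (pow_le_one₀ (by positivity)
    (inv_le_one_of_one_le₀ hA))).trans (hu.2 _ k hk)⟩

end Scaling

section Iterates

theorem Bd.zero {r : ℕ} : Bd r 0 (fun _ => 0) := Bd.const (by simp)

/-- The displacement of `Tⁿ ∘ (T⁻¹ ∘ (id + z))ⁿ`, where `T` is the unit translation. -/
def Useq (z : ℝ → ℝ) : ℕ → ℝ → ℝ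
  | 0 => fun _ => 0
  | n + 1 => fun s => Useq z n s + z (s + Useq z n s + (-(n : ℝ)))

theorem Useq_succ_eq (z : ℝ → ℝ) (n : ℕ) : Useq z (n + 1) = fun s => Useq z n s +
    (fun x => z (x + (-(n : ℝ)))) (s + Useq z n s) := rfl

theorem Useq_base (n r : ℕ) (M : ℝ) : ∃ C, 1 ≤ C ∧ ∀ (N : ℝ) (z : ℝ → ℝ), N ≤ M → Bd r N z →
    Bd r (C * N) (Useq z n) := by
  induction n with
  | zero =>
    exact ⟨1, le_rfl, fun N z _ hz => Bd.zero.mono le_rfl (by linarith [hz.nonneg])⟩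
  | succ n ih =>
    obtain ⟨C, hC, ih⟩ := ih
    obtain ⟨C1, hC1, h1⟩ := comp_bound r (C * |M|)
    refine ⟨C + C1, by linarith, fun N z hN hz => ?_⟩
    have h2 := ih N z hN hz
    have h3 := Bd.comp h1 (hz.shift (-(n : ℝ))) (h2.mono le_rfl
      (by gcongr; exact hN.trans (le_abs_self _)))
    rw [Useq_succ_eq, add_mul]
    exact h2.add h3

theorem Useq_top_close (n r : ℕ) : ∃ C m₀ : ℝ, 0 ≤ C ∧ 0 < m₀ ∧ ∀ (m t : ℝ) (z : ℝ → ℝ), m ≤ m₀ →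
    Bd r m z → (∀ x, |iteratedDeriv r z x| ≤ t) →
    ∀ x, |iteratedDeriv r (Useq z n) x| ≤ n * t + C * m * m := by
  induction n with
  | zero =>
    refine ⟨0, 1, le_rfl, one_pos, fun m t z _ _ _ x => ?_⟩
    have h : |iteratedDeriv r (Useq z 0) x| ≤ 0 := ((Bd.zero (r := r)).2 x).top
    simpa using h
  | succ n ih =>
    obtain ⟨C, m0, hC, hm0, ih⟩ := ih
    obtain ⟨C1, hC1, h1⟩ := Useq_base n r 1
    obtain ⟨C2, hC2, h2⟩ := comp_top_close r
    refine ⟨C + C2 * C1, min m0 (1 / C1), by positivity, by positivity, fun m t z hm hz ht x => ?_⟩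
    have hm1 : C1 * m ≤ 1 := by
      calc C1 * m ≤ C1 * (1 / C1) := by gcongr; exact hm.trans (min_le_right _ _)
        _ = 1 := by field_simp
    have hm2 : m ≤ 1 := by nlinarith [hz.nonneg]
    have a1 := h1 m z hm2 hz
    have a2 := ih m t z (hm.trans (min_le_left _ _)) hz ht x
    have a3 := h2 m (C1 * m) _ _ (hz.shift (-(n : ℝ))) a1 hm1 x
    rw [iteratedDeriv_shift_const] at a3
    have a4 := ht (x + Useq z n x + (-(n : ℝ)))
    rw [Useq_succ_eq, iteratedDeriv_add_smooth a1.1 (smooth_shift (hz.shift _).1 a1.1)]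
    push_cast
    rw [abs_le] at *
    constructor <;> nlinarith

theorem Useq_lip (n r : ℕ) : ∃ C m₀ : ℝ, 1 ≤ C ∧ 0 < m₀ ∧ ∀ (m e t : ℝ) (z z' : ℝ → ℝ), m ≤ m₀ →
    Bd (r + 1) m z → Bd (r + 1) m z' → Bd r e (fun x => z x - z' x) →
    (∀ x, |iteratedDeriv r (fun x => z x - z' x) x| ≤ t) →
    Bd r (C * e) (fun x => Useq z n x - Useq z' n x) ∧
    ∀ x, |iteratedDeriv r (fun x => Useq z n x - Useq z' n x) x| ≤ n * t + C * m * e := by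
  induction n with
  | zero =>
    refine ⟨1, 1, le_rfl, one_pos, fun m e t z z' _ h1 _ h2 _ => ?_⟩
    have e0 : (fun x => Useq z 0 x - Useq z' 0 x) = fun _ => (0 : ℝ) := by
      funext x; simp [Useq]
    have a1 := h1.nonneg
    have a2 := h2.nonneg
    rw [e0]
    refine ⟨Bd.zero.mono le_rfl (by positivity), fun x => ?_⟩
    have := ((Bd.zero (r := r)).2 x).top
    refine this.trans ?_
    simp; positivity
  | succ n ih =>
    obtain ⟨C, m0, hC, hm0, ih⟩ := ih
    obtain ⟨C1, hC1, h1⟩ := Useq_base n r 1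
    obtain ⟨C2, hC2, h2⟩ := comp_top_close r
    obtain ⟨C3, hC3, h3⟩ := comp_bound r 1
    obtain ⟨C4, hC4, h4⟩ := comp_lip r 1
    refine ⟨C + C3 + C4 * C + C2 * C1, min m0 (1 / C1), by nlinarith [mul_nonneg hC2 (by linarith : 0 ≤ C1)], by positivity,
      fun m e t z z' hm hz hz' hd ht => ?_⟩
    have hm1 : C1 * m ≤ 1 := by
      calc C1 * m ≤ C1 * (1 / C1) := by gcongr; exact hm.trans (min_le_right _ _)
        _ = 1 := by field_simp
    have hm' := hz.nonneg
    have he := hd.nonneg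
    have hm2 : m ≤ 1 := by nlinarith
    have a1 := h1 m z hm2 (hz.mono (Nat.le_succ _) le_rfl)
    have a1' := h1 m z' hm2 (hz'.mono (Nat.le_succ _) le_rfl)
    obtain ⟨b1, b2⟩ := ih m e t z z' (hm.trans (min_le_left _ _)) hz hz' hd ht
    have c1 := Bd.comp h3 (hd.shift (-(n : ℝ))) (a1.mono le_rfl hm1)
    have c2 := h2 e (C1 * m) _ _ (hd.shift (-(n : ℝ))) a1 hm1
    have c3 := h4 m (C * e) _ _ _ (hz'.shift (-(n : ℝ))) (a1.mono le_rfl hm1) (a1'.mono le_rfl hm1) b1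
    have eq : (fun x => Useq z (n + 1) x - Useq z' (n + 1) x) = fun x =>
      ((Useq z n x - Useq z' n x) +
        (fun x => z (x + (-(n : ℝ))) - z' (x + (-(n : ℝ)))) (x + Useq z n x)) +
      ((fun x => z' (x + (-(n : ℝ)))) (x + Useq z n x) -
        (fun x => z' (x + (-(n : ℝ)))) (x + Useq z' n x)) := by
      funext x; simp only [Useq]; ring
    rw [eq]
    have p1 : 0 ≤ C2 * C1 := by positivity
    have p2 : 0 ≤ C4 * C := by positivity
    have p3 : m * e ≤ e := mul_le_of_le_one_left he hm2
    constructor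
    · refine ((b1.add c1).add c3).mono le_rfl ?_
      nlinarith [mul_nonneg p1 he, mul_le_mul_of_nonneg_left p3 p2]
    · intro x
      have d1 := b2 x
      have d2 := c2 x
      rw [iteratedDeriv_shift_const _ (fun x => z x - z' x)] at d2
      have d3 := ht (x + Useq z n x + (-(n : ℝ)))
      have d4 := (c3.2 x).top
      rw [iteratedDeriv_add_smooth (b1.1.add c1.1) c3.1, iteratedDeriv_add_smooth b1.1 c1.1]
      push_cast
      have p4 : 0 ≤ m * e := by positivity
      rw [abs_le] at *
      constructor <;> nlinarith

theorem one_add_pow_le_of_mul_le {x : ℝ} (hx : 0 ≤ x) (n : ℕ) (h : n * x ≤ 1 / 2) :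
    (1 + x) ^ n ≤ 1 + 2 * n * x := by
  induction n with
  | zero => simp
  | succ n ih =>
    push_cast at h ⊢
    have h1 := ih (by nlinarith)
    rw [pow_succ]
    nlinarith

theorem Useq_high (n r : ℕ) (M : ℝ) : ∃ C, 0 ≤ C ∧ ∀ (m t δ : ℝ) (z : ℝ → ℝ), m ≤ M → 0 ≤ δ →
    Bd (r + 1) m z → (∀ x, |iteratedDeriv (r + 2) z x| ≤ t) → (∀ x, |deriv z x| ≤ δ) →
    (1 + δ) ^ n ≤ 2 →
    ∀ x, |1 + deriv (Useq z n) x| ≤ (1 + δ) ^ n ∧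
      |iteratedDeriv (r + 2) (Useq z n) x| ≤ n * (1 + δ) ^ n * (2 ^ (r + 2) * t + C * m) := by
  induction n with
  | zero =>
    refine ⟨0, le_rfl, fun m t δ z _ _ _ _ _ _ x => ?_⟩
    have h1 : |iteratedDeriv (r + 2) (Useq z 0) x| ≤ 0 := ((Bd.zero (r := r + 2)).2 x).top
    have h2 : deriv (Useq z 0) x = 0 := by simp [Useq]
    rw [h2]
    simpa using h1
  | succ n ih =>
    obtain ⟨C, hC, ih⟩ := ih
    obtain ⟨C1, hC1, h1⟩ := Useq_base n (r + 1) M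
    obtain ⟨C2, hC2, h2⟩ := comp_top r (C1 * |M|)
    refine ⟨C + C2, by positivity, fun m t δ z hm hδ hz ht hz' hp x => ?_⟩
    have q1 : (1 : ℝ) ≤ (1 + δ) ^ n := one_le_pow₀ (by linarith)
    have q2 : (1 + δ) ^ n ≤ 2 := by
      refine le_trans ?_ hp
      rw [pow_succ]; nlinarith
    obtain ⟨a1, a2⟩ := ih m t δ z hm hδ hz ht hz' q2 x
    have b1 := h1 m z hm hz
    have hm' := hz.nonneg
    have ht' : 0 ≤ t := (abs_nonneg _).trans (ht 0)
    have b2 := h2 m _ (Useq z n) x (hz.shift (-(n : ℝ))).1 b1.1 ((hz.shift (-(n : ℝ))).2 _)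
      ((b1.mono le_rfl (by gcongr; exact hm.trans (le_abs_self _))).2 x)
    have hsm := (hz.shift (-(n : ℝ))).1
    have e1 : deriv (fun x => z (x + (-(n : ℝ)))) (x + Useq z n x) =
        deriv z (x + Useq z n x + (-(n : ℝ))) := by
      rw [deriv_comp_add_const]
    have e2 : deriv (Useq z (n + 1)) x = deriv (Useq z n) x +
        deriv z (x + Useq z n x + (-(n : ℝ))) * (1 + deriv (Useq z n) x) := by
      have h1 := (smooth_diff b1.1 x).hasDerivAt
      have h2 := (smooth_diff (smooth_shift hsm b1.1) x).hasDerivAt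
      rw [deriv_shift hsm b1.1] at h2
      rw [← e1]
      exact (h1.add h2).deriv
    have d1 := hz' (x + Useq z n x + (-(n : ℝ)))
    have d2 := ht (x + Useq z n x + (-(n : ℝ)))
    rw [iteratedDeriv_shift_const, e1] at b2
    constructor
    · rw [e2, show ∀ a b : ℝ, 1 + (a + b * (1 + a)) = (1 + a) * (1 + b) by intros; ring, abs_mul,
        pow_succ]
      gcongr
      refine (abs_add_le _ _).trans ?_
      rw [abs_one]; linarith
    · rw [Useq_succ_eq, iteratedDeriv_add_smooth b1.1 (smooth_shift hsm b1.1)]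
      set U2 := iteratedDeriv (r + 2) (Useq z n) x
      set y := x + Useq z n x + (-(n : ℝ))
      have f1 : |iteratedDeriv (r + 2) z y * (1 + deriv (Useq z n) x) ^ (r + 2)| ≤
          2 ^ (r + 2) * t := by
        rw [abs_mul, abs_pow, mul_comm]
        gcongr
        exact a1.trans q2
      have f2 : |deriv z y * U2| ≤ δ * |U2| := by
        rw [abs_mul]; gcongr
      set X := 2 ^ (r + 2) * t + (C + C2) * m with hX
      have hX0 : 0 ≤ X := by positivity
      have f3 : |U2| ≤ n * (1 + δ) ^ n * X := by
        refine a2.trans ?_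
        rw [hX]
        gcongr
        linarith
      have f4 : |U2 + iteratedDeriv (r + 2) (fun x => (fun x => z (x + (-(n : ℝ)))) (x + Useq z n x)) x|
          ≤ (1 + δ) * |U2| + (2 ^ (r + 2) * t + C2 * m) := by
        have := le_abs_self U2
        have := neg_abs_le U2
        rw [abs_le] at b2 f1 f2 ⊢
        constructor <;> linarith
      refine f4.trans ?_
      have g1 : 2 ^ (r + 2) * t + C2 * m ≤ X := by rw [hX]; nlinarith
      have g2 : (1 + δ) * |U2| ≤ (1 + δ) * (n * (1 + δ) ^ n * X) := by gcongr
      have g3 : X ≤ (1 + δ) ^ (n + 1) * X := le_mul_of_one_le_left hX0 (one_le_pow₀ (by linarith))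
      push_cast
      rw [pow_succ _ n] at g3 ⊢
      nlinarith

theorem Useq_succ' (z : ℝ → ℝ) (n : ℕ) (s : ℝ) :
    Useq z (n + 1) s = z s + Useq z n (s + z s - 1) := by
  induction n generalizing s with
  | zero => simp [Useq]
  | succ n ih =>
    have h := ih s
    have e : Useq z (n + 1 + 1) s = Useq z (n + 1) s + z (s + Useq z (n + 1) s + (-((n + 1 : ℕ) : ℝ))) := rfl
    have e' : Useq z (n + 1) (s + z s - 1) = Useq z n (s + z s - 1) +
      z (s + z s - 1 + Useq z n (s + z s - 1) + (-(n : ℝ))) := rfl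
    have e2 : s + (z s + Useq z n (s + z s - 1)) + (-((n + 1 : ℕ) : ℝ)) =
      s + z s - 1 + Useq z n (s + z s - 1) + (-(n : ℝ)) := by push_cast; ring
    rw [e, h, e', e2, add_assoc]

theorem Useq_of_nonpos {z : ℝ → ℝ} (hz : ∀ s ≤ 0, z s = 0) (n : ℕ) {s : ℝ} (hs : s ≤ 0) :
    Useq z n s = 0 := by
  induction n with
  | zero => rfl
  | succ n ih =>
    rw [Useq_succ_eq]
    simp only [ih]
    rw [zero_add, hz]
    have : (0 : ℝ) ≤ n := Nat.cast_nonneg n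
    linarith

theorem Useq_stable {z : ℝ → ℝ} (hz : ∀ s ≤ 0, z s = 0) (hz' : ∀ s, |z s| ≤ 1 / 2) (n : ℕ) {s : ℝ}
    (hs : s ≤ n / 2) : Useq z (n + 1) s = Useq z n s := by
  induction n generalizing s with
  | zero =>
    have : s ≤ 0 := by simpa using hs
    rw [Useq_of_nonpos hz _ this, Useq_of_nonpos hz _ this]
  | succ n ih =>
    rw [Useq_succ', Useq_succ' z n s, ih]
    have := (abs_le.1 (hz' s)).2
    push_cast at hs
    linarith

theorem Useq_fixed {z : ℝ → ℝ} (hz : ∀ s ≤ 0, z s = 0) (hz' : ∀ s, |z s| ≤ 1 / 2) (n : ℕ) {s : ℝ}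
    (hs : s ≤ n / 2) : Useq z n s = z s + Useq z n (s + z s - 1) := by
  rw [← Useq_stable hz hz' n hs, Useq_succ']

theorem Useq_shift {z : ℝ → ℝ} (hz : ∀ s ≤ 0, z s = 0) (hz' : ∀ s, |z s| ≤ 1 / 2) (n : ℕ) {s : ℝ}
    (hs : s + 1 ≤ n / 2) (h0 : z (s + 1) = 0) : Useq z n (s + 1) = Useq z n s := by
  rw [Useq_fixed hz hz' n hs, h0, zero_add]
  congr 1; ring

end Iterates

section FixedPoint

/-- The displacement of the generator rescaled by `A`. -/
def zA (A : ℝ) (P : ℝ → ℝ) : ℝ → ℝ := scal A (zeta P)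

/-- The number of iterations needed to cross `[0, B + 2]`. -/
def nB (B : ℕ) : ℕ := 2 * (B + 2)

def UA (A : ℝ) (B : ℕ) (P : ℝ → ℝ) : ℝ → ℝ := Useq (zA A P) (nB B)

def RA (A : ℝ) (B : ℕ) (P : ℝ → ℝ) : ℝ → ℝ := periodize B (UA A B P)

structure Ok (A : ℝ) (B : ℕ) (P : ℝ → ℝ) : Prop where
  per : Function.Periodic P 1
  smooth : ContDiff ℝ ∞ P
  cut : ∀ x, |deriv (cutW P) x| ≤ 1 / 4
  sm : ContDiff ℝ ∞ (zeta P)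
  small : ∀ s, |zA A P s| ≤ 1 / 2
  der : ∀ s, |deriv (zA A P) s| ≤ 1 / (2 * nB B)

theorem nB_pos (B : ℕ) : (0 : ℝ) < nB B := by
  have : 0 < nB B := by unfold nB; omega
  exact_mod_cast this

theorem exists_ok (A : ℝ) (hA : 1 ≤ A) (B : ℕ) : ∃ δ : ℝ, 0 < δ ∧ δ ≤ 1 ∧ ∀ P : ℝ → ℝ,
    Function.Periodic P 1 → Bd 1 δ P → Ok A B P := by
  obtain ⟨δ1, h1, h1', hc⟩ := cutW_small
  obtain ⟨C, hC, hz⟩ := zeta_bound 1 1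
  have hn := nB_pos B
  have hn1 : (1 : ℝ) ≤ nB B := by exact_mod_cast (show 1 ≤ nB B by unfold nB; omega)
  refine ⟨min δ1 (1 / (A * C * (2 * nB B))), by positivity, (min_le_left _ _).trans h1',
    fun P hper hP => ?_⟩
  set δ := min δ1 (1 / (A * C * (2 * nB B)))
  have a1 := hc P (hP.mono le_rfl (min_le_left _ _))
  obtain ⟨-, -, a2⟩ := hz δ P ((min_le_left _ _).trans h1') hP a1
  have a3 := a2.scal hA
  have a4 : A * (C * δ) ≤ 1 / (2 * nB B) := by
    calc A * (C * δ) ≤ A * (C * (1 / (A * C * (2 * nB B)))) := by gcongr; exact min_le_right _ _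
      _ = _ := by field_simp
  have a5 : 1 / (2 * (nB B : ℝ)) ≤ 1 / 2 := by
    apply one_div_le_one_div_of_le <;> linarith
  exact ⟨hper, hP.1, a1, a2.1, fun s => (a3.2 s).zero_apply.trans (a4.trans a5),
    fun s => (a3.2 s).deriv_apply.trans a4⟩

variable {A : ℝ} {B : ℕ} {P : ℝ → ℝ}

theorem Ok.cut' (h : Ok A B P) (x : ℝ) : |deriv (cutW P) x| ≤ 1 / 2 := by linarith [h.cut x]

theorem Ok.z_smooth (h : Ok A B P) : ContDiff ℝ ∞ (zA A P) := scal_smooth A h.sm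

theorem Ok.z_nonpos (hA : 1 ≤ A) (h : Ok A B P) {s : ℝ} (hs : s ≤ 0) : zA A P s = 0 := by
  have : A⁻¹ * s ≤ 0 := mul_nonpos_of_nonneg_of_nonpos (by positivity) hs
  rw [zA, scal, zeta_of_nonpos h.smooth h.cut' this, mul_zero]

theorem Ok.z_large (hA : 1 ≤ A) (h : Ok A B P) {s : ℝ} (hs : 2 * A ≤ s) : zA A P s = 0 := by
  have : 2 ≤ A⁻¹ * s := by
    rw [le_inv_mul_iff₀ (by linarith)]; linarith
  rw [zA, scal, zeta_of_two_le h.smooth h.per h.cut' this, mul_zero]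

theorem Ok.U_smooth (h : Ok A B P) : ContDiff ℝ ∞ (UA A B P) := by
  unfold UA
  induction nB B with
  | zero => exact contDiff_const
  | succ n ih => exact ih.add (h.z_smooth.comp ((contDiff_id.add ih).add contDiff_const))

theorem Ok.U_nonpos (hA : 1 ≤ A) (h : Ok A B P) {s : ℝ} (hs : s ≤ 0) : UA A B P s = 0 :=
  Useq_of_nonpos (fun _ hs => h.z_nonpos hA hs) _ hs

theorem nB_half (B : ℕ) : (nB B : ℝ) / 2 = B + 2 := by
  unfold nB; push_cast; ring

theorem Ok.U_fixed (hA : 1 ≤ A) (h : Ok A B P) {s : ℝ} (hs : s ≤ B + 2) :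
    UA A B P s = zA A P s + UA A B P (s + zA A P s - 1) :=
  Useq_fixed (fun _ hs => h.z_nonpos hA hs) h.small _ (by rw [nB_half]; exact hs)

theorem Ok.U_shift (hA : 1 ≤ A) (hB : 2 * A ≤ B) (h : Ok A B P) {s : ℝ}
    (hs : s ∈ Icc ((B : ℝ) - 1) (B + 1)) : UA A B P (s + 1) = UA A B P s :=
  Useq_shift (fun _ hs => h.z_nonpos hA hs) h.small _ (by rw [nB_half]; linarith [hs.2])
    (h.z_large hA (by linarith [hs.1]))

theorem Ok.U_shift' (hA : 1 ≤ A) (hB : 2 * A ≤ B) (h : Ok A B P) :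
    ∀ s ∈ Icc (B : ℝ) (B + 1), UA A B P (s + 1) = UA A B P s :=
  fun _ hs => h.U_shift hA hB ⟨by linarith [hs.1], hs.2⟩

theorem RA_periodic (A : ℝ) (B : ℕ) (P : ℝ → ℝ) : Function.Periodic (RA A B P) 1 :=
  periodize_periodic _ _

theorem Ok.R_eq (hA : 1 ≤ A) (hB : 2 * A ≤ B) (h : Ok A B P) {s : ℝ}
    (hs : s ∈ Ico (B : ℝ) (B + 2)) : RA A B P s = UA A B P s := by
  have := periodize_eq (h.U_shift' hA hB) (s := s) 0 (by simpa using hs)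
  simpa [RA] using this

theorem Ok.R_bd (hA : 1 ≤ A) (hB : 2 * A ≤ B) (h : Ok A B P) {r : ℕ} {M : ℝ}
    (hU : Bd r M (UA A B P)) : Bd r M (RA A B P) :=
  periodize_bd h.U_smooth (h.U_shift' hA hB) fun x _ => hU.2 x

theorem Ok.R_top (hA : 1 ≤ A) (hB : 2 * A ≤ B) (h : Ok A B P) {r : ℕ} {M : ℝ}
    (hU : ∀ x, |iteratedDeriv r (UA A B P) x| ≤ M) (x : ℝ) :
    |iteratedDeriv r (RA A B P) x| ≤ M := by
  obtain ⟨y, -, hy⟩ := (periodize_smooth h.U_smooth (h.U_shift' hA hB)).2 x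
  rw [RA, hy]; exact hU y

theorem Ok.z_bd (hA : 1 ≤ A) (r : ℕ) (M : ℝ) : ∃ C, 1 ≤ C ∧ ∀ (B : ℕ) (N : ℝ) (P : ℝ → ℝ), N ≤ M →
    Ok A B P → Bd r N P → Bd r (C * N) (zA A P) := by
  obtain ⟨C, hC, h⟩ := zeta_bound r M
  refine ⟨A * C, by nlinarith, fun B N P hN ho hP => ?_⟩
  rw [mul_assoc]
  exact ((h N P hN hP ho.cut).2.2).scal hA

theorem Ok.R_base (hA : 1 ≤ A) (hB : 2 * A ≤ B) (r : ℕ) (M : ℝ) : ∃ C, 1 ≤ C ∧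
    ∀ (N : ℝ) (P : ℝ → ℝ), N ≤ M → Ok A B P → Bd r N P →
    Bd r (C * N) (UA A B P) ∧ Bd r (C * N) (RA A B P) := by
  obtain ⟨C, hC, h⟩ := Ok.z_bd hA r M
  obtain ⟨C1, hC1, h1⟩ := Useq_base (nB B) r (C * |M|)
  refine ⟨C1 * C, by nlinarith, fun N P hN ho hP => ?_⟩
  have a1 := h B N P hN ho hP
  have a2 := h1 (C * N) (zA A P) (by gcongr; exact hN.trans (le_abs_self _)) a1
  rw [mul_assoc]
  exact ⟨a2, ho.R_bd hA hB a2⟩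

theorem R_top_four : ∃ A₀ : ℝ, 1 ≤ A₀ ∧ ∀ A ≥ A₀, ∀ B : ℕ, 2 * A ≤ B → (B : ℝ) ≤ 2 * A + 1 →
    ∃ δ : ℝ, 0 < δ ∧ ∀ (p : ℝ) (P : ℝ → ℝ), p ≤ δ → Ok A B P → Bd 4 p P →
      ∀ x, |iteratedDeriv 4 (RA A B P) x| ≤ p / 2 := by
  obtain ⟨Cz, hCz, hz⟩ := zeta_bound 4 1
  refine ⟨40 * Cz, by linarith, fun A hA B hB hB' => ?_⟩
  have hA1 : 1 ≤ A := by linarith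
  have hA0 : 0 < A := by linarith
  obtain ⟨C, m0, hC, hm0, h⟩ := Useq_top_close (nB B) 4
  have hK : 0 < A * Cz := by positivity
  refine ⟨min 1 (min (m0 / (A * Cz)) (1 / (4 * ((C + 1) * (A * Cz) * (A * Cz))))), by positivity,
    fun p P hp ho hP => ?_⟩
  have hp0 := hP.nonneg
  obtain ⟨-, -, a1⟩ := hz p P (hp.trans (min_le_left _ _)) hP ho.cut
  have a2 := a1.scal hA1
  have a3 := scal_top hA1 a1.1 (k := 3) (t := Cz * p) (fun s => (a1.2 s).top)
  have hp1 : A * (Cz * p) ≤ m0 := by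
    calc A * (Cz * p) ≤ A * (Cz * (m0 / (A * Cz))) := by
          gcongr; exact hp.trans ((min_le_right _ _).trans (min_le_left _ _))
      _ = m0 := by field_simp
  have hp2 : (C + 1) * (A * Cz) * (A * Cz) * p ≤ 1 / 4 := by
    calc (C + 1) * (A * Cz) * (A * Cz) * p ≤ (C + 1) * (A * Cz) * (A * Cz) *
        (1 / (4 * ((C + 1) * (A * Cz) * (A * Cz)))) := by
          gcongr; exact hp.trans ((min_le_right _ _).trans (min_le_right _ _))
      _ = 1 / 4 := by field_simp
  refine ho.R_top hA1 hB fun x => (h _ _ (zA A P) hp1 a2 a3 x).trans ?_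
  have e1 : (nB B : ℝ) ≤ 10 * A := by linarith [nB_half B]
  have e2 : (nB B : ℝ) * (A⁻¹ ^ 3 * (Cz * p)) ≤ p / 4 := by
    calc (nB B : ℝ) * (A⁻¹ ^ 3 * (Cz * p)) ≤ (10 * A) * (A⁻¹ ^ 3 * (Cz * p)) := by gcongr
      _ = 10 * Cz * A⁻¹ * A⁻¹ * p := by field_simp
      _ ≤ 10 * Cz * A⁻¹ * 1 * p := by gcongr; exact inv_le_one_of_one_le₀ hA1
      _ ≤ 1 / 4 * p := by
        gcongr
        rw [mul_one, ← div_eq_mul_inv, div_le_iff₀ hA0]; linarith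
      _ = p / 4 := by ring
  have e3 : C * (A * (Cz * p)) * (A * (Cz * p)) ≤ p / 4 := by
    calc C * (A * (Cz * p)) * (A * (Cz * p)) ≤ (C + 1) * (A * (Cz * p)) * (A * (Cz * p)) := by
          gcongr; linarith
      _ = (C + 1) * (A * Cz) * (A * Cz) * p * p := by ring
      _ ≤ 1 / 4 * p := by gcongr
      _ = p / 4 := by ring
  linarith

theorem R_lip : ∃ A₀ : ℝ, 1 ≤ A₀ ∧ ∀ A ≥ A₀, ∀ B : ℕ, 2 * A ≤ B → (B : ℝ) ≤ 2 * A + 1 →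
    ∃ C δ : ℝ, 1 ≤ C ∧ 0 < δ ∧ ∀ (η : ℝ) (P P' : ℝ → ℝ), Ok A B P → Ok A B P' → Bd 4 δ P →
      Bd 4 δ P' → Bd 3 η (fun x => P x - P' x) →
      Bd 3 (C * η) (fun x => RA A B P x - RA A B P' x) ∧
      ∀ x, |iteratedDeriv 3 (fun x => RA A B P x - RA A B P' x) x| ≤ η / 4 := by
  obtain ⟨Cz, δz, hCz, hδz, hz⟩ := zeta_lip 3
  obtain ⟨Cb, hCb, hb⟩ := zeta_bound 4 1
  refine ⟨80 * Cz, by linarith, fun A hA B hB hB' => ?_⟩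
  have hA1 : 1 ≤ A := by linarith
  have hA0 : 0 < A := by linarith
  obtain ⟨C, m0, hC, hm0, h⟩ := Useq_lip (nB B) 3
  have hK : 0 < A * Cb := by positivity
  have hC0 : 0 < C := by linarith
  refine ⟨C * (A * Cz), min (min 1 δz) (min (m0 / (A * Cb)) (1 / (8 * (C * (A * Cb) * (A * Cz))))),
    by nlinarith [mul_le_mul hA1 hCz zero_le_one (by linarith)], by positivity,
    fun η P P' ho ho' hP hP' hd => ?_⟩
  set δ := min (min 1 δz) (min (m0 / (A * Cb)) (1 / (8 * (C * (A * Cb) * (A * Cz))))) with hδ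
  have hδ1 : δ ≤ 1 := (min_le_left _ _).trans (min_le_left _ _)
  have hδ2 : δ ≤ δz := (min_le_left _ _).trans (min_le_right _ _)
  have hδ0 := hP.nonneg
  have hη0 := hd.nonneg
  have a1 := hz η P P' (hP.mono le_rfl hδ2) (hP'.mono le_rfl hδ2) hd
  have a2 := a1.scal hA1
  have a3 := scal_top hA1 a1.1 (k := 2) (t := Cz * η) (fun s => (a1.2 s).top)
  have eq : scal A (fun x => zeta P x - zeta P' x) = fun x => zA A P x - zA A P' x := by
    funext x; simp only [scal, zA]; ring
  rw [eq] at a2 a3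
  have b1 := ((hb δ P hδ1 hP ho.cut).2.2).scal hA1
  have b1' := ((hb δ P' hδ1 hP' ho'.cut).2.2).scal hA1
  have hp1 : A * (Cb * δ) ≤ m0 := by
    calc A * (Cb * δ) ≤ A * (Cb * (m0 / (A * Cb))) := by
          gcongr; exact (min_le_right _ _).trans (min_le_left _ _)
      _ = m0 := by field_simp
  have hp2 : (C * (A * Cb) * (A * Cz)) * δ ≤ 1 / 8 := by
    calc (C * (A * Cb) * (A * Cz)) * δ ≤ (C * (A * Cb) * (A * Cz)) *
        (1 / (8 * (C * (A * Cb) * (A * Cz)))) := by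
          gcongr; exact (min_le_right _ _).trans (min_le_right _ _)
      _ = 1 / 8 := by field_simp
  obtain ⟨c1, c2⟩ := h _ _ _ (zA A P) (zA A P') hp1 b1 b1' a2 a3
  have hper : ∀ s ∈ Icc (B : ℝ) (B + 1),
      (fun x => UA A B P x - UA A B P' x) (s + 1) = (fun x => UA A B P x - UA A B P' x) s :=
    fun s hs => by
      change UA A B P (s + 1) - UA A B P' (s + 1) = _
      rw [ho.U_shift' hA1 hB s hs, ho'.U_shift' hA1 hB s hs]
  have hR : (fun x => RA A B P x - RA A B P' x) = periodize B (fun x => UA A B P x - UA A B P' x) :=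
    rfl
  obtain ⟨d1, d2⟩ := periodize_smooth (ho.U_smooth.sub ho'.U_smooth) hper
  rw [hR]
  constructor
  · refine periodize_bd (ho.U_smooth.sub ho'.U_smooth) hper fun x _ => ?_
    refine (c1.2 x).mono le_rfl (le_of_eq ?_)
    ring
  · intro x
    obtain ⟨y, -, hy⟩ := d2 x
    rw [hy]
    refine (c2 y).trans ?_
    have e1 : (nB B : ℝ) ≤ 10 * A := by linarith [nB_half B]
    have e2 : (nB B : ℝ) * (A⁻¹ ^ 2 * (Cz * η)) ≤ η / 8 := by
      calc (nB B : ℝ) * (A⁻¹ ^ 2 * (Cz * η)) ≤ (10 * A) * (A⁻¹ ^ 2 * (Cz * η)) := by gcongr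
        _ = 10 * Cz * A⁻¹ * η := by field_simp
        _ ≤ 1 / 8 * η := by
          gcongr
          rw [← div_eq_mul_inv, div_le_iff₀ hA0]; linarith
        _ = η / 8 := by ring
    have e3 : C * (A * (Cb * δ)) * (A * (Cz * η)) ≤ η / 8 := by
      calc C * (A * (Cb * δ)) * (A * (Cz * η)) = (C * (A * Cb) * (A * Cz)) * δ * η := by ring
        _ ≤ 1 / 8 * η := by gcongr
        _ = η / 8 := by ring
    linarith

theorem R_high (hA : 327680 ≤ A) (hB : 2 * A ≤ B) (hB' : (B : ℝ) ≤ 2 * A + 1) (r : ℕ) (hr : 1 ≤ r)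
    (M : ℝ) : ∃ C, 0 ≤ C ∧ ∀ (N t : ℝ) (P : ℝ → ℝ), N ≤ M → Ok A B P → Bd (r + 1) N P →
      (∀ x, |iteratedDeriv (r + 2) P x| ≤ t) →
      ∀ x, |iteratedDeriv (r + 2) (RA A B P) x| ≤ t / 8 + C * N := by
  have hA1 : 1 ≤ A := by linarith
  have hA0 : 0 < A := by linarith
  obtain ⟨C1, hC1, h1⟩ := zeta_top r M
  obtain ⟨C2, hC2, h2⟩ := Ok.z_bd hA1 (r + 1) M
  obtain ⟨C3, hC3, h3⟩ := Useq_high (nB B) r (C2 * |M|)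
  have hn := nB_pos B
  refine ⟨2 * nB B * (2 ^ (r + 2) * (A⁻¹ ^ (r + 1) * C1) + C3 * C2), by positivity,
    fun N t P hN ho hP ht => ?_⟩
  have hN0 := hP.nonneg
  have ht0 : 0 ≤ t := (abs_nonneg _).trans (ht 0)
  have a1 := h1 N t P hN hP ho.cut ht
  have a2 := scal_top hA1 ho.sm a1
  have a3 := h2 B N P hN ho hP
  have hp : (1 + 1 / (2 * (nB B : ℝ))) ^ nB B ≤ 2 := by
    have e : (nB B : ℝ) * (1 / (2 * nB B)) = 1 / 2 := by field_simp
    refine (one_add_pow_le_of_mul_le (by positivity) _ e.le).trans ?_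
    rw [mul_assoc, e]; norm_num
  refine ho.R_top hA1 hB fun x => ((h3 (C2 * N) _ _ (zA A P) (by
    gcongr; exact hN.trans (le_abs_self _)) (by positivity) a3 a2 ho.der hp) x).2.trans ?_
  have e1 : (nB B : ℝ) ≤ 10 * A := by linarith [nB_half B]
  have e2 : 2 * (10 * A) * (2 ^ (r + 2) * (A⁻¹ ^ (r + 1) * (4 * 4 ^ (r + 2)))) ≤ 1 / 8 := by
    have f1 : (2 : ℝ) ^ (r + 2) * 4 ^ (r + 2) = 8 ^ r * 64 := by
      rw [← mul_pow, pow_add]; norm_num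
    calc 2 * (10 * A) * (2 ^ (r + 2) * (A⁻¹ ^ (r + 1) * (4 * 4 ^ (r + 2))))
        = 80 * (A * A⁻¹) * A⁻¹ ^ r * (2 ^ (r + 2) * 4 ^ (r + 2)) := by rw [pow_succ _ r]; ring
      _ = 5120 * (8 * A⁻¹) ^ r := by
        rw [f1, mul_inv_cancel₀ hA0.ne', mul_pow]; ring
      _ ≤ 5120 * (8 * A⁻¹) ^ 1 := by
        have : 8 * A⁻¹ ≤ 1 := by
          rw [← div_eq_mul_inv, div_le_one hA0]; linarith
        exact mul_le_mul_of_nonneg_left (pow_le_pow_of_le_one (by positivity) this hr) (by norm_num)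
      _ ≤ 1 / 8 := by
        rw [pow_one, ← mul_assoc, ← div_eq_mul_inv, div_le_iff₀ hA0]; linarith
  calc (nB B : ℝ) * (1 + 1 / (2 * (nB B : ℝ))) ^ nB B *
        (2 ^ (r + 2) * (A⁻¹ ^ (r + 1) * (4 * 4 ^ (r + 2) * t + C1 * N)) + C3 * (C2 * N))
      ≤ nB B * 2 *
        (2 ^ (r + 2) * (A⁻¹ ^ (r + 1) * (4 * 4 ^ (r + 2) * t + C1 * N)) + C3 * (C2 * N)) := by
        gcongr
    _ = 2 * nB B * (2 ^ (r + 2) * (A⁻¹ ^ (r + 1) * (4 * 4 ^ (r + 2)))) * t +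
        2 * nB B * (2 ^ (r + 2) * (A⁻¹ ^ (r + 1) * C1) + C3 * C2) * N := by ring
    _ ≤ 2 * (10 * A) * (2 ^ (r + 2) * (A⁻¹ ^ (r + 1) * (4 * 4 ^ (r + 2)))) * t +
        2 * nB B * (2 ^ (r + 2) * (A⁻¹ ^ (r + 1) * C1) + C3 * C2) * N := by gcongr
    _ ≤ 1 / 8 * t + 2 * nB B * (2 ^ (r + 2) * (A⁻¹ ^ (r + 1) * C1) + C3 * C2) * N := by gcongr
    _ = _ := by ring

end FixedPoint

section FixedPointIteration

/-- The constant by which the conjugacy is translated. -/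
def cA (A : ℝ) (B : ℕ) (Q P : ℝ → ℝ) : ℝ := RA A B P 0 + Q (RA A B P 0)

/-- The map whose fixed point solves the conjugacy equation. -/
def Phi (A : ℝ) (B : ℕ) (Q P : ℝ → ℝ) : ℝ → ℝ := fun s =>
  (RA A B P s + Q (s + RA A B P s)) + (-cA A B Q P)

theorem Phi_zero (A : ℝ) (B : ℕ) (Q P : ℝ → ℝ) : Phi A B Q P 0 = 0 := by
  simp [Phi, cA]

theorem Phi_periodic (A : ℝ) (B : ℕ) {Q : ℝ → ℝ} (P : ℝ → ℝ) (hQ : Function.Periodic Q 1) :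
    Function.Periodic (Phi A B Q P) 1 := fun s => by
  simp only [Phi]
  rw [RA_periodic A B P s, show s + 1 + RA A B P s = s + RA A B P s + 1 by ring, hQ]

theorem iteratedDeriv_add_const_succ (u : ℝ → ℝ) (c : ℝ) (k : ℕ) :
    iteratedDeriv (k + 1) (fun s => u s + c) = iteratedDeriv (k + 1) u := by
  rw [iteratedDeriv_succ', iteratedDeriv_succ']
  congr 1
  funext x
  exact deriv_add_const c

theorem Phi_deriv {A : ℝ} {B : ℕ} {Q P : ℝ → ℝ} (hR : ContDiff ℝ ∞ (RA A B P))
    (hQ : ContDiff ℝ ∞ Q) (k : ℕ) (x : ℝ) : iteratedDeriv (k + 1) (Phi A B Q P) x =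
    iteratedDeriv (k + 1) (RA A B P) x + iteratedDeriv (k + 1) (fun s => Q (s + RA A B P s)) x := by
  unfold Phi
  rw [iteratedDeriv_add_const_succ, iteratedDeriv_add_smooth hR (smooth_shift hQ hR)]

theorem Phi_smooth {A : ℝ} {B : ℕ} {Q P : ℝ → ℝ} (hR : ContDiff ℝ ∞ (RA A B P))
    (hQ : ContDiff ℝ ∞ Q) : ContDiff ℝ ∞ (Phi A B Q P) :=
  (hR.add (smooth_shift hQ hR)).add contDiff_const

theorem Phi_low : ∃ A₀ : ℝ, 1 ≤ A₀ ∧ ∀ A ≥ A₀, ∀ B : ℕ, 2 * A ≤ B → (B : ℝ) ≤ 2 * A + 1 →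
    ∃ δ κ C : ℝ, 0 < δ ∧ δ ≤ 1 ∧ 0 < κ ∧ 1 ≤ C ∧
    (∀ P : ℝ → ℝ, Function.Periodic P 1 → Bd 4 δ P → Ok A B P ∧ Bd 4 1 (RA A B P)) ∧
    (∀ (p q : ℝ) (P Q : ℝ → ℝ), p ≤ δ → Function.Periodic P 1 → Bd 4 p P →
      Function.Periodic Q 1 → Bd 4 q Q → Bd 4 (p / 2 + C * q) (Phi A B Q P)) ∧
    (∀ (η : ℝ) (P P' Q : ℝ → ℝ), Function.Periodic P 1 → Bd 4 δ P →
      Function.Periodic P' 1 → Bd 4 δ P' → Function.Periodic Q 1 → Bd 4 κ Q →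
      Bd 3 η (fun x => P x - P' x) →
      Bd 3 (η / 2) (fun x => Phi A B Q P x - Phi A B Q P' x)) := by
  obtain ⟨A1, hA1, h1⟩ := R_top_four
  obtain ⟨A2, hA2, h2⟩ := R_lip
  refine ⟨max A1 A2, le_max_of_le_left hA1, fun A hA B hB hB' => ?_⟩
  have hA0 : 1 ≤ A := hA1.trans ((le_max_left _ _).trans hA)
  obtain ⟨δ1, hδ1, h1⟩ := h1 A ((le_max_left _ _).trans hA) B hB hB'
  obtain ⟨C2, δ2, hC2, hδ2, h2⟩ := h2 A ((le_max_right _ _).trans hA) B hB hB'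
  obtain ⟨δ3, hδ3, hδ3', h3⟩ := exists_ok A hA0 B
  obtain ⟨C4, hC4, h4⟩ := Ok.R_base hA0 hB 4 1
  obtain ⟨C5, hC5, h5⟩ := comp_bound 4 1
  obtain ⟨C6, hC6, h6⟩ := comp_lip 3 1
  set δ := min (min δ1 δ2) (min δ3 (1 / C4)) with hδ
  have hδ0 : 0 < δ := by positivity
  have e1 : δ ≤ δ1 := (min_le_left _ _).trans (min_le_left _ _)
  have e2 : δ ≤ δ2 := (min_le_left _ _).trans (min_le_right _ _)
  have e3 : δ ≤ δ3 := (min_le_right _ _).trans (min_le_left _ _)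
  have e4 : C4 * δ ≤ 1 := by
    calc C4 * δ ≤ C4 * (1 / C4) := by gcongr; exact (min_le_right _ _).trans (min_le_right _ _)
      _ = 1 := by field_simp
  have key : ∀ P : ℝ → ℝ, Function.Periodic P 1 → Bd 4 δ P → Ok A B P ∧ Bd 4 1 (RA A B P) :=
    fun P hper hP => by
      have ho := h3 P hper (hP.mono (by norm_num) e3)
      exact ⟨ho, (h4 δ P (e3.trans hδ3') ho hP).2.mono le_rfl e4⟩
  refine ⟨δ, 1 / (4 * C6 * C2), C5, hδ0, e3.trans hδ3', by positivity, hC5, key, ?_, ?_⟩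
  · intro p q P Q hp hper hP hQper hQ
    obtain ⟨ho, hR⟩ := key P hper (hP.mono le_rfl hp)
    refine Bd.of_periodic (Phi_smooth hR.1 hQ.1) (Phi_periodic A B P hQper) (Phi_zero A B Q P)
      fun x => ?_
    rw [Phi_deriv hR.1 hQ.1 3 x]
    exact (abs_add_le _ _).trans (add_le_add (h1 p P (hp.trans e1) ho hP x)
      ((Bd.comp h5 hQ hR).2 x).top)
  · intro η P P' Q hper hP hper' hP' hQper hQ hd
    obtain ⟨ho, hR⟩ := key P hper hP
    obtain ⟨ho', hR'⟩ := key P' hper' hP'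
    obtain ⟨a1, a2⟩ := h2 η P P' ho ho' (hP.mono le_rfl e2) (hP'.mono le_rfl e2) hd
    have a3 := h6 _ _ Q _ _ hQ (hR.mono (by norm_num) le_rfl) (hR'.mono (by norm_num) le_rfl) a1
    have hη := hd.nonneg
    have hs := Phi_smooth hR.1 hQ.1
    have hs' := Phi_smooth hR'.1 hQ.1
    refine Bd.of_periodic (hs.sub hs') (fun s => ?_) ?_ fun x => ?_
    · change Phi A B Q P (s + 1) - Phi A B Q P' (s + 1) = _
      rw [Phi_periodic A B P hQper, Phi_periodic A B P' hQper]
    · simp only [Phi_zero, sub_zero]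
    · have e : iteratedDeriv 3 (fun x => Phi A B Q P x - Phi A B Q P' x) x =
          iteratedDeriv 3 (fun x => RA A B P x - RA A B P' x) x +
          iteratedDeriv 3 (fun x => Q (x + RA A B P x) - Q (x + RA A B P' x)) x := by
        rw [iteratedDeriv_sub_smooth hs hs', Phi_deriv hR.1 hQ.1 2, Phi_deriv hR'.1 hQ.1 2,
          iteratedDeriv_sub_smooth hR.1 hR'.1, iteratedDeriv_sub_smooth (smooth_shift hQ.1 hR.1)
          (smooth_shift hQ.1 hR'.1)]
        ring
      rw [e]
      have b1 := (a3.2 x).top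
      have b2 : C6 * (1 / (4 * C6 * C2)) * (C2 * η) = η / 4 := by field_simp
      rw [b2] at b1
      exact (abs_add_le _ _).trans (by linarith [a2 x])

/-- The iterates of `Phi`. -/
def pn (A : ℝ) (B : ℕ) (Q : ℝ → ℝ) : ℕ → ℝ → ℝ
  | 0 => fun _ => 0
  | n + 1 => Phi A B Q (pn A B Q n)

theorem pn_zero_periodic (A : ℝ) (B : ℕ) {Q : ℝ → ℝ} (hQ : Function.Periodic Q 1) (n : ℕ) :
    pn A B Q n 0 = 0 ∧ Function.Periodic (pn A B Q n) 1 := by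
  cases n with
  | zero => exact ⟨rfl, fun _ => rfl⟩
  | succ n => exact ⟨Phi_zero _ _ _ _, Phi_periodic _ _ _ hQ⟩

theorem pn_high {A : ℝ} {B : ℕ} (hA : 327680 ≤ A) (hB : 2 * A ≤ B) (hB' : (B : ℝ) ≤ 2 * A + 1)
    {δ κ C : ℝ} (hκ : 0 < κ) (hκ1 : κ ≤ 1) (hC : 0 ≤ C)
    (h1 : ∀ P : ℝ → ℝ, Function.Periodic P 1 → Bd 4 δ P → Ok A B P ∧ Bd 4 1 (RA A B P))
    (h2 : ∀ (Q : ℝ → ℝ), Function.Periodic Q 1 → Bd 4 κ Q → ∀ n, Bd 4 δ (pn A B Q n))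
    (h3 : ∀ (q : ℝ) (Q : ℝ → ℝ), q ≤ κ → Function.Periodic Q 1 → Bd 4 q Q →
      ∀ n, Bd 4 (C * q) (pn A B Q n)) (j : ℕ) (M : ℝ) :
    ∃ K, 0 ≤ K ∧ ∀ (q : ℝ) (Q : ℝ → ℝ), q ≤ M → Function.Periodic Q 1 → Bd 4 κ Q → Bd (j + 4) q Q →
      ∀ n, Bd (j + 4) (K * q) (pn A B Q n) := by
  have hA1 : 1 ≤ A := by linarith
  induction j with
  | zero =>
    refine ⟨C, hC, fun q Q _ hper hQ hQ' n => ?_⟩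
    rcases le_total q κ with h | h
    · exact h3 q Q h hper hQ' n
    · exact (h3 κ Q le_rfl hper hQ n).mono le_rfl (by gcongr)
  | succ j ih =>
    obtain ⟨K, hK, ih⟩ := ih
    obtain ⟨C1, hC1, a1⟩ := R_high hA hB hB' (j + 3) (by omega) (K * |M|)
    obtain ⟨C2, hC2, a2⟩ := Ok.R_base hA1 hB (j + 4) (K * |M|)
    obtain ⟨C3, hC3, a3⟩ := comp_top (j + 3) (C2 * (K * |M|))
    set L := 2 * (C1 * K) + C3 + 2 ^ (j + 5) with hL
    refine ⟨2 * L, by positivity, fun q Q hq hper hQ hQ' n => ?_⟩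
    have hq0 := hQ'.nonneg
    have hqM : q ≤ |M| := hq.trans (le_abs_self _)
    have hQ4 := hQ'.mono (show j + 4 ≤ j + 1 + 4 by omega) le_rfl
    have hb := ih q Q hq hper hQ hQ4
    have hL0 : 0 ≤ L * q := by positivity
    induction n with
    | zero => exact Bd.zero.mono le_rfl (by linarith)
    | succ n ihn =>
      obtain ⟨z0, zp⟩ := pn_zero_periodic A B hper n
      obtain ⟨ho, hR⟩ := h1 _ zp (h2 Q hper hQ n)
      refine Bd.of_periodic (Phi_smooth hR.1 hQ.1) (Phi_periodic A B _ hper) (Phi_zero A B Q _)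
        fun x => ?_
      have b1 := a1 (K * q) (2 * L * q) _ (by gcongr) ho (hb n) (fun x => (ihn.2 x).top) x
      have b2 := (a2 (K * q) _ (by gcongr) ho (hb n)).2
      have b3 := a3 q Q _ x hQ.1 hR.1 (hQ4.2 _) ((b2.mono le_rfl (by gcongr)).2 x)
      have b4 : |iteratedDeriv (j + 5) Q (x + RA A B (pn A B Q n) x)| ≤ q := (hQ'.2 _).top
      have b5 : |1 + deriv (RA A B (pn A B Q n)) x| ≤ 2 := by
        refine (abs_add_le _ _).trans ?_
        have : |deriv (RA A B (pn A B Q n)) x| ≤ 1 := ((hR.mono (show 1 ≤ 4 by norm_num) le_rfl).2 x).deriv_apply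
        rw [abs_one]; linarith
      have b6 : |deriv Q (x + RA A B (pn A B Q n) x)| ≤ 1 :=
        (((hQ.mono (show 1 ≤ 4 by norm_num) le_rfl).2 _).deriv_apply).trans hκ1
      have b7 : |iteratedDeriv (j + 5) Q (x + RA A B (pn A B Q n) x) *
          (1 + deriv (RA A B (pn A B Q n)) x) ^ (j + 5)| ≤ q * 2 ^ (j + 5) := by
        rw [abs_mul, abs_pow]; gcongr
      have b8 : |deriv Q (x + RA A B (pn A B Q n) x) *
          iteratedDeriv (j + 5) (RA A B (pn A B Q n)) x| ≤ 2 * L * q / 8 + C1 * (K * q) := by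
        rw [abs_mul]
        exact (mul_le_of_le_one_left (abs_nonneg _) b6).trans b1
      have e : iteratedDeriv (j + 5) (Phi A B Q (pn A B Q n)) x = _ := Phi_deriv hR.1 hQ.1 (j + 4) x
      change |iteratedDeriv (j + 5) (Phi A B Q (pn A B Q n)) x| ≤ _
      rw [e]
      have e' : L * q = 2 * (C1 * K * q) + C3 * q + q * 2 ^ (j + 5) := by rw [hL]; ring
      change |iteratedDeriv (j + 5) (fun s => Q (s + RA A B (pn A B Q n) s)) x - _ - _| ≤ _ at b3
      change |iteratedDeriv (j + 5) (RA A B (pn A B Q n)) x| ≤ _ at b1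
      rw [abs_le] at *
      constructor <;> linarith

theorem exists_fixed_point : ∃ A₀ : ℝ, 1 ≤ A₀ ∧ ∀ A ≥ A₀, ∀ B : ℕ, 2 * A ≤ B →
    (B : ℝ) ≤ 2 * A + 1 → ∃ (κ : ℝ) (K : ℕ → ℝ → ℝ), 0 < κ ∧ (∀ j M, 0 ≤ K j M) ∧ ∀ Q : ℝ → ℝ,
      Function.Periodic Q 1 → Bd 4 κ Q → ∃ P : ℝ → ℝ, Ok A B P ∧ P = Phi A B Q P ∧
        ∀ (j : ℕ) (q M : ℝ), q ≤ M → Bd (j + 4) q Q → Bd (j + 4) (K j M * q) P := by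
  obtain ⟨A1, hA1, h1⟩ := Phi_low
  refine ⟨max A1 327680, le_max_of_le_left hA1, fun A hA B hB hB' => ?_⟩
  obtain ⟨δ, κ0, C, hδ, hδ1, hκ0, hC, hok, hinv, hcon⟩ := h1 A ((le_max_left _ _).trans hA) B hB hB'
  have hA' : 327680 ≤ A := (le_max_right _ _).trans hA
  set κ := min (min κ0 1) (δ / (2 * C)) with hκ
  have hκp : 0 < κ := by positivity
  have k1 : κ ≤ κ0 := (min_le_left _ _).trans (min_le_left _ _)
  have k2 : κ ≤ 1 := (min_le_left _ _).trans (min_le_right _ _)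
  have k3 : 2 * C * κ ≤ δ := by
    calc 2 * C * κ ≤ 2 * C * (δ / (2 * C)) := by gcongr; exact min_le_right _ _
      _ = δ := by field_simp
  have i3 : ∀ (q : ℝ) (Q : ℝ → ℝ), q ≤ κ → Function.Periodic Q 1 → Bd 4 q Q →
      ∀ n, Bd 4 (2 * C * q) (pn A B Q n) := fun q Q hq hper hQ n => by
    have hq0 := hQ.nonneg
    induction n with
    | zero => exact Bd.zero.mono le_rfl (by positivity)
    | succ n ih =>
      refine (hinv (2 * C * q) q (pn A B Q n) Q (le_trans (by gcongr) k3)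
        (pn_zero_periodic A B hper n).2 ih hper hQ).mono le_rfl (le_of_eq (by ring))
  have i2 : ∀ (Q : ℝ → ℝ), Function.Periodic Q 1 → Bd 4 κ Q → ∀ n, Bd 4 δ (pn A B Q n) :=
    fun Q hper hQ n => (i3 κ Q le_rfl hper hQ n).mono le_rfl k3
  choose K hK0 hK using pn_high hA' hB hB' hκp k2 (show 0 ≤ 2 * C by linarith) hok i2 i3
  refine ⟨κ, K, hκp, hK0, fun Q hper hQ => ?_⟩
  have hp := fun n => i2 Q hper hQ n
  have hz := fun n => pn_zero_periodic A B hper n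
  have hQ0 := hQ.mono le_rfl k1
  have diff : ∀ n m, Bd 3 (δ * (1 / 2) ^ n) (fun x => pn A B Q (m + n) x - pn A B Q n x) := by
    intro n
    induction n with
    | zero =>
      intro m
      simpa [pn] using (hp m).mono (show 3 ≤ 4 by norm_num) le_rfl
    | succ n ih =>
      intro m
      have := hcon _ _ _ Q (hz (m + n)).2 (hp _) (hz n).2 (hp n) hper hQ0 (ih m)
      refine this.mono le_rfl (le_of_eq ?_)
      rw [pow_succ]; ring
  have hb : ∀ k, ∃ M, ∀ n x, |iteratedDeriv k (pn A B Q n) x| ≤ M := fun k => by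
    by_cases hk : ∃ q, Bd (k + 4) q Q
    · obtain ⟨q, hq⟩ := hk
      exact ⟨_, fun n x => (hK k q q Q le_rfl hper hQ hq n).2 x k (by omega)⟩
    · exfalso
      apply hk
      have hc : ∀ i, ∃ M, ∀ x, |iteratedDeriv i Q x| ≤ M := fun i => by
        obtain ⟨M, hM⟩ := (isCompact_Icc (a := (0 : ℝ)) (b := 1)).exists_bound_of_continuousOn
          (smooth_iter hQ.1 i).continuous.continuousOn
        refine ⟨M, fun x => ?_⟩
        have hp := Function.Periodic.iteratedDeriv' hper i
        obtain ⟨y, hy, e⟩ := hp.exists_mem_Ico₀ one_pos x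
        rw [e]
        exact hM y ⟨hy.1, hy.2.le⟩
      choose M hM using hc
      refine ⟨∑ i ∈ Finset.range (k + 5), |M i|, hQ.1, fun x i hi => ?_⟩
      refine (hM i x).trans ((le_abs_self _).trans ?_)
      exact Finset.single_le_sum (f := fun i => |M i|) (fun _ _ => abs_nonneg _)
        (Finset.mem_range.2 (by omega))
  obtain ⟨P, hPs, hlim⟩ := exists_smooth_limit (p := pn A B Q) (C := δ) (θ := 1 / 2)
    (fun n => (hp n).1) hb (by norm_num) (by norm_num) fun n x => by
      have := ((diff n 1).2 x).zero_apply
      rwa [add_comm 1 n] at this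
  have l0 : ∀ x, Tendsto (fun n => pn A B Q n x) atTop (𝓝 (P x)) := fun x => by
    simpa using hlim 0 x
  have hPper : Function.Periodic P 1 := fun x =>
    tendsto_nhds_unique (l0 (x + 1)) ((l0 x).congr fun n => ((hz n).2 x).symm)
  have hPd : Bd 4 δ P := Bd.of_tendsto hPs hlim hp
  have hdP : ∀ n, Bd 3 (δ * (1 / 2) ^ n) (fun x => P x - pn A B Q n x) := fun n => by
    refine Bd.of_tendsto (p := fun m x => pn A B Q (m + n) x - pn A B Q n x)
      (hPs.sub (hp n).1) (fun k x => ?_) (diff n)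
    simp_rw [fun m => iteratedDeriv_sub_smooth (hp (m + n)).1 (hp n).1 k x,
      iteratedDeriv_sub_smooth hPs (hp n).1 k x]
    exact ((tendsto_add_atTop_iff_nat n).2 (hlim k x)).sub tendsto_const_nhds
  refine ⟨P, (hok P hPper hPd).1, ?_, fun j q M hq hQq => Bd.of_tendsto hPs hlim
    (hK j M q Q hq hper hQ hQq)⟩
  funext x
  have hle : ∀ n : ℕ, |P x - Phi A B Q P x| ≤ 2 * δ * (1 / 2) ^ n := fun n => by
    have a1 := ((hdP (n + 1)).2 x).zero_apply
    have a2 := ((hcon _ _ _ Q hPper hPd (hz n).2 (hp n) hper hQ0 (hdP n)).2 x).zero_apply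
    have a3 : (0 : ℝ) ≤ δ * (1 / 2) ^ n := by positivity
    rw [pow_succ] at a1
    change |P x - Phi A B Q (pn A B Q n) x| ≤ _ at a1
    rw [abs_le] at *
    constructor <;> linarith
  have ht : Tendsto (fun n : ℕ => 2 * δ * (1 / 2 : ℝ) ^ n) atTop (𝓝 (2 * δ * 0)) :=
    (tendsto_pow_atTop_nhds_zero_of_lt_one (by norm_num) (by norm_num)).const_mul _
  have h0 := ge_of_tendsto' ht hle
  rw [mul_zero] at h0
  exact sub_eq_zero.1 (abs_nonpos_iff.1 h0)

end FixedPointIteration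

section Permutations

/-- Smooth displacements with derivative bounded by `1/2`. -/
def Dis (u : ℝ → ℝ) : Prop := ContDiff ℝ ∞ u ∧ ∀ x, |deriv u x| ≤ 1 / 2

open Classical in
/-- The bijection of the line with displacement `u`. -/
def pm (u : ℝ → ℝ) : Equiv.Perm ℝ :=
  if h : Dis u then
    { toFun := fun x => x + u x
      invFun := fun x => x + dinv u x
      left_inv := fun x => by
        change x + u x + dinv u (x + u x) = x
        rw [(dinv_spec h.1 h.2).2.1]; ring
      right_inv := fun x => by
        change x + dinv u x + u (x + dinv u x) = x
        rw [(dinv_spec h.1 h.2).2.2]; ring }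
  else 1

variable {u : ℝ → ℝ}

theorem Dis.pm_apply (h : Dis u) (x : ℝ) : pm u x = x + u x := by
  rw [pm, dif_pos h]; rfl

theorem Dis.pm_inv_apply (h : Dis u) (x : ℝ) : (pm u)⁻¹ x = x + dinv u x := by
  rw [pm, dif_pos h]; rfl

theorem Dis.strictMono (h : Dis u) : StrictMono (pm u) := by
  have : (pm u : ℝ → ℝ) = fun x => x + u x := funext h.pm_apply
  rw [this]
  refine strictMono_of_deriv_pos fun x => ?_
  have hd := (smooth_diff h.1) x
  rw [deriv_fun_add differentiableAt_fun_id hd]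
  have h2 := abs_le.1 (h.2 x)
  simp only [deriv_id'']
  linarith

theorem Dis.of_bd {M : ℝ} (h : Bd 1 M u) (hM : M ≤ 1 / 2) : Dis u :=
  ⟨h.1, fun x => (h.2 x).deriv_apply.trans hM⟩

theorem Sml.dis {ι : Type*} {l : Filter ι} {u : ι → ℝ → ℝ} (h : Sml l u) : ∀ᶠ i in l, Dis (u i) :=
  (h 1 (1 / 2) (by norm_num)).mono fun _ hi => Dis.of_bd hi le_rfl

theorem Dis.dinv_zero (h : Dis u) {s : ℝ} (hs : u s = 0) : dinv u s = 0 := by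
  have := (dinv_spec h.1 h.2).2.1 s
  rwa [hs, add_zero, neg_zero] at this

theorem Dis.pm_of_zero (h : Dis u) {s : ℝ} (hs : u s = 0) : pm u s = s := by
  rw [h.pm_apply, hs, add_zero]

theorem perm_apply_inv (g : Equiv.Perm ℝ) (x : ℝ) : g (g⁻¹ x) = x := g.apply_symm_apply x

theorem perm_inv_apply (g : Equiv.Perm ℝ) (x : ℝ) : g⁻¹ (g x) = x := g.symm_apply_apply x

/-- The unit translation of the line. -/
def tr : Equiv.Perm ℝ := Equiv.addRight 1

@[simp] theorem tr_apply (x : ℝ) : tr x = x + 1 := rfl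

@[simp] theorem tr_inv_apply (x : ℝ) : tr⁻¹ x = x - 1 := by
  rw [Equiv.Perm.inv_eq_iff_eq]; simp

end Permutations

section LineIdentity

/-- The cut of a periodic function at `-∞`. -/
def CQ (Q : ℝ → ℝ) : ℝ → ℝ := fun s => stp (-2) (-1) s * Q s

theorem CQ_left (Q : ℝ → ℝ) {s : ℝ} (hs : s ≤ -2) : CQ Q s = 0 := by
  rw [CQ, stp_zero (by norm_num) hs, zero_mul]

theorem CQ_right (Q : ℝ → ℝ) {s : ℝ} (hs : -1 ≤ s) : CQ Q s = Q s := by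
  rw [CQ, stp_one (by norm_num) hs, one_mul]

/-- The diffeomorphism supported on a fundamental domain produced by the cocycle `Q`. -/
def fQ (Q : ℝ → ℝ) : Equiv.Perm ℝ := (pm (CQ Q))⁻¹ * tr * pm (CQ Q) * tr⁻¹

/-- The displacement of `s ↦ ψ_Q (Ψ s) - c`. -/
def uH (A : ℝ) (B : ℕ) (Q P : ℝ → ℝ) : ℝ → ℝ := fun s =>
  (UA A B P s + CQ Q (s + UA A B P s)) + (-cA A B Q P)

/-- The displacement of the conjugacy. -/
def eH (A : ℝ) (B : ℕ) (Q P : ℝ → ℝ) : ℝ → ℝ := fun s =>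
  (1 - stp B (B + 1) s) * (uH A B Q P s + dinv (cutW P) (s + uH A B Q P s))

variable {A : ℝ} {B : ℕ} {P Q : ℝ → ℝ}

theorem fQ_of_nonneg (hQ : Function.Periodic Q 1) (hC : Dis (CQ Q)) {x : ℝ} (hx : 0 ≤ x) :
    fQ Q x = x := by
  simp only [fQ, Equiv.Perm.mul_apply, Equiv.Perm.inv_eq_iff_eq, tr_inv_apply, tr_apply,
    hC.pm_apply]
  rw [CQ_right Q (by linarith), CQ_right Q (by linarith), hQ.sub_eq]
  ring

theorem fQ_of_nonpos (hQ : Function.Periodic Q 1) (hC : Dis (CQ Q)) {x : ℝ} (hx : x ≤ 0) :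
    fQ Q x ≤ 0 := by
  have h0 := fQ_of_nonneg hQ hC le_rfl
  rw [← h0]
  have h1 : Monotone (fQ Q) := by
    intro a b hab
    simp only [fQ, Equiv.Perm.mul_apply, tr_inv_apply, tr_apply]
    have h2 : ∀ a b, a ≤ b → (pm (CQ Q))⁻¹ a ≤ (pm (CQ Q))⁻¹ b := fun a b hab => by
      rw [← hC.strictMono.le_iff_le]; simpa using hab
    exact h2 _ _ (by linarith [hC.strictMono.monotone (by linarith : a - 1 ≤ b - 1)])
  exact h1 hx

theorem eH_of_lt (hA : 1 ≤ A) (hB : 2 * A ≤ B) (hP : Ok A B P) (hPhi : P = Phi A B Q P)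
    (hU : Dis (UA A B P)) {s : ℝ} (hs : s < B + 2) :
    s + eH A B Q P s = (pm (cutW P))⁻¹ (s + uH A B Q P s) := by
  have hW : Dis (cutW P) := ⟨(stp_smooth 0 1).mul hP.smooth, hP.cut'⟩
  rw [hW.pm_inv_apply]
  by_cases hsB : s < B
  · rw [eH, stp_zero (by linarith) hsB.le]; ring
  · push Not at hsB
    have hU0 : 0 ≤ s + UA A B P s := by
      rw [← hU.pm_apply]
      have := hU.strictMono.monotone (show (0 : ℝ) ≤ s by linarith)
      rwa [hU.pm_of_zero (hP.U_nonpos hA le_rfl)] at this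
    have e1 : uH A B Q P s = P s := by
      conv_rhs => rw [hPhi]
      rw [uH, Phi, CQ_right Q (by linarith), hP.R_eq hA hB ⟨hsB, hs⟩]
    have e2 := (dinv_spec hW.1 hW.2).2.1 s
    rw [cutW_of_one_le P (by linarith : 1 ≤ s)] at e2
    rw [eH, e1, e2]; ring

theorem eH_of_ge (hA : 1 ≤ A) (hB : 2 * A ≤ B) (hP : Ok A B P) (hPhi : P = Phi A B Q P)
    (hU : Dis (UA A B P)) {s : ℝ} (hs : (B : ℝ) ≤ s) : eH A B Q P s = 0 := by
  by_cases hs1 : s < B + 2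
  · have e0 := eH_of_lt hA hB hP hPhi hU hs1
    have hW : Dis (cutW P) := ⟨(stp_smooth 0 1).mul hP.smooth, hP.cut'⟩
    have hU0 : 0 ≤ s + UA A B P s := by
      rw [← hU.pm_apply]
      have := hU.strictMono.monotone (show (0 : ℝ) ≤ s by linarith)
      rwa [hU.pm_of_zero (hP.U_nonpos hA le_rfl)] at this
    have e1 : uH A B Q P s = P s := by
      conv_rhs => rw [hPhi]
      rw [uH, Phi, CQ_right Q (by linarith), hP.R_eq hA hB ⟨hs, hs1⟩]
    have e2 := (dinv_spec hW.1 hW.2).2.1 s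
    rw [cutW_of_one_le P (by linarith : 1 ≤ s)] at e2
    rw [eH, e1, e2]; ring
  · rw [eH, stp_one (by linarith) (by linarith)]; ring

theorem eH_of_le (hA : 1 ≤ A) (hP : Ok A B P) (hc : |cA A B Q P| ≤ 1) {s : ℝ} (hs : s ≤ -2) :
    eH A B Q P s = -cA A B Q P := by
  have hW : Dis (cutW P) := ⟨(stp_smooth 0 1).mul hP.smooth, hP.cut'⟩
  have hB : (0 : ℝ) ≤ B := B.cast_nonneg
  have e1 : uH A B Q P s = -cA A B Q P := by
    rw [uH, hP.U_nonpos hA (by linarith), add_zero, CQ_left Q hs]; ring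
  rw [abs_le] at hc
  rw [eH, e1, stp_zero (by linarith) (by linarith), hW.dinv_zero (cutW_of_nonpos P (by linarith))]
  ring

theorem zeta_apply (hP : Ok A B P) (hz : Dis (zeta P)) (s : ℝ) :
    pm (zeta P) s = (pm (cutW P))⁻¹ (pm (cutW P) s - 1) + 1 := by
  have hW : Dis (cutW P) := ⟨(stp_smooth 0 1).mul hP.smooth, hP.cut'⟩
  rw [hz.pm_apply, hW.pm_inv_apply, hW.pm_apply, zeta,
    show s + (cutW P s + -1) = s + cutW P s - 1 by ring]
  ring

theorem line_identity (hA : 1 ≤ A) (hB : 2 * A ≤ B) (hP : Ok A B P) (hPhi : P = Phi A B Q P)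
    (hQ : Function.Periodic Q 1) (hC : Dis (CQ Q)) (hU : Dis (UA A B P)) (hz : Dis (zeta P))
    (hz' : Dis (zA A P)) (he : Dis (eH A B Q P)) :
    fQ Q * (pm (zA A P))⁻¹ * tr = (pm (eH A B Q P))⁻¹ * ((pm (zeta P))⁻¹ * tr) * pm (eH A B Q P) := by
  set H := pm (eH A B Q P) with hH
  set W := pm (cutW P) with hWd
  set C := pm (CQ Q) with hCd
  have hH1 : ∀ s < (B : ℝ) + 2, H s = W⁻¹ (C (s + UA A B P s) - cA A B Q P) := fun s hs => by
    rw [hH, he.pm_apply, eH_of_lt hA hB hP hPhi hU hs, hCd, hC.pm_apply, uH]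
    congr 1; ring
  have hH2 : ∀ s, (B : ℝ) ≤ s → H s = s := fun s hs => by
    rw [hH, he.pm_apply, eH_of_ge hA hB hP hPhi hU hs, add_zero]
  have hzW : ∀ s, pm (zeta P) s - 1 = W⁻¹ (W s - 1) := fun s => by
    rw [zeta_apply hP hz]; ring
  have key : ∀ x, H (pm (zA A P) x - 1) = pm (zeta P) (H (fQ Q x)) - 1 := by
    intro x
    rw [hzW]
    rcases le_total x 0 with hx | hx
    · have hx' := fQ_of_nonpos hQ hC hx
      rw [hz'.pm_of_zero (hP.z_nonpos hA hx), hH1 _ (by linarith), hH1 _ (by linarith),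
        hP.U_nonpos hA hx', hP.U_nonpos hA (by linarith), add_zero, add_zero]
      have : C (fQ Q x) = C (x - 1) + 1 := by
        simp only [fQ, ← hCd, Equiv.Perm.mul_apply, perm_apply_inv, tr_apply, tr_inv_apply]
      rw [this]
      simp only [perm_apply_inv]
      congr 1; ring
    · rw [fQ_of_nonneg hQ hC hx]
      by_cases hxB : x < B + 2
      · have hzs := abs_le.1 (hP.small x)
        by_cases hxB' : x < B + 1
        · have hUx : 0 ≤ x + UA A B P x := by
            rw [← hU.pm_apply]
            have := hU.strictMono.monotone hx
            rwa [hU.pm_of_zero (hP.U_nonpos hA le_rfl)] at this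
          rw [hH1 _ hxB, hz'.pm_apply, hH1 _ (by linarith)]
          have e1 := hP.U_fixed hA hxB.le
          rw [show x + zA A P x - 1 + UA A B P (x + zA A P x - 1) = x + UA A B P x - 1 by
            rw [e1]; ring]
          simp only [perm_apply_inv]
          rw [hCd, hC.pm_apply, hC.pm_apply, CQ_right Q (by linarith), CQ_right Q (by linarith),
            hQ.sub_eq]
          congr 1; ring
        · push Not at hxB'
          rw [hz'.pm_of_zero (hP.z_large hA (by linarith)), hH2 _ (by linarith),
            hH2 _ (by linarith), ← hzW, hz.pm_of_zero
              (zeta_of_two_le hP.smooth hP.per hP.cut' (by linarith))]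
      · push Not at hxB
        rw [hz'.pm_of_zero (hP.z_large hA (by linarith)), hH2 _ (by linarith),
            hH2 _ (by linarith), ← hzW, hz.pm_of_zero
              (zeta_of_two_le hP.smooth hP.per hP.cut' (by linarith))]
  have key2 : H * tr⁻¹ * pm (zA A P) = tr⁻¹ * pm (zeta P) * H * fQ Q := by
    ext x
    simpa [Equiv.Perm.mul_apply] using key x
  have e : H * (fQ Q * (pm (zA A P))⁻¹ * tr) = (pm (zeta P))⁻¹ * tr * H := by
    calc H * (fQ Q * (pm (zA A P))⁻¹ * tr)
        = (pm (zeta P))⁻¹ * tr * (tr⁻¹ * pm (zeta P) * H * fQ Q) * (pm (zA A P))⁻¹ * tr := by group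
      _ = _ := by rw [← key2]; group
  rw [← mul_right_inj H, e]; group

/-- For a small family of periodic cocycles, the compactly supported maps they produce are, up to
a change of scale, conjugate to perturbations of the translation. -/
theorem exists_conjugacy : ∃ A₀ : ℝ, 1 ≤ A₀ ∧ ∀ A ≥ A₀, ∀ B : ℕ, 2 * A ≤ B → (B : ℝ) ≤ 2 * A + 1 →
    ∀ {ι : Type} {l : Filter ι} {Q : ι → ℝ → ℝ}, Sml l Q → (∀ᶠ i in l, Function.Periodic (Q i) 1) →
    ∃ z e : ι → ℝ → ℝ, ∃ c : ι → ℝ, Sml l z ∧ Sml l e ∧ ∀ᶠ i in l,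
      (∀ s ≤ 0, z i s = 0) ∧ (∀ s ≥ 2, z i s = 0) ∧ (∀ s ≤ -2, e i s = c i) ∧
      (∀ s ≥ (B : ℝ), e i s = 0) ∧
      fQ (Q i) * (pm (scal A (z i)))⁻¹ * tr = (pm (e i))⁻¹ * ((pm (z i))⁻¹ * tr) * pm (e i) := by
  obtain ⟨A₀, hA₀, hfp⟩ := exists_fixed_point
  refine ⟨A₀, hA₀, fun A hA B hB hB' => ?_⟩
  intro ι l Q hQ hper
  obtain ⟨κ, K, hκ, hK, hP⟩ := hfp A hA B hB hB'
  have hA1 : 1 ≤ A := hA₀.trans hA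
  have : ∀ i, ∃ P : ℝ → ℝ, Function.Periodic (Q i) 1 ∧ Bd 4 κ (Q i) → Ok A B P ∧
      P = Phi A B (Q i) P ∧ ∀ (j : ℕ) (q M : ℝ), q ≤ M → Bd (j + 4) q (Q i) →
        Bd (j + 4) (K j M * q) P := fun i => by
    by_cases h : Function.Periodic (Q i) 1 ∧ Bd 4 κ (Q i)
    · obtain ⟨P, h1⟩ := hP (Q i) h.1 h.2
      exact ⟨P, fun _ => h1⟩
    · exact ⟨0, fun h' => absurd h' h⟩
  choose P hP using this
  have hP' := (hper.and (hQ 4 κ hκ)).mono fun i hi => hP i hi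
  have hPs : Sml l P := hQ.map fun r => by
    refine ⟨r + 4, K r 1, 1, one_pos, hP'.mono fun i hi M hM h => ?_⟩
    exact (hi.2.2 r M 1 hM h).mono (by omega) le_rfl
  have hW : Sml l (fun i => cutW (P i)) := hPs.mul_bb (stp_bb one_pos)
  have hz : Sml l (fun i => zeta (P i)) :=
    hW.add (hW.dinv.comp (hW.evb.add (Bb.const (-1)).evb))
  have hUR : Sml l (fun i => UA A B (P i)) ∧ Sml l (fun i => RA A B (P i)) := by
    constructor <;>
    · refine hPs.map fun r => ?_
      obtain ⟨C, -, hC⟩ := Ok.R_base hA1 hB r 1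
      refine ⟨r, C, 1, one_pos, hP'.mono fun i hi M hM h => ?_⟩
      first | exact (hC M _ hM hi.1 h).1 | exact (hC M _ hM hi.1 h).2
  have hc : Tendsto (fun i => cA A B (Q i) (P i)) l (𝓝 0) := by
    have := (hUR.2.add (hQ.comp hUR.2.evb)).eval 0
    simpa [cA] using this
  have hCQ : Sml l (fun i => CQ (Q i)) := hQ.mul_bb (stp_bb (by norm_num))
  have hu : Sml l (fun i => uH A B (Q i) (P i)) :=
    (hUR.1.add (hCQ.comp hUR.1.evb)).add (Sml.const (by simpa using hc.neg))
  have hcut : Bb (fun s => 1 - stp (B : ℝ) (B + 1) s) := by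
    have := (Bb.const 1).add ((Bb.const (-1)).mul (stp_bb (a := (B : ℝ)) (b := B + 1) (by linarith)))
    simpa [sub_eq_add_neg] using this
  have he : Sml l (fun i => eH A B (Q i) (P i)) := (hu.add (hW.dinv.comp hu.evb)).mul_bb hcut
  refine ⟨_, _, fun i => -cA A B (Q i) (P i), hz, he, ?_⟩
  have hc1 : ∀ᶠ i in l, |cA A B (Q i) (P i)| ≤ 1 :=
    ((tendsto_zero_iff_abs_tendsto_zero _).1 hc).eventually_le_const one_pos
  filter_upwards [hP', hper, hz.dis, hUR.1.dis, hCQ.dis, he.dis, hc1]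
    with i h1 hper h2 h3 h4 h5 h6
  refine ⟨fun s hs => zeta_of_nonpos h1.1.smooth h1.1.cut' hs,
    fun s hs => zeta_of_two_le h1.1.smooth h1.1.per h1.1.cut' hs,
    fun s hs => eH_of_le hA1 h1.1 h6 hs, fun s hs => eH_of_ge hA1 hB h1.1 h1.2.1 h3 hs, ?_⟩
  refine line_identity hA1 hB h1.1 h1.2.1 hper h4 h3 h2 ⟨h1.1.z_smooth, fun s => ?_⟩ h5
  refine (h1.1.der s).trans ?_
  have hn1 : (1 : ℝ) ≤ nB B := by exact_mod_cast (show 1 ≤ nB B by unfold nB; omega)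
  apply one_div_le_one_div_of_le <;> linarith

end LineIdentity

section Scales

variable {z : ℝ → ℝ}

theorem Dis.scal {a : ℝ} (ha : 0 < a) (h : Dis z) : Dis (scal a z) := by
  refine ⟨scal_smooth a h.1, fun x => ?_⟩
  have := iteratedDeriv_scal a h.1 1 x
  simp only [iteratedDeriv_one] at this
  rw [this]
  have e : a * a⁻¹ ^ 1 = 1 := by rw [pow_one, mul_inv_cancel₀ ha.ne']
  rw [← mul_assoc, e, one_mul]
  exact h.2 _

/-- A map which is the homothety of ratio `a` near the support of `z` conjugates the scaled
copies of `z` to one another. -/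
theorem scale_conj {a b : ℝ} (ha : 1 ≤ a) (hb : 0 < b) (h : Dis z) (h0 : ∀ s ≤ 0, z s = 0)
    (h2 : ∀ s ≥ 2, z s = 0) {D : Equiv.Perm ℝ} (hD : StrictMono D)
    (hDa : ∀ s, 0 ≤ s → s ≤ 2 * b → D s = a * s) :
    D * pm (scal b z) = pm (scal (a * b) z) * D := by
  have ha0 : 0 < a := by linarith
  have h' := h.scal hb
  have h'' := h.scal (mul_pos ha0 hb)
  have z1 : ∀ c > 0, ∀ s ≤ 0, scal c z s = 0 := fun c hc s hs => by
    rw [_root_.scal, h0 _ (mul_nonpos_of_nonneg_of_nonpos (by positivity) hs), mul_zero]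
  have z2 : ∀ c > 0, ∀ s ≥ 2 * c, scal c z s = 0 := fun c hc s hs => by
    rw [_root_.scal, h2 _ (by rw [ge_iff_le, le_inv_mul_iff₀ hc]; linarith), mul_zero]
  have hab : 0 < a * b := mul_pos ha0 hb
  have D0 : D 0 = 0 := by simpa using hDa 0 le_rfl (by positivity)
  ext s
  simp only [Equiv.Perm.mul_apply]
  rcases le_total s 0 with hs | hs
  · have : D s ≤ 0 := by rw [← D0]; exact hD.monotone hs
    rw [h'.pm_of_zero (z1 b hb s hs), h''.pm_of_zero (z1 _ hab _ this)]
  rcases le_total s (2 * b) with hs2 | hs2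
  · have m1 := h'.strictMono.monotone hs
    have m2 := h'.strictMono.monotone hs2
    rw [h'.pm_of_zero (z1 b hb 0 le_rfl)] at m1
    rw [h'.pm_of_zero (z2 b hb _ le_rfl)] at m2
    rw [hDa _ m1 m2, hDa _ hs hs2, h'.pm_apply, h''.pm_apply, _root_.scal, _root_.scal,
      show (a * b)⁻¹ * (a * s) = b⁻¹ * s by field_simp]
    ring
  · have : 2 * (a * b) ≤ D s := by
      have := hD.monotone hs2
      rw [hDa _ (by positivity) le_rfl] at this
      linarith
    rw [h'.pm_of_zero (z2 b hb s hs2), h''.pm_of_zero (z2 _ hab _ this)]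

end Scales

section GroupIdentities

variable {G : Type*} [Group G]

theorem mul_inv_eq_two_commutators {K : ℕ} (hK : 1 ≤ K) (w : ℕ → G) (D : G)
    (h : ∀ j < K, D * w j * D⁻¹ = w (j + 1)) :
    ∃ W c : G, W = ((List.range K).map w).prod ∧
      c = ((List.range (K - 1)).map fun j => w (j + 1)).prod ∧
      w 0 * (w K)⁻¹ = (W * D * W⁻¹ * D⁻¹) * (c * w K * c⁻¹ * (w K)⁻¹) := by
  obtain ⟨m, rfl⟩ : ∃ m, K = m + 1 := ⟨K - 1, by omega⟩
  have h1 : ∀ n ≤ m + 1, D * ((List.range n).map w).prod * D⁻¹ =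
      ((List.range n).map fun j => w (j + 1)).prod := by
    intro n hn
    induction n with
    | zero => simp
    | succ n ih =>
      simp only [List.range_succ, List.map_append, List.map_cons, List.map_nil, List.prod_append,
        List.prod_cons, List.prod_nil, mul_one]
      rw [← ih (by omega), ← h n (by omega)]; group
  have h2 := h1 (m + 1) le_rfl
  have h3 : ((List.range (m + 1)).map w).prod =
      w 0 * ((List.range m).map fun j => w (j + 1)).prod := by
    rw [List.range_succ_eq_map]; simp [Function.comp_def]
  rw [List.range_succ (n := m)] at h2
  simp only [List.map_append, List.map_cons, List.map_nil, List.prod_append, List.prod_cons,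
    List.prod_nil, mul_one] at h2
  refine ⟨_, _, rfl, rfl, ?_⟩
  rw [show m + 1 - 1 = m from rfl]
  have h4 : ((List.range (m + 1)).map w).prod = ((List.range m).map w).prod * w m := by
    rw [List.range_succ]; simp
  rw [← h4] at h2
  set c := ((List.range m).map fun j => w (j + 1)).prod
  set W := ((List.range (m + 1)).map w).prod
  calc w 0 * (w (m + 1))⁻¹ = W * (c * w (m + 1))⁻¹ * (c * w (m + 1) * c⁻¹ * (w (m + 1))⁻¹) := by
        rw [h3]; group
    _ = _ := by rw [← h2]; group

end GroupIdentities

section Linearization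

variable {lam L η : ℝ} {u q : ℝ → ℝ}

theorem iteratedDeriv_two_shift (hu : ContDiff ℝ ∞ u) (hw : ContDiff ℝ ∞ q) (x : ℝ) :
    iteratedDeriv 2 (fun x => u (x + q x)) x =
      iteratedDeriv 2 u (x + q x) * (1 + deriv q x) ^ 2 + deriv u (x + q x) * iteratedDeriv 2 q x := by
  have e3 : ∀ f : ℝ → ℝ, iteratedDeriv 2 f = deriv (deriv f) := fun f => by
    rw [iteratedDeriv_succ', iteratedDeriv_one]
  rw [e3, deriv_shift hu hw, e3, e3]
  have e2 := congrFun (deriv_shift (smooth_deriv hu) hw) x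
  have a1 := (smooth_diff (smooth_shift (smooth_deriv hu) hw) x).hasDerivAt
  have a2 := (smooth_diff (smooth_one_add_deriv hw) x).hasDerivAt
  have := (a1.mul a2).deriv
  rw [e2] at this
  refine this.trans ?_
  simp
  ring

/-- The transfer operator `q ↦ lam • q ∘ (lam⁻¹ (id + u))`. -/
def KL (lam : ℝ) (u q : ℝ → ℝ) : ℝ → ℝ := fun y => scal lam q (y + u y)

/-- Iterates of the transfer operator on the displacement. -/
def kit (lam : ℝ) (u : ℝ → ℝ) : ℕ → ℝ → ℝ
  | 0 => u
  | n + 1 => KL lam u (kit lam u n)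

/-- Partial sums of the Neumann series. -/
def ksum (lam : ℝ) (u : ℝ → ℝ) : ℕ → ℝ → ℝ
  | 0 => fun _ => 0
  | n + 1 => fun y => ksum lam u n y + kit lam u n y

theorem ksum_succ (n : ℕ) (y : ℝ) :
    ksum lam u (n + 1) y = u y + KL lam u (ksum lam u n) y := by
  induction n generalizing y with
  | zero => simp [ksum, kit, KL, scal]
  | succ n ih =>
    rw [show ksum lam u (n + 1 + 1) y = ksum lam u (n + 1) y + kit lam u (n + 1) y from rfl, ih]
    simp only [ksum, kit, KL, scal]
    ring

/-- Standing assumptions on the displacement to be linearized. -/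
structure KHyp (lam L η : ℝ) (u : ℝ → ℝ) : Prop where
  one_lt : 1 < lam
  hL : 1 ≤ L
  hη : 0 ≤ η
  le_lam : 1 + η ≤ lam
  zero : ∀ y ≤ 0, u y = 0
  bd : Bd 2 η u

theorem KHyp.map_le (h : KHyp lam L η u) {y a : ℝ} (ha : 1 ≤ a) (hy : y ≤ a) :
    lam⁻¹ * (y + u y) ≤ a := by
  have h1 := h.one_lt
  rw [inv_mul_le_iff₀ (by linarith)]
  have h2 := (abs_le.1 (h.bd.2 y).zero_apply).2
  have := h.le_lam
  nlinarith

theorem KHyp.kit_smooth (h : KHyp lam L η u) (n : ℕ) : ContDiff ℝ ∞ (kit lam u n) := by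
  induction n with
  | zero => exact h.bd.1
  | succ n ih => exact smooth_shift (scal_smooth lam ih) h.bd.1

theorem KHyp.ksum_smooth (h : KHyp lam L η u) (n : ℕ) : ContDiff ℝ ∞ (ksum lam u n) := by
  induction n with
  | zero => exact contDiff_const
  | succ n ih => exact ih.add (h.kit_smooth n)

theorem KHyp.KL_zero (h : KHyp lam L η u) (hq : ∀ y ≤ 0, q y = 0) : ∀ y ≤ 0, KL lam u q y = 0 :=
  fun y hy => by
    have := h.one_lt
    rw [KL, scal, h.zero y hy, hq _ (mul_nonpos_of_nonneg_of_nonpos (by positivity) (by linarith)),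
      mul_zero]

theorem KHyp.kit_zero (h : KHyp lam L η u) (n : ℕ) : ∀ y ≤ 0, kit lam u n y = 0 := by
  induction n with
  | zero => exact h.zero
  | succ n ih => exact h.KL_zero ih

theorem abs_le_of_deriv_le {f : ℝ → ℝ} (hf : ContDiff ℝ ∞ f) (h0 : ∀ y < 0, f y = 0) {t : ℝ}
    (hL : 1 ≤ L) (ht : ∀ y ≤ L, |deriv f y| ≤ t) : ∀ y ≤ L, |f y| ≤ (L + 1) * t := by
  intro y hy
  have ht0 : 0 ≤ t := (abs_nonneg _).trans (ht 0 (by linarith))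
  rcases lt_or_ge y 0 with h | h
  · rw [h0 y h, abs_zero]; nlinarith
  · have := Convex.norm_image_sub_le_of_norm_deriv_le (f := f) (C := t) (s := Iic L)
      (fun x _ => smooth_diff hf x) (fun x hx => by simpa using ht x hx) (convex_Iic L)
      (x := -1) (y := y) (by simp; linarith) hy
    rw [h0 (-1) (by norm_num), sub_zero, Real.norm_eq_abs, Real.norm_eq_abs,
      abs_of_nonneg (by linarith : 0 ≤ y - -1)] at this
    nlinarith

theorem bdAt_two_of_top (hq : ContDiff ℝ ∞ q) (h0 : ∀ y ≤ 0, q y = 0) {t : ℝ} (hL : 1 ≤ L)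
    (ht : ∀ y ≤ L, |iteratedDeriv 2 q y| ≤ t) : ∀ y ≤ L, |deriv q y| ≤ (L + 1) * t ∧
      BdAt 2 ((L + 1) ^ 2 * t) q y := by
  have ht0 : 0 ≤ t := (abs_nonneg _).trans (ht 0 (by linarith))
  have hd0 : ∀ y < 0, deriv q y = 0 := fun y hy => by
    have : q =ᶠ[𝓝 y] fun _ => 0 := by
      filter_upwards [Iio_mem_nhds hy] with z hz
      exact h0 z (le_of_lt hz)
    rw [this.deriv_eq]; simp
  have e2 : deriv (deriv q) = iteratedDeriv 2 q := by
    rw [iteratedDeriv_succ', iteratedDeriv_one]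
  have h1 := abs_le_of_deriv_le (smooth_deriv hq) hd0 hL (fun y hy => by rw [e2]; exact ht y hy)
  have h2 := abs_le_of_deriv_le hq (fun y hy => h0 y hy.le) hL h1
  refine fun y hy => ⟨h1 y hy, ?_⟩
  have hb : (L + 1) * t ≤ (L + 1) ^ 2 * t := by nlinarith [mul_nonneg (by linarith : 0 ≤ L) ht0]
  intro k hk
  interval_cases k
  · simpa [pow_two, mul_assoc] using h2 y hy
  · simpa using (h1 y hy).trans hb
  · refine (ht y hy).trans ?_
    nlinarith [mul_nonneg (by linarith : 0 ≤ L) ht0]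

theorem iteratedDeriv_KL_scal (hlam : 1 < lam) (hq : ContDiff ℝ ∞ q) (k : ℕ) (s : ℝ) :
    iteratedDeriv (k + 1) (scal lam q) s = lam⁻¹ ^ k * iteratedDeriv (k + 1) q (lam⁻¹ * s) := by
  rw [iteratedDeriv_scal lam hq, pow_succ]
  have : lam ≠ 0 := by linarith
  field_simp

theorem KHyp.kit_two (h : KHyp lam L η u) {M : ℝ} (hM : Bd 2 M u) (n : ℕ) : ∀ y ≤ L,
    |iteratedDeriv 2 (kit lam u n) y| ≤ M * ((1 + η) ^ 2 * lam⁻¹ + (L + 1) * η) ^ n := by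
  set θ := (1 + η) ^ 2 * lam⁻¹ + (L + 1) * η
  induction n with
  | zero => intro y _; simpa [kit] using (hM.2 y).top
  | succ n ih =>
    intro y hy
    have hy' := h.map_le h.hL hy
    have h1 := h.one_lt
    set t := M * θ ^ n
    have ht0 : 0 ≤ t := (abs_nonneg _).trans (ih 0 (by linarith [h.hL]))
    have hd := (bdAt_two_of_top (h.kit_smooth n) (h.kit_zero n) h.hL ih _ hy').1
    have hu1 := (h.bd.2 y).deriv_apply
    have hu2 := (h.bd.2 y).top
    have hη := h.hη
    have ed : deriv (scal lam (kit lam u n)) (y + u y) =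
        deriv (kit lam u n) (lam⁻¹ * (y + u y)) := by
      have := iteratedDeriv_KL_scal h1 (h.kit_smooth n) 0 (y + u y)
      simpa [iteratedDeriv_one] using this
    rw [kit, show KL lam u (kit lam u n) = fun y => scal lam (kit lam u n) (y + u y) from rfl,
      iteratedDeriv_two_shift (scal_smooth lam (h.kit_smooth n)) h.bd.1,
      iteratedDeriv_KL_scal h1 (h.kit_smooth n) 1, ed, pow_one]
    have a1 : |1 + deriv u y| ≤ 1 + η := (abs_add_le _ _).trans (by rw [abs_one]; linarith)
    have i1 := ih _ hy'
    have hli : 0 < lam⁻¹ := by positivity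
    calc _ ≤ |lam⁻¹ * iteratedDeriv 2 (kit lam u n) (lam⁻¹ * (y + u y)) * (1 + deriv u y) ^ 2| +
          |deriv (kit lam u n) (lam⁻¹ * (y + u y)) * iteratedDeriv 2 u y| := abs_add_le _ _
      _ ≤ lam⁻¹ * t * (1 + η) ^ 2 + (L + 1) * t * η := by
          rw [abs_mul, abs_mul, abs_mul, abs_pow, abs_of_pos hli]
          gcongr
          have := h.hL
          positivity
      _ = M * θ ^ (n + 1) := by rw [pow_succ]; simp only [t, θ]; ring

theorem pow_aux (l x : ℝ) (k : ℕ) :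
    l ^ (k + 2) * x ^ (k + 3) = (l * x) ^ (k + 1) * (x ^ 2 * l) := by
  rw [mul_pow, show k + 3 = k + 1 + 2 from rfl, pow_add x (k + 1) 2, pow_succ l (k + 1)]
  ring

theorem kit_bound (hlam : 1 < lam) (hL : 1 ≤ L) (hη : 0 ≤ η)
    (hθ : (1 + η) ^ 2 * lam⁻¹ + (L + 1) * η < 1) {N : ℝ} (hN : 1 ≤ N) (k : ℕ) : ∃ C ρ : ℝ, 0 ≤ C ∧
    (1 + η) ^ 2 * lam⁻¹ + (L + 1) * η ≤ ρ ∧ ρ < 1 ∧ ∀ (u : ℝ → ℝ) (M : ℝ), KHyp lam L η u → M ≤ N →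
      Bd (k + 2) M u → ∀ n, ∀ y ≤ L, BdAt (k + 2) (C * M * ρ ^ n) (kit lam u n) y := by
  set θ := (1 + η) ^ 2 * lam⁻¹ + (L + 1) * η with hθd
  have hθ0 : 0 < θ := by positivity
  induction k with
  | zero =>
    refine ⟨(L + 1) ^ 2, θ, by positivity, le_rfl, hθ, fun u M h _ hM n y hy => ?_⟩
    rw [mul_assoc]
    exact (bdAt_two_of_top (h.kit_smooth n) (h.kit_zero n) hL (h.kit_two hM n) y hy).2
  | succ k ih =>
    obtain ⟨C, ρ, hC, hρ1, hρ2, ih⟩ := ih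
    obtain ⟨C1, hC1, hct⟩ := comp_top (k + 1) N
    set ρ' := (1 + ρ) / 2 with hρ'
    have hρ'' : ρ < ρ' := by rw [hρ']; linarith
    set E := C * N + C1 * (lam * C) with hE
    have hE0 : 0 ≤ E := by positivity
    have hgap : 0 < ρ' - θ := by linarith
    set C' := 1 + C + E / (ρ' - θ) with hC'
    have hEg : 0 ≤ E / (ρ' - θ) := by positivity
    have hC'0 : 0 ≤ C' := by positivity
    refine ⟨C', ρ', hC'0, by linarith, by rw [hρ']; linarith, fun u M h hM1 hM n => ?_⟩
    have hM0 := hM.nonneg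
    have hρ'0 : 0 ≤ ρ' := by linarith
    have hlow : ∀ n, ∀ y ≤ L, BdAt (k + 2) (C * M * ρ ^ n) (kit lam u n) y :=
      ih u M h hM1 (hM.mono (by omega) le_rfl)
    have hρn : ∀ n, ρ ^ n ≤ ρ' ^ n := fun n => pow_le_pow_left₀ (by linarith) hρ''.le n
    have htop : ∀ n, ∀ y ≤ L, |iteratedDeriv (k + 3) (kit lam u n) y| ≤ C' * M * ρ' ^ n := by
      intro n
      induction n with
      | zero =>
        intro y _
        have := (hM.2 y).top
        rw [pow_zero, mul_one, kit]
        refine this.trans ?_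
        nlinarith
      | succ n ihn =>
        intro y hy
        have hy' := h.map_le hL hy
        have hsm := scal_smooth lam (h.kit_smooth n)
        have hl := hlow n _ hy'
        have hli : 0 < lam⁻¹ := by positivity
        have hli1 : lam⁻¹ ≤ 1 := inv_le_one_of_one_le₀ hlam.le
        have hm0 := hl.nonneg
        have hbs : BdAt (k + 2) (lam * (C * M * ρ ^ n)) (scal lam (kit lam u n)) (y + u y) := by
          intro j hj
          rw [iteratedDeriv_scal lam (h.kit_smooth n), abs_mul, abs_mul, abs_pow, abs_of_pos hli,
            abs_of_pos (by linarith : 0 < lam)]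
          have := hl j hj
          have h3 : lam⁻¹ ^ j ≤ 1 := pow_le_one₀ hli.le hli1
          refine mul_le_mul_of_nonneg_left ?_ (by linarith)
          nlinarith [abs_nonneg (iteratedDeriv j (kit lam u n) (lam⁻¹ * (y + u y)))]
        have hu1 : BdAt (k + 2) N u y := (hM.2 y).mono (by omega) hM1
        have key := hct _ _ _ y hsm h.bd.1 hbs hu1
        have hdu := (h.bd.2 y).deriv_apply
        have hutop := (hM.2 y).top
        have hd1 := hl.deriv_apply
        have ed : deriv (scal lam (kit lam u n)) (y + u y) =
            deriv (kit lam u n) (lam⁻¹ * (y + u y)) := by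
          have := iteratedDeriv_KL_scal hlam (h.kit_smooth n) 0 (y + u y)
          simpa [iteratedDeriv_one] using this
        have e3 := iteratedDeriv_KL_scal hlam (h.kit_smooth n) (k + 2) (y + u y)
        rw [show k + 1 + 2 = k + 3 by ring] at key
        rw [e3, ed] at key
        have a1 : |1 + deriv u y| ≤ 1 + η := (abs_add_le _ _).trans (by rw [abs_one]; linarith)
        have a2 : lam⁻¹ ^ (k + 2) * (1 + η) ^ (k + 3) ≤ θ := by
          have b1 : lam⁻¹ * (1 + η) ≤ 1 := by
            rw [inv_mul_le_iff₀ (by linarith)]; linarith [h.le_lam]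
          calc lam⁻¹ ^ (k + 2) * (1 + η) ^ (k + 3)
              = (lam⁻¹ * (1 + η)) ^ (k + 1) * ((1 + η) ^ 2 * lam⁻¹) := by
                exact pow_aux _ _ _
            _ ≤ 1 * ((1 + η) ^ 2 * lam⁻¹) := by
                gcongr
                exact pow_le_one₀ (by positivity) b1
            _ ≤ θ := by rw [hθd]; nlinarith
        have t1 : |lam⁻¹ ^ (k + 2) * iteratedDeriv (k + 3) (kit lam u n) (lam⁻¹ * (y + u y)) *
            (1 + deriv u y) ^ (k + 3)| ≤ θ * (C' * M * ρ' ^ n) := by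
          rw [abs_mul, abs_mul, abs_pow, abs_pow, abs_of_pos hli]
          have := ihn _ hy'
          calc _ ≤ lam⁻¹ ^ (k + 2) * (C' * M * ρ' ^ n) * (1 + η) ^ (k + 3) := by gcongr
            _ = lam⁻¹ ^ (k + 2) * (1 + η) ^ (k + 3) * (C' * M * ρ' ^ n) := by ring
            _ ≤ _ := by gcongr
        have t2 : |deriv (kit lam u n) (lam⁻¹ * (y + u y)) * iteratedDeriv (k + 3) u y| ≤
            C * M * ρ ^ n * N := by
          rw [abs_mul]
          gcongr
          exact hutop.trans hM1
        have t3 : |iteratedDeriv (k + 3) (kit lam u (n + 1)) y| ≤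
            θ * (C' * M * ρ' ^ n) + C * M * ρ ^ n * N + C1 * (lam * (C * M * ρ ^ n)) := by
          rw [kit, show KL lam u (kit lam u n) = fun y => scal lam (kit lam u n) (y + u y) from rfl]
          generalize iteratedDeriv (k + 3) (fun y => scal lam (kit lam u n) (y + u y)) y = d0 at key ⊢
          rw [abs_le] at key t1 t2 ⊢
          constructor <;> linarith [key.1, key.2, t1.1, t1.2, t2.1, t2.2]
        refine t3.trans ?_
        have hEC : E ≤ C' * (ρ' - θ) := by
          rw [hC', add_mul, div_mul_cancel₀ _ hgap.ne']
          have := mul_nonneg (by linarith : 0 ≤ 1 + C) hgap.le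
          linarith
        calc θ * (C' * M * ρ' ^ n) + C * M * ρ ^ n * N + C1 * (lam * (C * M * ρ ^ n))
            = θ * (C' * M * ρ' ^ n) + E * M * ρ ^ n := by rw [hE]; ring
          _ ≤ θ * (C' * M * ρ' ^ n) + (C' * (ρ' - θ)) * M * ρ' ^ n := by
              have := hρn n
              have hρ0 : 0 ≤ ρ := by linarith
              gcongr
          _ = C' * M * ρ' ^ (n + 1) := by rw [pow_succ]; ring
    intro y hy
    refine BdAt.succ ((hlow n y hy).mono le_rfl ?_) (htop n y hy)
    have : C ≤ C' := by linarith
    have hρ0 : 0 ≤ ρ := by linarith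
    gcongr

theorem koenigs_line (hlam : 1 < lam) {a : ℝ} (ha : 1 ≤ a) : ∃ (η : ℝ) (C : ℕ → ℝ), 0 < η ∧
    ∀ u : ℝ → ℝ, (∀ y ≤ 0, u y = 0) → Bb u → Bd 2 η u → ∃ q : ℝ → ℝ, ContDiff ℝ ∞ q ∧
      (∀ y ≤ 0, q y = 0) ∧ (∀ y ≤ a, q y = u y + lam * q (lam⁻¹ * (y + u y))) ∧
      ∀ (k : ℕ) (M : ℝ), M ≤ 1 → Bd (k + 2) M u → Bd (k + 2) (C k * M) q := by
  have hli : 0 < lam⁻¹ := by positivity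
  have hli1 : lam⁻¹ < 1 := inv_lt_one_of_one_lt₀ hlam
  set L := a + 1 with hLd
  have hL : 1 ≤ L := by linarith
  set η := (1 - lam⁻¹) / (2 * (L + 4)) with hηd
  have hη0 : 0 < η := by
    have : 0 < 1 - lam⁻¹ := by linarith
    positivity
  have hη2 : (L + 4) * η = (1 - lam⁻¹) / 2 := by
    rw [hηd]
    have : L + 4 ≠ 0 := by positivity
    field_simp
  have hη1 : η ≤ 1 := by nlinarith
  have hθ : (1 + η) ^ 2 * lam⁻¹ + (L + 1) * η < 1 := by
    have h1 : (1 + η) ^ 2 ≤ 1 + 3 * η := by nlinarith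
    have h2 := mul_le_mul_of_nonneg_right h1 hli.le
    nlinarith
  have hle : 1 + η ≤ lam := by
    have h1 : 1 - lam⁻¹ ≤ lam - 1 := by
      have : lam * lam⁻¹ = 1 := mul_inv_cancel₀ (by linarith)
      nlinarith
    nlinarith
  have hθ0 : 0 < (1 + η) ^ 2 * lam⁻¹ + (L + 1) * η := by positivity
  have hcut : Bb (fun y => 1 - stp a L y) := by
    have := (Bb.const 1).add ((Bb.const (-1)).mul (stp_bb (a := a) (b := L) (by linarith)))
    simpa [sub_eq_add_neg] using this
  choose X hX using hcut
  have hX0 : ∀ k, 0 ≤ X k := fun k => (hX k).nonneg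
  set χ := fun y => 1 - stp a L y with hχ
  have hχs : ContDiff ℝ ∞ χ := (hX 0).1
  have hχ0 : ∀ y, L ≤ y → χ y = 0 := fun y hy => by
    simp only [hχ]; rw [stp_one (by linarith) hy, sub_self]
  have hχ1 : ∀ y ≤ a, χ y = 1 := fun y hy => by
    simp only [hχ]; rw [stp_zero (by linarith) hy, sub_zero]
  have cut : ∀ (k : ℕ) (N : ℝ) (g : ℝ → ℝ), 0 ≤ N → ContDiff ℝ ∞ g → (∀ y ≤ L, BdAt k N g y) →
      Bd k (2 ^ k * X k * N) (fun y => χ y * g y) := by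
    intro k N g hN hg h
    refine ⟨hχs.mul hg, fun y => ?_⟩
    rcases le_or_gt y L with hy | hy
    · exact BdAt.mul hχs hg ((hX k).2 y) (h y hy)
    · intro j hj
      have : (fun y => χ y * g y) =ᶠ[𝓝 y] fun _ => 0 := by
        filter_upwards [Ioi_mem_nhds hy] with z hz
        rw [hχ0 z (le_of_lt hz), zero_mul]
      rw [this.iteratedDeriv_eq j]
      have := hX0 k
      have h0 : |iteratedDeriv j (fun _ : ℝ => (0 : ℝ)) y| = 0 := by
        simp
      rw [h0]; positivity
  have hksum : ∀ (N : ℝ), 1 ≤ N → ∀ k, ∃ C : ℝ, 0 ≤ C ∧ ∀ (u : ℝ → ℝ) (M : ℝ), KHyp lam L η u →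
      M ≤ N → Bd (k + 2) M u → ∀ n, Bd (k + 2) (C * M) (fun y => χ y * ksum lam u n y) := by
    intro N hN k
    obtain ⟨C, ρ, hC, hρ1, hρ2, hkb⟩ := kit_bound hlam hL hη0.le hθ hN k
    have hρ : 0 ≤ ρ := hθ0.le.trans hρ1
    have hg : 0 < 1 - ρ := by linarith
    have := hX0 (k + 2)
    refine ⟨2 ^ (k + 2) * X (k + 2) * (C / (1 - ρ)), by positivity, fun u M h hM1 hM n => ?_⟩
    have hM0 := hM.nonneg
    rw [mul_assoc]
    refine cut _ _ _ (by positivity) (h.ksum_smooth n) fun y hy => ?_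
    have : BdAt (k + 2) (C / (1 - ρ) * M * (1 - ρ ^ n)) (ksum lam u n) y := by
      induction n with
      | zero => exact BdAt.const (c := 0) (by simp)
      | succ n ih =>
        refine (ih.add (h.ksum_smooth n) (h.kit_smooth n) (hkb u M h hM1 hM n y hy)).mono le_rfl ?_
        rw [pow_succ]
        apply le_of_eq
        field_simp
        ring
    refine this.mono le_rfl ?_
    have h1 : 0 ≤ C / (1 - ρ) * M := by positivity
    have h2 : 0 ≤ ρ ^ n := by positivity
    nlinarith
  choose C hC hCb using hksum 1 le_rfl
  refine ⟨η, C, hη0, fun u hu0 hub hu => ?_⟩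
  have h : KHyp lam L η u := ⟨hlam, hL, hη0.le, hle, hu0, hu⟩
  obtain ⟨C0, ρ0, hC0, hρ01, hρ02, hk0⟩ := kit_bound hlam hL hη0.le hθ le_rfl 0
  obtain ⟨q, hq, hlim⟩ := exists_smooth_limit (p := fun n y => χ y * ksum lam u n y)
    (C := C0 * η) (θ := ρ0) (fun n => hχs.mul (h.ksum_smooth n)) (fun k => by
      obtain ⟨M, hM⟩ := hub (k + 2)
      obtain ⟨C', hC', hb⟩ := hksum (max 1 M) (le_max_left _ _) k
      exact ⟨C' * M, fun n x => (hb u M h (le_max_right _ _) hM n).2 x k (by omega)⟩)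
    (hθ0.trans_le hρ01) hρ02 fun n x => by
      have hρ0 : 0 ≤ ρ0 := hθ0.le.trans hρ01
      rw [ksum, mul_add, add_sub_cancel_left]
      rcases le_or_gt x L with hx | hx
      · rw [abs_mul]
        have h1 := (hk0 u η h hη1 hu n x hx).zero_apply
        have h2 : |χ x| ≤ 1 := by
          rw [abs_le]
          constructor <;> simp only [hχ] <;> linarith [stp_nonneg a L x, stp_le_one a L x]
        nlinarith [abs_nonneg (χ x), abs_nonneg (kit lam u n x)]
      · rw [hχ0 x hx.le, zero_mul, abs_zero]; positivity
  have hl0 : ∀ y, Tendsto (fun n => χ y * ksum lam u n y) atTop (𝓝 (q y)) := fun y => by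
    simpa using hlim 0 y
  have hl1 : ∀ y ≤ a, Tendsto (fun n => ksum lam u n y) atTop (𝓝 (q y)) := fun y hy => by
    simpa [hχ1 y hy] using hl0 y
  refine ⟨q, hq, fun y hy => ?_, fun y hy => ?_, fun k M hM hb => Bd.of_tendsto hq hlim
    fun n => hCb k u M h hM hb n⟩
  · refine tendsto_nhds_unique (hl1 y (by linarith)) ?_
    have : ∀ n, ksum lam u n y = 0 := fun n => by
      induction n with
      | zero => rfl
      | succ n ih => simp only [ksum]; rw [ih, h.kit_zero n y hy, add_zero]
    simp [this]
  · refine tendsto_nhds_unique ((tendsto_add_atTop_iff_nat 1).2 (hl1 y hy)) ?_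
    simp only [ksum_succ, KL, scal]
    exact ((hl1 _ (h.map_le ha hy)).const_mul lam).const_add _

end Linearization

section Extension

theorem iteratedDerivWithin_add_id {d : ℝ → ℝ} (hd : ContDiff ℝ ∞ d) (k : ℕ) {x : ℝ}
    (hx : x ∈ Icc (0 : ℝ) 1) :
    iteratedDerivWithin k (fun x => x + d x) (Icc 0 1) x - iteratedDerivWithin k id (Icc 0 1) x =
      iteratedDeriv k d x := by
  have hu : UniqueDiffOn ℝ (Icc (0 : ℝ) 1) := uniqueDiffOn_Icc one_pos
  have hk : ((k : ℕ∞) : WithTop ℕ∞) ≤ ∞ := by exact_mod_cast le_top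
  have hs : ContDiff ℝ ∞ (fun x => x + d x) := contDiff_id.add hd
  rw [iteratedDerivWithin_eq_iteratedDeriv hu (hs.of_le hk).contDiffAt hx,
    iteratedDerivWithin_eq_iteratedDeriv hu contDiff_id.contDiffAt hx]
  have := iteratedDeriv_add_smooth (contDiff_id (𝕜 := ℝ) (E := ℝ) (n := ∞)) hd k x
  simp only [id] at this
  rw [this]
  simp

/-- Extending the displacement of an infinitely tangent to the identity diffeomorphism by zero. -/
theorem exists_extension (f : DiffIcc ⊤) (h0 : ITIat f.toFun 0) (h1 : ITIat f.toFun 1) :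
    ∃ u : ℝ → ℝ, ContDiff ℝ ∞ u ∧ (∀ x ∉ Ioo (0 : ℝ) 1, u x = 0) ∧
      (∀ x ∈ Icc (0 : ℝ) 1, f.toFun x = x + u x) ∧
      ∀ r ε, IDistLt r ε f.toFun id → Bd r ε u := by
  classical
  have hu : UniqueDiffOn ℝ (Icc (0 : ℝ) 1) := uniqueDiffOn_Icc one_pos
  set w : ℝ → ℝ := fun x => f.toFun x - x with hw
  have hws : ContDiffOn ℝ ∞ w (Icc 0 1) := f.smooth.sub contDiffOn_id
  set v : ℕ → ℝ → ℝ := fun k x => if x ∈ Icc (0 : ℝ) 1 then iteratedDerivWithin k w (Icc 0 1) x else 0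
    with hv
  have hsplit : ∀ k, ∀ x ∈ Icc (0 : ℝ) 1, iteratedDerivWithin k w (Icc 0 1) x =
      iteratedDerivWithin k f.toFun (Icc 0 1) x - iteratedDerivWithin k id (Icc 0 1) x := by
    intro k x hx
    have hk : ((k : ℕ∞) : WithTop ℕ∞) ≤ ∞ := by exact_mod_cast le_top
    exact iteratedDerivWithin_sub hx hu ((f.smooth.of_le hk) x hx) contDiffWithinAt_id
  have hend : ∀ a ∈ Icc (0 : ℝ) 1, ITIat f.toFun a → f.toFun a = a → ∀ k,
      iteratedDerivWithin k w (Icc 0 1) a = 0 := by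
    intro a ha hI hfa k
    match k with
    | 0 => simp [hw, hfa]
    | 1 =>
      rw [hsplit 1 a ha, iteratedDerivWithin_one, iteratedDerivWithin_one, hI.1,
        derivWithin_id _ _ (hu a ha), sub_self]
    | k + 2 =>
      rw [hsplit _ a ha, hI.2 _ (by omega)]
      have := iteratedDerivWithin_add_id (d := fun _ => 0) contDiff_const (k + 2) ha
      rw [iteratedDerivWithin_eq_iteratedDeriv hu contDiff_id.contDiffAt ha]
      simp [iteratedDeriv_succ']
  have hwd : ∀ k, ∀ x ∈ Icc (0 : ℝ) 1,
      HasDerivWithinAt (v k) (iteratedDerivWithin (k + 1) w (Icc 0 1) x) (Icc 0 1) x := by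
    intro k x hx
    have hk : ((k : ℕ∞) : WithTop ℕ∞) < ∞ := by exact_mod_cast ENat.natCast_lt_top k
    have := (hws.differentiableOn_iteratedDerivWithin hk hu x hx).hasDerivWithinAt
    rw [← iteratedDerivWithin_succ] at this
    exact this.congr (fun y hy => if_pos hy) (if_pos hx)
  have hder : ∀ k x, HasDerivAt (v k) (v (k + 1) x) x := by
    intro k x
    have hout : ∀ s : Set ℝ, (∀ y ∈ s, v k y = 0) → x ∈ s → v (k + 1) x = 0 →
        HasDerivWithinAt (v k) (v (k + 1) x) s x := by
      intro s hs hx h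
      rw [h]
      exact (hasDerivWithinAt_const x s (0 : ℝ)).congr hs (hs x hx)
    have v0 : ∀ k, v k 0 = 0 := fun k => by
      simp only [hv]
      rw [if_pos (by simp), hend 0 (by simp) h0 f.fix0]
    have v1 : ∀ k, v k 1 = 0 := fun k => by
      simp only [hv]
      rw [if_pos (by simp), hend 1 (by simp) h1 f.fix1]
    have vl : ∀ k, ∀ y ∈ Iic (0 : ℝ), v k y = 0 := fun k y hy => by
      rcases eq_or_lt_of_le (mem_Iic.1 hy) with h | h
      · rw [h, v0]
      · exact if_neg fun h' => by linarith [h'.1]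
    have vr : ∀ k, ∀ y ∈ Ici (1 : ℝ), v k y = 0 := fun k y hy => by
      rcases eq_or_lt_of_le (mem_Ici.1 hy) with h | h
      · rw [← h, v1]
      · exact if_neg fun h' => by linarith [h'.2]
    have hin : x ∈ Icc (0 : ℝ) 1 → HasDerivWithinAt (v k) (v (k + 1) x) (Icc 0 1) x := fun hx => by
      have := hwd k x hx
      rwa [show iteratedDerivWithin (k + 1) w (Icc 0 1) x = v (k + 1) x from (if_pos hx).symm] at this
    rcases lt_trichotomy x 0 with hx | hx | hx
    · exact (hout _ (vl k) (mem_Iic.2 hx.le) (vl _ _ hx.le)).hasDerivAt (Iic_mem_nhds hx)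
    · have a1 := hin (by simp [hx])
      have a2 := hout _ (vl k) (mem_Iic.2 hx.le) (vl _ _ hx.le)
      refine (a2.union a1).hasDerivAt ?_
      rw [Iic_union_Icc_eq_Iic zero_le_one, hx]
      exact Iic_mem_nhds one_pos
    rcases lt_trichotomy x 1 with hx1 | hx1 | hx1
    · exact (hin ⟨hx.le, hx1.le⟩).hasDerivAt (Icc_mem_nhds hx hx1)
    · have a1 := hin (by simp [hx1])
      have a2 := hout _ (vr k) (mem_Ici.2 hx1.ge) (vr _ _ hx1.ge)
      refine (a1.union a2).hasDerivAt ?_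
      rw [Icc_union_Ici_eq_Ici zero_le_one, hx1]
      exact Ici_mem_nhds one_pos
    · exact (hout _ (vr k) (mem_Ici.2 hx1.le) (vr _ _ hx1.le)).hasDerivAt (Ici_mem_nhds hx1)
  obtain ⟨hs, he⟩ := smooth_of_hasDerivAt_seq hder
  refine ⟨v 0, hs, fun x hx => ?_, fun x hx => ?_, fun r ε h => ⟨hs, fun x k hk => ?_⟩⟩
  · simp only [hv]
    split_ifs with h
    · rcases eq_or_lt_of_le h.1 with h' | h'
      · rw [← h']; exact hend 0 (by simp) h0 f.fix0 0
      · rcases eq_or_lt_of_le h.2 with h'' | h''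
        · rw [h'']; exact hend 1 (by simp) h1 f.fix1 0
        · exact absurd ⟨h', h''⟩ hx
    · rfl
  · simp only [hv]; rw [if_pos hx]; simp [hw]
  · rw [he]
    simp only [hv]
    split_ifs with hx
    · rw [hsplit k x hx]; exact (h k hk x hx).le
    · rw [abs_zero]; exact (abs_nonneg _).trans (h 0 (Nat.zero_le _) 0 (by simp)).le

end Extension

section Coordinates

/-- Inverse of the sigmoid function. -/
def lgt (x : ℝ) : ℝ := Real.log x - Real.log (1 - x)

theorem sigmoid_lgt {x : ℝ} (h0 : 0 < x) (h1 : x < 1) : Real.sigmoid (lgt x) = x := by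
  have : 0 < 1 - x := by linarith
  rw [lgt, Real.sigmoid_def, neg_sub, Real.exp_sub, Real.exp_log this, Real.exp_log h0]
  field_simp
  ring

theorem lgt_sigmoid (t : ℝ) : lgt (Real.sigmoid t) = t :=
  Real.sigmoid_injective (sigmoid_lgt (Real.sigmoid_pos t) (Real.sigmoid_lt_one t))

theorem lgt_contDiffAt {x : ℝ} (h0 : 0 < x) (h1 : x < 1) : ContDiffAt ℝ ∞ lgt x :=
  (contDiffAt_id.log h0.ne').sub ((contDiffAt_const.sub contDiffAt_id).log (by simp; linarith))

/-- The permutation `g`, read through `s ↦ σ(τ s)`, is the map `x ↦ x + d x` of `[0,1]`. -/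
def Rlz (τ : ℝ) (d : ℝ → ℝ) (g : Equiv.Perm ℝ) : Prop :=
  d 0 = 0 ∧ d 1 = 0 ∧ ∀ s, Real.sigmoid (τ * g s) = Real.sigmoid (τ * s) + d (Real.sigmoid (τ * s))

/-- The permutation `g` comes from a diffeomorphism of `[0,1]` close to the identity. -/
def Good (τ : ℝ) (r : ℕ) (ε : ℝ) (g : Equiv.Perm ℝ) : Prop :=
  ∃ F : DiffIcc ⊤, IDistLt r ε F.toFun id ∧
    ∀ s, F.toFun (Real.sigmoid (τ * s)) = Real.sigmoid (τ * g s)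

variable {τ : ℝ} {d d' : ℝ → ℝ} {g g' : Equiv.Perm ℝ}

theorem Rlz.mul (h : Rlz τ d g) (h' : Rlz τ d' g') :
    Rlz τ (fun x => d' x + d (x + d' x)) (g * g') := by
  refine ⟨by simp [h.1, h'.1], by simp [h.2.1, h'.2.1], fun s => ?_⟩
  rw [Equiv.Perm.mul_apply, h.2.2, h'.2.2, add_assoc]

theorem Rlz.inv (hd : Dis d) (h : Rlz τ d g) : Rlz τ (dinv d) g⁻¹ := by
  refine ⟨hd.dinv_zero h.1, hd.dinv_zero h.2.1, fun s => ?_⟩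
  have := h.2.2 (g⁻¹ s)
  rw [perm_apply_inv] at this
  rw [this, (dinv_spec hd.1 hd.2).2.1]
  ring

theorem Rlz.of_line {η : ℝ → ℝ} (h0 : d 0 = 0) (h1 : d 1 = 0)
    (h : ∀ t, Real.sigmoid (t + η t) = Real.sigmoid t + d (Real.sigmoid t))
    (hg : ∀ s, τ * g s = τ * s + η (τ * s)) : Rlz τ d g :=
  ⟨h0, h1, fun s => by rw [hg, h]⟩

theorem Dis.mapsTo_Icc (hd : Dis d) (h0 : d 0 = 0) (h1 : d 1 = 0) :
    MapsTo (pm d) (Icc 0 1) (Icc 0 1) := fun x hx => by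
  have a0 := hd.strictMono.monotone hx.1
  have a1 := hd.strictMono.monotone hx.2
  rw [hd.pm_of_zero h0] at a0
  rw [hd.pm_of_zero h1] at a1
  exact ⟨a0, a1⟩

theorem Dis.inv_mapsTo_Icc (hd : Dis d) (h0 : d 0 = 0) (h1 : d 1 = 0) :
    MapsTo ((pm d)⁻¹ : Equiv.Perm ℝ) (Icc 0 1) (Icc 0 1) := fun x hx => by
  have e := perm_apply_inv (pm d) x
  constructor
  · by_contra! h
    have := hd.strictMono h
    rw [e, hd.pm_of_zero h0] at this
    linarith [hx.1]
  · by_contra! h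
    have := hd.strictMono h
    rw [e, hd.pm_of_zero h1] at this
    linarith [hx.2]

theorem Dis.exists_diffIcc (hd : Dis d) (h0 : d 0 = 0) (h1 : d 1 = 0) :
    ∃ F : DiffIcc ⊤, F.toFun = fun x => x + d x := by
  have e : (pm d : ℝ → ℝ) = fun x => x + d x := funext hd.pm_apply
  have e' : ((pm d)⁻¹ : Equiv.Perm ℝ) = fun x => x + dinv d x := funext hd.pm_inv_apply
  refine ⟨⟨pm d, ((pm d)⁻¹ : Equiv.Perm ℝ), ?_, ?_, hd.mapsTo_Icc h0 h1, hd.inv_mapsTo_Icc h0 h1,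
    fun x _ => perm_inv_apply _ x, fun x _ => perm_apply_inv _ x, hd.pm_of_zero h0,
    hd.pm_of_zero h1, fun x hx => ?_⟩, e⟩
  · rw [e]; exact (contDiff_id.add hd.1).contDiffOn
  · rw [e']; exact (contDiff_id.add (dinv_spec hd.1 hd.2).1).contDiffOn
  · have hx' := smooth_diff hd.1 x
    have h2 : HasDerivAt (fun x => x + d x) (1 + deriv d x) x :=
      (hasDerivAt_id' x).add hx'.hasDerivAt
    rw [e, h2.hasDerivWithinAt.derivWithin (uniqueDiffOn_Icc one_pos x hx)]
    have := abs_le.1 (hd.2 x)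
    linarith [this.1]

theorem Rlz.good (h : Rlz τ d g) (hd : Dis d) {r : ℕ} {ε ε' : ℝ} (hb : Bd r ε' d) (hε : ε' < ε) :
    Good τ r ε g := by
  obtain ⟨F, hF⟩ := hd.exists_diffIcc h.1 h.2.1
  refine ⟨F, fun k hk x hx => ?_, fun s => by rw [hF, h.2.2]⟩
  rw [hF, iteratedDerivWithin_add_id hd.1 k hx]
  exact (hb.2 x k hk).trans_lt hε

theorem exists_rlz (hτ : 0 < τ) (hd : Dis d) (h0 : d 0 = 0) (h1 : d 1 = 0) :
    ∃ g : Equiv.Perm ℝ, Rlz τ d g := by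
  have key : ∀ s, Real.sigmoid (lgt (pm d (Real.sigmoid s))) = pm d (Real.sigmoid s) := fun s => by
    have a0 := hd.strictMono (Real.sigmoid_pos s)
    have a1 := hd.strictMono (Real.sigmoid_lt_one s)
    rw [hd.pm_of_zero h0] at a0
    rw [hd.pm_of_zero h1] at a1
    exact sigmoid_lgt a0 a1
  have key' : ∀ s, Real.sigmoid (lgt ((pm d)⁻¹ (Real.sigmoid s))) = (pm d)⁻¹ (Real.sigmoid s) :=
    fun s => by
      have e := perm_apply_inv (pm d) (Real.sigmoid s)
      refine sigmoid_lgt ?_ ?_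
      · by_contra! h
        have := hd.strictMono.monotone h
        rw [e, hd.pm_of_zero h0] at this
        linarith [Real.sigmoid_pos s]
      · by_contra! h
        have := hd.strictMono.monotone h
        rw [e, hd.pm_of_zero h1] at this
        linarith [Real.sigmoid_lt_one s]
  refine ⟨⟨fun s => τ⁻¹ * lgt (pm d (Real.sigmoid (τ * s))),
    fun s => τ⁻¹ * lgt ((pm d)⁻¹ (Real.sigmoid (τ * s))), fun s => ?_, fun s => ?_⟩, h0, h1,
    fun s => ?_⟩
  · simp only
    rw [mul_inv_cancel_left₀ hτ.ne', key, perm_inv_apply, lgt_sigmoid, inv_mul_cancel_left₀ hτ.ne']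
  · simp only
    rw [mul_inv_cancel_left₀ hτ.ne', key', perm_apply_inv, lgt_sigmoid, inv_mul_cancel_left₀ hτ.ne']
  · simp only [Equiv.coe_fn_mk]
    rw [mul_inv_cancel_left₀ hτ.ne', key, hd.pm_apply]

theorem Rlz.strictMono (hτ : 0 < τ) (hd : Dis d) (h : Rlz τ d g) : StrictMono g := fun s s' hs => by
  have h1 := h.2.2 s
  have h2 := h.2.2 s'
  have h3 := hd.strictMono (Real.sigmoid_strictMono (mul_lt_mul_of_pos_left hs hτ))
  rw [hd.pm_apply, hd.pm_apply, ← h1, ← h2, Real.sigmoid_lt_iff] at h3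
  exact lt_of_mul_lt_mul_left h3 hτ.le

end Coordinates

section Conversion

/-- A cutoff equal to `1` on `[σ(-4), σ(4)]`. -/
def midCut : ℝ → ℝ :=
  plat (Real.sigmoid (-5)) (Real.sigmoid (-4)) (Real.sigmoid 4) (Real.sigmoid 5)

/-- The inverse sigmoid function, cut off near the endpoints. -/
def lgtCut (x : ℝ) : ℝ :=
  plat (Real.sigmoid (-6)) (Real.sigmoid (-5)) (Real.sigmoid 5) (Real.sigmoid 6) x * lgt x

/-- A smooth function with value `η t` at `σ t`, for `η` constant near each end. -/
def pullback (η : ℝ → ℝ) (x : ℝ) : ℝ :=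
  η (-3) * ((1 - midCut x) * (1 - stp (Real.sigmoid (-3)) (Real.sigmoid 3) x)) +
    η 3 * ((1 - midCut x) * stp (Real.sigmoid (-3)) (Real.sigmoid 3) x) +
    η (lgtCut x) * midCut x

/-- The unit interval displacement corresponding to the displacement `η` of the line. -/
def conv (η : ℝ → ℝ) (x : ℝ) : ℝ :=
  ((Real.exp (pullback η x) - 1) - (Real.exp (pullback η x) - 1) *
    ((Real.exp (pullback η x) - 1) * (plat (-2) (-1) 2 3 x * x) /
      (1 + (Real.exp (pullback η x) - 1) * (plat (-2) (-1) 2 3 x * x)))) *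
    (plat (-2) (-1) 2 3 x * (x * (1 - x)))

theorem sg_lt {a b : ℝ} (h : a < b) : Real.sigmoid a < Real.sigmoid b := Real.sigmoid_lt h

theorem midCut_bb : Bb midCut := plat_bb (sg_lt (by norm_num)) (sg_lt (by norm_num))

theorem lgtCut_bb : Bb lgtCut :=
  cut_bb (sg_lt (by norm_num)) (sg_lt (by norm_num)) fun x hx =>
    lgt_contDiffAt ((Real.sigmoid_pos _).trans_le hx.1) (hx.2.trans_lt (Real.sigmoid_lt_one _))

theorem Bb.one_sub {u : ℝ → ℝ} (h : Bb u) : Bb (fun x => 1 - u x) := by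
  have := (Bb.const 1).add ((Bb.const (-1)).mul h)
  simpa [sub_eq_add_neg] using this

theorem pullback_sigmoid {η : ℝ → ℝ} (hl : ∀ t ≤ -3, η t = η (-3)) (hr : ∀ t ≥ 3, η t = η 3)
    (t : ℝ) : pullback η (Real.sigmoid t) = η t := by
  have hmid : ∀ t, |t| ≤ 4 → midCut (Real.sigmoid t) = 1 := fun t ht => by
    have := abs_le.1 ht
    exact plat_one (sg_lt (by norm_num)) (sg_lt (by norm_num))
      ⟨Real.sigmoid_le this.1, Real.sigmoid_le this.2⟩
  have hout : ∀ t, 5 ≤ |t| → midCut (Real.sigmoid t) = 0 := fun t ht => by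
    refine plat_zero (sg_lt (by norm_num)) (sg_lt (by norm_num)) fun h => ?_
    have h1 := Real.sigmoid_lt_iff.1 h.1
    have h2 := Real.sigmoid_lt_iff.1 h.2
    exact absurd ht (not_le.2 (abs_lt.2 ⟨h1, h2⟩))
  have hlg : ∀ t, |t| ≤ 5 → lgtCut (Real.sigmoid t) = t := fun t ht => by
    have := abs_le.1 ht
    rw [lgtCut, plat_one (sg_lt (by norm_num)) (sg_lt (by norm_num))
      ⟨Real.sigmoid_le this.1, Real.sigmoid_le this.2⟩, one_mul, lgt_sigmoid]
  have hmlg : η (lgtCut (Real.sigmoid t)) * midCut (Real.sigmoid t) =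
      η t * midCut (Real.sigmoid t) := by
    rcases le_or_gt |t| 5 with h | h
    · rw [hlg t h]
    · rw [hout t h.le, mul_zero, mul_zero]
  have h33 : Real.sigmoid (-3) < Real.sigmoid 3 := sg_lt (by norm_num)
  rw [pullback, hmlg]
  rcases le_or_gt t (-3) with h | h
  · rw [stp_zero h33 (Real.sigmoid_le h), hl t h]; ring
  rcases le_or_gt 3 t with h' | h'
  · rw [stp_one h33 (Real.sigmoid_le h'), hr t h']; ring
  · rw [hmid t (abs_le.2 ⟨by linarith, by linarith⟩)]; ring

theorem conv_zero (η : ℝ → ℝ) : conv η 0 = 0 := by simp [conv]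

theorem conv_one (η : ℝ → ℝ) : conv η 1 = 0 := by simp [conv]

theorem conv_spec {η : ℝ → ℝ} (hl : ∀ t ≤ -3, η t = η (-3)) (hr : ∀ t ≥ 3, η t = η 3) (t : ℝ) :
    Real.sigmoid (t + η t) = Real.sigmoid t + conv η (Real.sigmoid t) := by
  have h0 := Real.sigmoid_pos t
  have h1 := Real.sigmoid_lt_one t
  rw [conv, pullback_sigmoid hl hr, plat_one (by norm_num) (by norm_num) ⟨by linarith, by linarith⟩]
  rw [Real.sigmoid_def, Real.sigmoid_def, neg_add, Real.exp_add, Real.exp_neg (η t)]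
  have e1 := Real.exp_pos (-t)
  have e2 := Real.exp_pos (η t)
  generalize Real.exp (-t) = p at e1
  generalize Real.exp (η t) = q at e2
  have : 1 + p ≠ 0 := by positivity
  have h3 : 1 + (q - 1) * (1 * (1 + p)⁻¹) = (p + q) / (1 + p) := by field_simp; ring
  rw [h3]
  have : p + q ≠ 0 := by positivity
  field_simp
  ring

theorem Sml.conv {ι : Type*} {l : Filter ι} {η : ι → ℝ → ℝ} (h : Sml l η) :
    Sml l (fun i => conv (η i)) := by
  have hS : Bb (stp (Real.sigmoid (-3)) (Real.sigmoid 3)) := stp_bb (sg_lt (by norm_num))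
  have hP : Bb (plat (-2) (-1) 2 3) := plat_bb (by norm_num) (by norm_num)
  have hq : Sml l (fun i => pullback (η i)) := by
    have h1 := (Sml.const (h.eval (-3))).mul_bb (midCut_bb.one_sub.mul hS.one_sub)
    have h2 := (Sml.const (h.eval 3)).mul_bb (midCut_bb.one_sub.mul hS)
    have h3 := (h.comp_fixed lgtCut_bb.smooth lgtCut_bb.deriv).mul_bb midCut_bb
    refine ((h1.add h2).add h3).congr (Eventually.of_forall fun i => ?_)
    funext x
    simp only [pullback]
    ring
  have hg : Sml l (fun i x => Real.exp (pullback (η i) x) - 1) :=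
    hq.left_comp (F := fun e => Real.exp e - 1) (Real.contDiff_exp.sub contDiff_const) (by simp)
  have hx : Bb (fun x => plat (-2) (-1) 2 3 x * x) :=
    cut_bb (by norm_num) (by norm_num) fun x _ => contDiffAt_id
  have hx' : Bb (fun x => plat (-2) (-1) 2 3 x * (x * (1 - x))) :=
    cut_bb (by norm_num) (by norm_num) fun x _ =>
      contDiffAt_id.mul (contDiffAt_const.sub contDiffAt_id)
  have hf := (hg.mul_bb hx).left_comp_at (F := fun h => h / (1 + h)) (a := 1 / 2) (by norm_num)
    (fun x hx => contDiffAt_id.div (contDiffAt_const.add contDiffAt_id)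
      (ne_of_gt (show 0 < 1 + x by linarith [hx.1]))) (by simp)
  refine ((hg.sub (hg.mul_evb hf.evb)).mul_bb hx').congr (Eventually.of_forall fun i => ?_)
  funext x
  simp only [_root_.conv]
  ring

theorem conv_bb {η : ℝ → ℝ} (h : ContDiff ℝ ∞ (conv η)) : Bb (conv η) :=
  Bb.of_support (a := -2) (b := 3) h fun x hx => by
    rw [conv, plat_zero_Icc (by norm_num) (by norm_num) hx]; ring

end Conversion

section Families

variable {ι : Type} {l : Filter ι} {τ : ℝ}

/-- Families of diffeomorphisms of `[0,1]` converging smoothly to the identity along `l`. -/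
def XP (l : Filter ι) (τ : ℝ) (g : ι → Equiv.Perm ℝ) : Prop :=
  ∃ d : ι → ℝ → ℝ, Sml l d ∧ ∀ᶠ i in l, Rlz τ (d i) (g i)

variable {g g' : ι → Equiv.Perm ℝ}

theorem XP.mul (h : XP l τ g) (h' : XP l τ g') : XP l τ (fun i => g i * g' i) := by
  obtain ⟨d, hd, hr⟩ := h
  obtain ⟨d', hd', hr'⟩ := h'
  refine ⟨_, hd'.add (hd.comp hd'.evb), ?_⟩
  filter_upwards [hr, hr'] with i hi hi'
  exact hi.mul hi'

theorem XP.inv (h : XP l τ g) : XP l τ (fun i => (g i)⁻¹) := by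
  obtain ⟨d, hd, hr⟩ := h
  refine ⟨_, hd.dinv, ?_⟩
  filter_upwards [hr, hd.dis] with i hi hi'
  exact hi.inv hi'

theorem XP.one : XP l τ (fun _ => 1) := by
  refine ⟨_, Sml.zero, Eventually.of_forall fun i => ⟨rfl, rfl, fun s => by simp⟩⟩

theorem XP.list_prod {w : ℕ → ι → Equiv.Perm ℝ} (L : List ℕ)
    (h : ∀ j ∈ L, XP l τ (w j)) : XP l τ (fun i => (L.map fun j => w j i).prod) := by
  induction L with
  | nil => simpa using XP.one
  | cons a L ih =>
    simpa using (h a (by simp)).mul (ih fun j hj => h j (by simp [hj]))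

theorem XP.good (h : XP l τ g) (r : ℕ) {ε : ℝ} (hε : 0 < ε) : ∀ᶠ i in l, Good τ r ε (g i) := by
  obtain ⟨d, hd, hr⟩ := h
  filter_upwards [hr, hd.dis, hd r (ε / 2) (by linarith)] with i hi hi' hb
  exact hi.good hi' hb (by linarith)

/-- Conjugating a fixed diffeomorphism by a small family. -/
theorem XP.good_conj (h : XP l τ g) {r : ℕ} {ε : ℝ} (hε : 0 < ε) {d : ℝ → ℝ} {T : Equiv.Perm ℝ}
    (hT : Rlz τ d T) (hd : Bb d) (h1 : ∀ x, |deriv d x| ≤ 1 / 4) (hb : Bd r (ε / 2) d) :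
    ∀ᶠ i in l, Good τ r ε (g i * T * (g i)⁻¹) := by
  obtain ⟨w, hw, hr⟩ := h
  have hs := hw.conj_fixed hd
  filter_upwards [hr, hw.dis, hs r (ε / 4) (by linarith), hs 1 (1 / 4) (by norm_num)]
    with i hi hi' hb' h1'
  have hR := hi.mul (hT.mul (hi.inv hi'))
  rw [← mul_assoc] at hR
  have e : (fun x => (dinv (w i) x + d (x + dinv (w i) x)) +
      w i (x + (dinv (w i) x + d (x + dinv (w i) x)))) = fun x => d x +
      ((dinv (w i) x + d (x + dinv (w i) x) +
      w i (x + (dinv (w i) x + d (x + dinv (w i) x)))) - d x) := by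
    funext x; ring
  rw [e] at hR
  have hb1 := hb.add hb'
  refine hR.good ?_ hb1 (by linarith)
  refine ⟨hb1.1, fun x => ?_⟩
  rw [deriv_fun_add (smooth_diff hd.smooth x) (smooth_diff h1'.1 x)]
  refine (abs_add_le _ _).trans ?_
  have := (h1'.2 x).deriv_apply
  linarith [h1 x]

/-- Families of displacements of the line which are constant near each end. -/
theorem XP.of_line (hτ : 0 < τ) {B : ℝ} (hB : τ * B ≤ 1) {η : ι → ℝ → ℝ} (h : Sml l η)
    (hη : ∀ᶠ i in l, (∀ s ≤ -B, η i s = η i (-B)) ∧ ∀ s ≥ B, η i s = η i B)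
    (hg : ∀ᶠ i in l, ∀ s, g i s = s + η i s) : XP l τ g := by
  have hs : Sml l (fun i t => τ * η i (τ⁻¹ * t + 0)) := (h.comp_affine τ⁻¹ 0).const_mul τ
  refine ⟨_, hs.conv, ?_⟩
  filter_upwards [hη, hg] with i hi hgi
  have hτ3 : B ≤ τ⁻¹ * 3 := by
    rw [inv_mul_eq_div, le_div_iff₀ hτ]; linarith
  refine Rlz.of_line (conv_zero _) (conv_one _) (conv_spec (fun t ht => ?_) fun t ht => ?_)
    fun s => ?_
  · have : τ⁻¹ * t ≤ τ⁻¹ * (-3) := mul_le_mul_of_nonneg_left ht (inv_pos.2 hτ).le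
    simp only [add_zero]
    rw [hi.1 _ (by linarith), hi.1 (τ⁻¹ * (-3)) (by linarith)]
  · have : τ⁻¹ * 3 ≤ τ⁻¹ * t := mul_le_mul_of_nonneg_left ht (inv_pos.2 hτ).le
    simp only [add_zero]
    rw [hi.2 _ (by linarith), hi.2 (τ⁻¹ * 3) (by linarith)]
  · rw [hgi, mul_add, add_zero, inv_mul_cancel_left₀ hτ.ne']

end Families

section Translation

/-- The displacement of the Möbius flow on the unit interval. -/
def dT (τ : ℝ) : ℝ → ℝ := conv fun _ => τ

theorem dT_sml : Sml (𝓝[>] 0) dT :=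
  (Sml.const (c := fun τ : ℝ => τ) (tendsto_id.mono_left nhdsWithin_le_nhds)).conv

theorem dT_rlz (τ : ℝ) : Rlz τ (dT τ) tr :=
  Rlz.of_line (η := fun _ => τ) (conv_zero _) (conv_one _) (conv_spec (fun _ _ => rfl) fun _ _ => rfl)
    fun s => by rw [tr_apply]; ring

/-- Displacement of a local dilation of the line. -/
def dilLine (δ t : ℝ) : ℝ := δ * (plat (-2) (-1) 1 2 t * t)

theorem dilLine_sml : Sml (𝓝[>] 0) dilLine := by
  refine Sml.congr ((Sml.const (c := fun τ : ℝ => τ) (tendsto_id.mono_left nhdsWithin_le_nhds)).mul_bb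
    (cut_bb (a := -2) (b := -1) (c := 1) (d := 2) (by norm_num) (by norm_num)
      fun x _ => contDiffAt_id)) (Eventually.of_forall fun i => ?_)
  funext x
  simp only [dilLine, id]
  ring

theorem dilLine_eq {δ t : ℝ} (h0 : 0 ≤ t) (h1 : t ≤ 1) : dilLine δ t = δ * t := by
  rw [dilLine, plat_one (by norm_num) (by norm_num) ⟨by linarith, h1⟩, one_mul]

theorem dilLine_zero {δ t : ℝ} (h : t ∉ Ioo (-2 : ℝ) 2) : dilLine δ t = 0 := by
  rw [dilLine, plat_zero (by norm_num) (by norm_num) h]; ring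

/-- The displacement on the unit interval of a local dilation. -/
def dD (δ : ℝ) : ℝ → ℝ := conv (dilLine δ)

theorem dD_sml : Sml (𝓝[>] 0) dD := dilLine_sml.conv

theorem dD_spec (δ t : ℝ) :
    Real.sigmoid (t + dilLine δ t) = Real.sigmoid t + dD δ (Real.sigmoid t) :=
  conv_spec (fun t ht => by
    rw [dilLine_zero fun h => by linarith [h.1], dilLine_zero fun h => by linarith [h.1]])
    (fun t ht => by
    rw [dilLine_zero fun h => by linarith [h.2], dilLine_zero fun h => by linarith [h.2]]) t

theorem exists_dilation {δ τ : ℝ} (hτ : 0 < τ) (hd : Dis (dD δ)) : ∃ D : Equiv.Perm ℝ,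
    Rlz τ (dD δ) D ∧ StrictMono D ∧ ∀ s, 0 ≤ s → τ * s ≤ 1 → D s = (1 + δ) * s := by
  obtain ⟨D, hD⟩ := exists_rlz hτ hd (conv_zero _) (conv_one _)
  refine ⟨D, hD, hD.strictMono hτ hd, fun s h0 h1 => ?_⟩
  have h := hD.2.2 s
  rw [← dD_spec, dilLine_eq (by positivity) h1] at h
  have := Real.sigmoid_injective h
  refine mul_left_cancel₀ hτ.ne' ?_
  rw [this]; ring

end Translation

section FamilyConstructions

variable {ι : Type} {l : Filter ι} {τ : ℝ} {g h : ι → Equiv.Perm ℝ}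

theorem XP.of_disp (hτ : 0 < τ) {d : ι → ℝ → ℝ} (hd : Sml l d)
    (h0 : ∀ᶠ i in l, d i 0 = 0 ∧ d i 1 = 0) :
    ∃ k : ι → Equiv.Perm ℝ, XP l τ k ∧ ∀ᶠ i in l, Rlz τ (d i) (k i) := by
  classical
  have key : ∀ᶠ i in l, ∃ k, Rlz τ (d i) k := by
    filter_upwards [hd.dis, h0] with i hi h
    exact exists_rlz hτ hi h.1 h.2
  have : ∀ᶠ i in l, Rlz τ (d i) (if h : ∃ k, Rlz τ (d i) k then h.choose else 1) := by
    filter_upwards [key] with i hi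
    rw [dif_pos hi]
    exact hi.choose_spec
  exact ⟨_, ⟨d, hd, this⟩, this⟩

theorem XP.glue (hτ : 0 < τ) (hg : XP l τ g) (hh : XP l τ h) {a b : ℝ} (hab : a < b)
    (e : ∀ᶠ i in l, ∀ s ∈ Icc a b, g i s = h i s) : ∃ k : ι → Equiv.Perm ℝ, XP l τ k ∧
      ∀ᶠ i in l, (∀ s ≤ b, k i s = g i s) ∧ ∀ s ≥ a, k i s = h i s := by
  obtain ⟨d, hd, hr⟩ := hg
  obtain ⟨d', hd', hr'⟩ := hh
  have hab' : Real.sigmoid (τ * a) < Real.sigmoid (τ * b) :=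
    Real.sigmoid_lt (mul_lt_mul_of_pos_left hab hτ)
  have hS := stp_bb hab'
  have hs := (hd.mul_bb hS.one_sub).add (hd'.mul_bb hS)
  obtain ⟨k, hk, hkr⟩ := XP.of_disp (τ := τ) hτ hs (by
    filter_upwards [hr, hr'] with i hi hi'
    simp [hi.1, hi'.1, hi.2.1, hi'.2.1])
  refine ⟨k, hk, ?_⟩
  filter_upwards [hkr, hr, hr', e] with i hi h1 h2 he
  have inj : ∀ {p q : ℝ}, Real.sigmoid (τ * p) = Real.sigmoid (τ * q) → p = q := fun h =>
    mul_left_cancel₀ hτ.ne' (Real.sigmoid_injective h)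
  have hmid : ∀ s ∈ Icc a b, k i s = g i s := fun s hs => by
    have e1 := h1.2.2 s
    have e2 := h2.2.2 s
    rw [← he s hs] at e2
    refine inj ?_
    rw [hi.2.2, e1]
    beta_reduce
    have : d i (Real.sigmoid (τ * s)) = d' i (Real.sigmoid (τ * s)) := by linarith
    rw [this]
    ring
  refine ⟨fun s hs => ?_, fun s hs => ?_⟩
  · rcases le_or_gt a s with h | h
    · exact hmid s ⟨h, hs⟩
    · refine inj ?_
      have : Real.sigmoid (τ * s) ≤ Real.sigmoid (τ * a) :=
        Real.sigmoid_le (mul_le_mul_of_nonneg_left h.le hτ.le)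
      rw [hi.2.2, h1.2.2]
      beta_reduce
      rw [stp_zero hab' this]
      ring
  · rcases le_or_gt s b with h | h
    · rw [hmid s ⟨hs, h⟩, he s ⟨hs, h⟩]
    · refine inj ?_
      have : Real.sigmoid (τ * b) ≤ Real.sigmoid (τ * s) :=
        Real.sigmoid_le (mul_le_mul_of_nonneg_left h.le hτ.le)
      rw [hi.2.2, h2.2.2]
      beta_reduce
      rw [stp_one hab' this]
      ring

/-- The displacement on a bounded part of the line. -/
theorem XP.line_disp (hτ : 0 < τ) (hτ1 : τ ≤ 1) (hg : XP l τ g) : ∃ U : ι → ℝ → ℝ, Sml l U ∧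
    ∀ᶠ i in l, ∀ s, |s| ≤ 4 → g i s = s + U i s := by
  obtain ⟨d, hd, hr⟩ := hg
  have hσ : Bb (fun t => plat (-5) (-4) 4 5 t * Real.sigmoid t) :=
    cut_bb (by norm_num) (by norm_num) fun x _ => (contDiff_sigmoid.of_le le_top).contDiffAt
  have h1 := (hd.comp_close lgtCut_bb).comp_fixed hσ.smooth hσ.deriv
  refine ⟨_, (h1.comp_affine τ 0).const_mul τ⁻¹, ?_⟩
  set δ := min (Real.sigmoid (-4) - Real.sigmoid (-5)) (Real.sigmoid 5 - Real.sigmoid 4) with hδ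
  have hδ0 : 0 < δ := lt_min (by linarith [sg_lt (show (-5 : ℝ) < -4 by norm_num)])
    (by linarith [sg_lt (show (4 : ℝ) < 5 by norm_num)])
  have hlg : ∀ x ∈ Icc (Real.sigmoid (-5)) (Real.sigmoid 5), lgtCut x = lgt x := fun x hx => by
    rw [lgtCut, plat_one (sg_lt (by norm_num)) (sg_lt (by norm_num)) hx, one_mul]
  filter_upwards [hr, hd 0 δ hδ0] with i hi hb s hs
  have hts : |τ * s| ≤ 4 := by
    rw [abs_mul, abs_of_pos hτ]
    nlinarith [abs_nonneg s]
  have ht := abs_le.1 hts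
  have hx1 := Real.sigmoid_le ht.1
  have hx2 := Real.sigmoid_le ht.2
  have hb' := abs_le.1 (hb.2 (Real.sigmoid (τ * s))).zero_apply
  have hδ1 : δ ≤ Real.sigmoid (-4) - Real.sigmoid (-5) := min_le_left _ _
  have hδ2 : δ ≤ Real.sigmoid 5 - Real.sigmoid 4 := min_le_right _ _
  simp only [add_zero]
  rw [plat_one (by norm_num) (by norm_num) ⟨ht.1, ht.2⟩, one_mul,
    hlg (Real.sigmoid (τ * s)) ⟨by linarith, by linarith⟩,
    hlg _ ⟨by linarith [hb'.1], by linarith [hb'.2]⟩, ← hi.2.2, lgt_sigmoid, lgt_sigmoid]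
  field_simp
  ring

theorem XP.strictMono (hτ : 0 < τ) (hg : XP l τ g) : ∀ᶠ i in l, StrictMono (g i) := by
  obtain ⟨d, hd, hr⟩ := hg
  filter_upwards [hr, hd.dis] with i hi hi'
  exact hi.strictMono hτ hi'

theorem XP.near (hτ : 0 < τ) (hτ1 : τ ≤ 1) (hg : XP l τ g) :
    ∀ᶠ i in l, ∀ s, |s| ≤ 4 → |g i s - s| ≤ 1 / 10 := by
  obtain ⟨U, hU, he⟩ := hg.line_disp hτ hτ1
  filter_upwards [he, hU 0 (1 / 10) (by norm_num)] with i hi hb s hs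
  rw [hi s hs, add_sub_cancel_left]
  exact (hb.2 s).zero_apply

theorem XP.conj_tr (hg : XP l τ g) (hd : Bb (dT τ)) (h1 : ∀ x, |deriv (dT τ) x| ≤ 1 / 4) :
    XP l τ (fun i => tr * g i * tr⁻¹) := by
  obtain ⟨w, hw, hr⟩ := hg
  have hD : Dis (dT τ) := ⟨hd.smooth, fun x => (h1 x).trans (by norm_num)⟩
  refine ⟨_, hw.conj_by_fixed hd h1, ?_⟩
  filter_upwards [hr] with i hi
  have h2 := ((dT_rlz τ).mul hi).mul ((dT_rlz τ).inv hD)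
  refine ⟨?_, ?_, fun s => ?_⟩
  · simp [hi.1, hD.dinv_zero (dT_rlz τ).1, (dT_rlz τ).1]
  · simp [hi.2.1, hD.dinv_zero (dT_rlz τ).2.1, (dT_rlz τ).2.1]
  · rw [h2.2.2]
    beta_reduce
    rw [(dinv_spec hD.1 hD.2).2.2 (Real.sigmoid (τ * s))]
    ring

/-- Reversal of the line. -/
def rv : Equiv.Perm ℝ := Equiv.neg ℝ

theorem Rlz.conj_rv {d : ℝ → ℝ} {g : Equiv.Perm ℝ} (hi : Rlz τ d g) :
    Rlz τ (fun x => -d (-1 * x + 1)) (rv * g * rv⁻¹) := by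
  refine ⟨by simp [hi.2.1], by simp [hi.1], fun s => ?_⟩
  have h1 := hi.2.2 (-s)
  have : (rv * g * rv⁻¹) s = - g (-s) := rfl
  rw [this, mul_neg, Real.sigmoid_neg, h1, mul_neg, Real.sigmoid_neg]
  beta_reduce
  rw [show -1 * Real.sigmoid (τ * s) + 1 = 1 - Real.sigmoid (τ * s) by ring]
  ring

theorem XP.conj_rv (hg : XP l τ g) : XP l τ (fun i => rv * g i * rv⁻¹) := by
  obtain ⟨w, hw, hr⟩ := hg
  exact ⟨_, (hw.comp_affine (-1) 1).neg, hr.mono fun i hi => hi.conj_rv⟩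

end FamilyConstructions

section Koenigs

theorem exp_eq_sigmoid_div (t : ℝ) : Real.exp t = Real.sigmoid t / (1 - Real.sigmoid t) := by
  have h : Real.exp (-t) * Real.exp t = 1 := by rw [← Real.exp_add]; simp
  have h1 := Real.exp_pos t
  rw [Real.sigmoid_def, show Real.exp (-t) = (Real.exp t)⁻¹ from Real.exp_neg t]
  field_simp
  ring

theorem sigmoid_eq_exp_div (t : ℝ) : Real.sigmoid t = Real.exp t / (1 + Real.exp t) := by
  have h1 := Real.exp_pos t
  rw [Real.sigmoid_def, show Real.exp (-t) = (Real.exp t)⁻¹ from Real.exp_neg t]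
  field_simp
  ring

theorem exp_eq_of_sigmoid {t P : ℝ} (hP : 1 + P ≠ 0) (h : Real.sigmoid t = 1 - 1 / (1 + P)) :
    Real.exp t = P := by
  rw [exp_eq_sigmoid_div, h]
  field_simp
  ring

variable {ι : Type} {l : Filter ι}

theorem exists_affine_chart {L : ℝ} (_ : 0 < L) {b : ι → ℝ → ℝ} (hb : Sml l b)
    (h0 : ∀ᶠ i in l, ∀ x ≤ 0, b i x = 0) : ∃ u : ι → ℝ → ℝ, Sml l u ∧
      ∀ᶠ i in l, (∀ y ≤ 0, u i y = 0) ∧ Bb (u i) ∧ ∀ t t', Real.exp t ≤ L →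
        Real.sigmoid t' = Real.sigmoid t + b i (Real.sigmoid t) →
        Real.exp t' = Real.exp t + u i (Real.exp t) := by
  set X : ℝ → ℝ := fun y => plat (-3 / 4) (-1 / 2) L (L + 1) y * (y / (1 + y)) with hX
  set a : ℝ → ℝ := fun y => plat (-1 / 2) (-1 / 4) L (L + 1) y * (1 + y) with ha
  have hXb : Bb X := cut_bb (by norm_num) (by linarith) fun x hx =>
    contDiffAt_id.div (contDiffAt_const.add contDiffAt_id)
      (ne_of_gt (show 0 < 1 + x by linarith [hx.1]))
  have hab : Bb a := cut_bb (by norm_num) (by linarith) fun x hx =>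
    contDiffAt_const.add contDiffAt_id
  have hB := (hb.comp_fixed hXb.smooth hXb.deriv).mul_bb hab
  have hu := (hB.left_comp_at (F := fun B => B / (1 - B)) (a := 1 / 2) (by norm_num)
    (fun x hx => contDiffAt_id.div (contDiffAt_const.sub contDiffAt_id)
      (ne_of_gt (show 0 < 1 - x by linarith [hx.2]))) (by simp)).mul_bb hab
  refine ⟨_, hu, ?_⟩
  have hX0 : ∀ y ≤ 0, X y ≤ 0 := fun y hy => by
    by_cases h : y ∈ Ioo (-3 / 4) (L + 1)
    · exact mul_nonpos_of_nonneg_of_nonpos (plat_nonneg _ _ _ _ _)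
        (div_nonpos_of_nonpos_of_nonneg hy (by linarith [h.1]))
    · simp only [hX]
      rw [plat_zero (by norm_num) (by linarith) h, zero_mul]
  filter_upwards [h0, hu.smooth, hB 0 (1 / 2) (by norm_num)] with i hi hs hBi
  refine ⟨fun y hy => by simp [hi _ (hX0 y hy)], Bb.of_support (a := -1 / 2) (b := L + 1) hs
    fun y hy => ?_, fun t t' ht h => ?_⟩
  · simp only [ha]
    rw [plat_zero_Icc (by norm_num) (by linarith) hy]
    simp
  · have hy := Real.exp_pos t
    have hBy := abs_le.1 (hBi.2 (Real.exp t)).zero_apply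
    have e1 : a (Real.exp t) = 1 + Real.exp t := by
      simp only [ha]
      rw [plat_one (by norm_num) (by linarith) ⟨by linarith, ht⟩, one_mul]
    have e2 : X (Real.exp t) = Real.sigmoid t := by
      simp only [hX]
      rw [plat_one (by norm_num) (by linarith) ⟨by linarith, ht⟩, one_mul, sigmoid_eq_exp_div]
    rw [e1, e2] at hBy
    rw [e1, e2]
    have e3 : Real.sigmoid t = 1 - 1 / (1 + Real.exp t) := by
      rw [sigmoid_eq_exp_div]; field_simp; ring
    generalize b i (Real.sigmoid t) = β at *
    generalize Real.exp t = y at *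
    have hy1 : 0 < 1 + y := by linarith
    have hB1 : 0 < 1 - (1 + y) * β := by linarith [hBy.2]
    have hP : 1 + (y + (1 + y) * ((1 + y) * β / (1 - (1 + y) * β))) =
        (1 + y) / (1 - (1 + y) * β) := by
      field_simp
      ring
    refine exp_eq_of_sigmoid (by rw [hP]; positivity) ?_
    rw [hP, h, e3]
    field_simp
    ring

theorem exists_interval_chart (c : ℝ) {q : ι → ℝ → ℝ} (hq : Sml l q)
    (h0 : ∀ᶠ i in l, q i 0 = 0) : ∃ d : ι → ℝ → ℝ, Sml l d ∧
      ∀ᶠ i in l, (d i 0 = 0 ∧ d i 1 = 0) ∧ ∀ t t', t ≤ c →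
        Real.sigmoid t' = Real.sigmoid t + d i (Real.sigmoid t) →
        Real.exp t' = Real.exp t + q i (Real.exp t) := by
  have hc0 : -1 < Real.sigmoid c := by linarith [Real.sigmoid_pos c]
  have hc1 : Real.sigmoid c < Real.sigmoid (c + 1) := sg_lt (by linarith)
  have hc2 : Real.sigmoid (c + 1) < Real.sigmoid (c + 2) := sg_lt (by linarith)
  set Y : ℝ → ℝ := fun x => plat (-3) (-2) (Real.sigmoid (c + 1)) (Real.sigmoid (c + 2)) x *
    (x / (1 - x)) with hY
  set a : ℝ → ℝ := fun x => plat (-2) (-1) (Real.sigmoid c) (Real.sigmoid (c + 1)) x * (1 - x)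
    with ha
  have hYb : Bb Y := cut_bb (by norm_num) hc2 fun x hx =>
    contDiffAt_id.div (contDiffAt_const.sub contDiffAt_id)
      (ne_of_gt (show 0 < 1 - x by linarith [hx.2, Real.sigmoid_lt_one (c + 2)]))
  have hab : Bb a := cut_bb (by norm_num) hc1 fun x hx => contDiffAt_const.sub contDiffAt_id
  have hC := (hq.comp_fixed hYb.smooth hYb.deriv).mul_bb hab
  have hd := (hC.left_comp_at (F := fun C => C / (1 + C)) (a := 1 / 2) (by norm_num)
    (fun x hx => contDiffAt_id.div (contDiffAt_const.add contDiffAt_id)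
      (ne_of_gt (show 0 < 1 + x by linarith [hx.1]))) (by simp)).mul_bb hab
  refine ⟨_, hd, ?_⟩
  filter_upwards [h0, hC 0 (1 / 2) (by norm_num)] with i hi hCi
  refine ⟨⟨by simp [hY, hi], by simp [ha]⟩, fun t t' ht h => ?_⟩
  have hx0 := Real.sigmoid_pos t
  have hx1 := Real.sigmoid_lt_one t
  have htc : Real.sigmoid t ≤ Real.sigmoid c := Real.sigmoid_le ht
  have hCy := abs_le.1 (hCi.2 (Real.sigmoid t)).zero_apply
  have e1 : a (Real.sigmoid t) = 1 - Real.sigmoid t := by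
    simp only [ha]
    rw [plat_one (by norm_num) hc1 ⟨by linarith, htc⟩, one_mul]
  have e2 : Y (Real.sigmoid t) = Real.exp t := by
    simp only [hY]
    rw [plat_one (by norm_num) hc2 ⟨by linarith, by linarith⟩, one_mul, exp_eq_sigmoid_div]
  rw [e1, e2] at hCy h
  have e3 := exp_eq_sigmoid_div t
  generalize q i (Real.exp t) = β at *
  rw [e3]
  generalize Real.sigmoid t = x at *
  have hx : 0 < 1 - x := by linarith
  have hB1 : 0 < 1 + (1 - x) * β := by linarith [hCy.1]
  have hP : 1 + (x / (1 - x) + β) = (1 + (1 - x) * β) / (1 - x) := by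
    field_simp
    ring
  refine exp_eq_of_sigmoid (by rw [hP]; positivity) ?_
  rw [hP, h]
  field_simp
  ring

/-- Linearization at `-∞` of the composition of the inverse translation with a map that is
infinitely tangent to the identity. -/
theorem XP.koenigs_left {τ : ℝ} (hτ : 0 < τ) {b : ι → ℝ → ℝ} {J : ι → Equiv.Perm ℝ}
    (hb : Sml l b) (h : ∀ᶠ i in l, Rlz τ (b i) (J i) ∧ ∀ x ≤ 0, b i x = 0) :
    ∃ ψ : ι → Equiv.Perm ℝ, XP l τ ψ ∧ ∀ᶠ i in l, ∀ s ≤ 5, ψ i s = ψ i (J i s - 1) + 1 := by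
  classical
  have hlam : 1 < Real.exp τ := Real.one_lt_exp_iff.2 hτ
  have ha : 1 ≤ Real.exp (5 * τ) := Real.one_le_exp (by linarith)
  obtain ⟨u, hu, hu'⟩ := exists_affine_chart (L := Real.exp (5 * τ)) (by linarith) hb
    (h.mono fun i hi => hi.2)
  obtain ⟨η, C, hη, hk⟩ := koenigs_line hlam ha
  set p : (ℝ → ℝ) → (ℝ → ℝ) → Prop := fun u q => ContDiff ℝ ∞ q ∧ (∀ y ≤ 0, q y = 0) ∧
    (∀ y ≤ Real.exp (5 * τ), q y = u y + Real.exp τ * q ((Real.exp τ)⁻¹ * (y + u y))) ∧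
      ∀ (k : ℕ) (M : ℝ), M ≤ 1 → Bd (k + 2) M u → Bd (k + 2) (C k * M) q with hp
  have hex : ∀ᶠ i in l, ∃ q, p (u i) q := by
    filter_upwards [hu', hu 2 η hη] with i hi hi'
    exact hk _ hi.1 hi.2.1 hi'
  set q : ι → ℝ → ℝ := fun i => if h : ∃ q, p (u i) q then h.choose else 0
  have hq : ∀ᶠ i in l, p (u i) (q i) := by
    filter_upwards [hex] with i hi
    simp only [q]
    rw [dif_pos hi]
    exact hi.choose_spec
  have hqs : Sml l q := hu.map fun r => ⟨r + 2, C r, 1, one_pos, by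
    filter_upwards [hq] with i hi M hM hB
    exact (hi.2.2.2 r M hM hB).mono (by omega) le_rfl⟩
  obtain ⟨d, hd, hd'⟩ := exists_interval_chart (5 * τ) hqs (hq.mono fun i hi => hi.2.1 0 le_rfl)
  obtain ⟨ψ, hψ, hr⟩ := XP.of_disp hτ hd (hd'.mono fun i hi => hi.1)
  refine ⟨ψ, hψ, ?_⟩
  have hε : 0 < Real.exp (5 * τ) * (Real.exp τ - 1) := mul_pos (by linarith) (by linarith)
  filter_upwards [h, hu', hq, hd', hr, hu 0 _ hε] with i h1 h2 h3 h4 h5 h6 s hs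
  have hs' : τ * s ≤ 5 * τ := by nlinarith
  have hy : Real.exp (τ * s) ≤ Real.exp (5 * τ) := Real.exp_le_exp.2 hs'
  have eJ := h2.2.2 _ _ hy (h1.1.2.2 s)
  have eψ := h4.2 _ _ hs' (h5.2.2 s)
  have eJ' : Real.exp (τ * (J i s - 1)) =
      (Real.exp τ)⁻¹ * (Real.exp (τ * s) + u i (Real.exp (τ * s))) := by
    rw [← eJ, ← Real.exp_neg, ← Real.exp_add]
    congr 1
    ring
  have hJ : τ * (J i s - 1) ≤ 5 * τ := by
    rw [← Real.exp_le_exp, eJ', inv_mul_le_iff₀ (by linarith)]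
    have := abs_le.1 (h6.2 (Real.exp (τ * s))).zero_apply
    nlinarith
  have eψ' := h4.2 _ _ hJ (h5.2.2 (J i s - 1))
  have e := h3.2.2.1 _ hy
  rw [← eJ'] at e
  have : Real.exp (τ * ψ i s) = Real.exp (τ * (ψ i (J i s - 1) + 1)) := by
    rw [mul_add, mul_one, Real.exp_add, eψ, eψ', eJ', e]
    rw [← eJ']
    have : Real.exp τ * Real.exp (τ * (J i s - 1)) =
      Real.exp (τ * s) + u i (Real.exp (τ * s)) := by
      rw [eJ']
      field_simp
    linarith
  exact mul_left_cancel₀ hτ.ne' (Real.exp_injective this)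

end Koenigs

section Cocycle

variable {ι : Type} {l : Filter ι} {τ : ℝ} {u : ι → ℝ → ℝ} {f : ι → Equiv.Perm ℝ}

theorem exists_linearization_right (hτ : 0 < τ) (hd : Bb (dT τ))
    (h1 : ∀ x, |deriv (dT τ) x| ≤ 1 / 4) (hu : Sml l u)
    (hf : ∀ᶠ i in l, Rlz τ (u i) (f i) ∧ ∀ x ∉ Ioo 0 1, u i x = 0) :
    ∃ ψ : ι → Equiv.Perm ℝ, XP l τ ψ ∧ ∀ᶠ i in l, ∀ s ≥ -6, ψ i (f i (s + 1)) = ψ i s + 1 := by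
  obtain ⟨φ, hφ, e⟩ := XP.koenigs_left hτ (hu.comp_affine (-1) 1).neg
    (J := fun i => rv * f i * rv⁻¹) (by
      filter_upwards [hf] with i hi
      exact ⟨hi.1.conj_rv, fun x hx => by
        rw [hi.2 _ fun h => by linarith [h.2], neg_zero]⟩)
  refine ⟨_, (hφ.conj_tr hd h1).conj_rv, ?_⟩
  filter_upwards [e] with i hi s hs
  have key : ∀ x, (rv * (tr * φ i * tr⁻¹) * rv⁻¹) x = -(φ i (-x - 1) + 1) := fun x => rfl
  have key' : (rv * f i * rv⁻¹) (-s - 1) = -f i (-(-s - 1)) := rfl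
  have := hi (-s - 1) (by linarith)
  rw [key', show -(-s - 1) = s + 1 by ring] at this
  rw [key, key, this]
  ring

theorem exists_linearization_left (hτ : 0 < τ) (hu : Sml l u)
    (hf : ∀ᶠ i in l, Rlz τ (u i) (f i) ∧ ∀ x ∉ Ioo 0 1, u i x = 0) :
    ∃ ψ : ι → Equiv.Perm ℝ, XP l τ ψ ∧
      ∀ᶠ i in l, ∀ s, f i (s + 1) ≤ 5 → ψ i (f i (s + 1)) = ψ i s + 1 := by
  obtain ⟨φ, hφ, e⟩ := XP.koenigs_left hτ hu.dinv (J := fun i => (f i)⁻¹) (by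
    filter_upwards [hf, hu.dis] with i hi hd
    exact ⟨hi.1.inv hd, fun x hx => hd.dinv_zero (hi.2 x fun h => by linarith [h.1])⟩)
  refine ⟨φ, hφ, ?_⟩
  filter_upwards [e] with i hi s hs
  rw [hi _ hs, perm_inv_apply, add_sub_cancel_right]

theorem Sml.periodize {U : ι → ℝ → ℝ} {B : ℝ} (hU : Sml l U)
    (h : ∀ᶠ i in l, ∀ s ∈ Icc B (B + 1), U i (s + 1) = U i s) :
    Sml l (fun i => _root_.periodize B (U i)) :=
  hU.map fun r => ⟨r, 1, 1, one_pos, by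
    filter_upwards [h] with i hi M _ hM
    rw [one_mul]
    exact periodize_bd hM.1 hi fun x _ => hM.2 x⟩

/-- A diffeomorphism infinitely tangent to the identity at both ends, composed with the
translation, is conjugate to the composition of the translation with a diffeomorphism supported
on a fundamental domain. -/
theorem XP.exists_cocycle (hτ : 0 < τ) (hτ4 : τ * 4 ≤ 1) (hd : Bb (dT τ))
    (h1 : ∀ x, |deriv (dT τ) x| ≤ 1 / 4) (hu : Sml l u)
    (hf : ∀ᶠ i in l, Rlz τ (u i) (f i) ∧ ∀ x ∉ Ioo 0 1, u i x = 0) :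
    ∃ (Q : ι → ℝ → ℝ) (m : ι → Equiv.Perm ℝ), Sml l Q ∧
      (∀ᶠ i in l, Function.Periodic (Q i) 1) ∧ XP l τ m ∧
      ∀ᶠ i in l, m i * f i * tr = fQ (Q i) * tr * m i := by
  have hτ1 : τ ≤ 1 := by linarith
  obtain ⟨ψ, hψ, e⟩ := exists_linearization_left hτ hu hf
  obtain ⟨φ, hφ, e'⟩ := exists_linearization_right hτ hd h1 hu hf
  have hfx : XP l τ f := ⟨u, hu, hf.mono fun i hi => hi.1⟩
  obtain ⟨U, hU, hgU⟩ := (hψ.mul hφ.inv).line_disp hτ hτ1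
  have hUp : ∀ᶠ i in l, ∀ s ∈ Icc (0 : ℝ) (0 + 1), U i (s + 1) = U i s := by
    filter_upwards [e, e', hgU, hfx.near hτ hτ1, hφ.inv.near hτ hτ1] with i h1 h2 h3 h4 h5 t ht
    rw [zero_add] at ht
    have n1 := abs_le.1 (h5 t (abs_le.2 ⟨by linarith [ht.1], by linarith [ht.2]⟩))
    set s := (φ i)⁻¹ t with hs
    have n2 := abs_le.1 (h4 (s + 1) (abs_le.2 ⟨by linarith [ht.1], by linarith [ht.2]⟩))
    have e1 := h3 t (abs_le.2 ⟨by linarith [ht.1], by linarith [ht.2]⟩)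
    have e2 := h3 (t + 1) (abs_le.2 ⟨by linarith [ht.1], by linarith [ht.2]⟩)
    rw [Equiv.Perm.mul_apply, ← hs] at e1
    have : (φ i)⁻¹ (t + 1) = f i (s + 1) := by
      rw [Equiv.Perm.inv_eq_iff_eq, h2 s (by linarith [ht.1]), hs, perm_apply_inv]
    rw [Equiv.Perm.mul_apply, this, h1 s (by linarith [ht.2])] at e2
    linarith
  have hQ := hU.periodize hUp
  set Q : ι → ℝ → ℝ := fun i => periodize 0 (U i) with hQd
  have hQU : ∀ᶠ i in l, ∀ s ∈ Ico (0 : ℝ) 2, Q i s = U i s := by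
    filter_upwards [hUp] with i hi s hs
    have := periodize_eq hi (s := s) 0 (by simpa using hs)
    simpa using this
  have hQp : ∀ i, Function.Periodic (Q i) 1 := fun i => periodize_periodic _ _
  have hCQ : Sml l (fun i => CQ (Q i)) := hQ.mul_bb (stp_bb (by norm_num))
  have hη : Sml l (fun i s => (1 - stp 3 4 s) * CQ (Q i) s) :=
    hCQ.mul_bb (stp_bb (by norm_num)).one_sub
  have hP' : XP l τ (fun i => pm (fun s => (1 - stp 3 4 s) * CQ (Q i) s)) := by
    refine XP.of_line hτ hτ4 hη (Eventually.of_forall fun i => ⟨fun s hs => ?_, fun s hs => ?_⟩)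
      (hη.dis.mono fun i hi => hi.pm_apply)
    · rw [CQ_left _ (by linarith), CQ_left _ (by norm_num), mul_zero, mul_zero]
    · rw [stp_one (by norm_num) hs, stp_one (by norm_num) le_rfl]; ring
  have hP3 : ∀ᶠ i in l, ∀ s ≤ 3, pm (fun s => (1 - stp 3 4 s) * CQ (Q i) s) s = s + CQ (Q i) s := by
    filter_upwards [hη.dis] with i hi s hs
    rw [hi.pm_apply, stp_zero (by norm_num) hs]
    ring
  set P : ι → Equiv.Perm ℝ := fun i => pm (fun s => (1 - stp 3 4 s) * CQ (Q i) s) with hP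
  have hG := hP'.inv.mul hψ
  have hGφ : ∀ᶠ i in l, ∀ s ∈ Icc (1 / 4 : ℝ) (3 / 2), ((P i)⁻¹ * ψ i) s = φ i s := by
    filter_upwards [hP3, hQU, hgU, hφ.near hτ hτ1] with i h1 h2 h3 h4 s hs
    have n := abs_le.1 (h4 s (abs_le.2 ⟨by linarith [hs.1], by linarith [hs.2]⟩))
    have e1 := h3 (φ i s) (abs_le.2 ⟨by linarith [hs.1], by linarith [hs.2]⟩)
    rw [Equiv.Perm.mul_apply, perm_inv_apply] at e1
    rw [Equiv.Perm.mul_apply, Equiv.Perm.inv_eq_iff_eq, h1 _ (by linarith [hs.2]),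
      CQ_right _ (by linarith [hs.1]), h2 _ ⟨by linarith [hs.1], by linarith [hs.2]⟩, e1]
  obtain ⟨m, hm, hm'⟩ := hG.glue hτ hφ (by norm_num) hGφ
  refine ⟨Q, m, hQ, Eventually.of_forall hQp, hm, ?_⟩
  filter_upwards [hm', hP3, e, e', hCQ.dis, hfx.near hτ hτ1, hφ.near hτ hτ1,
    hG.strictMono hτ, hφ.strictMono hτ, hfx.strictMono hτ, hGφ] with
    i hm hP3 e e' hC hfn hφn hGm hφm hfm hGφ
  have nf := abs_le.1 (hfn (5 / 4) (abs_le.2 ⟨by norm_num, by norm_num⟩))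
  ext s
  simp only [Equiv.Perm.mul_apply, tr_apply]
  rcases le_or_gt s (1 / 4) with hs | hs
  · have hfs : f i (s + 1) ≤ 27 / 20 := by
      have := hfm.monotone (show s + 1 ≤ 5 / 4 by linarith)
      linarith
    have hPG : ∀ x ≤ 3 / 2, ((P i)⁻¹ * ψ i) x + CQ (Q i) (((P i)⁻¹ * ψ i) x) = ψ i x :=
      fun x hx => by
        have h := hGm.monotone hx
        rw [hGφ (3 / 2) ⟨by norm_num, le_rfl⟩] at h
        have n := abs_le.1 (hφn (3 / 2) (abs_le.2 ⟨by norm_num, by norm_num⟩))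
        rw [← hP3 _ (by linarith), Equiv.Perm.mul_apply, perm_apply_inv]
    rw [hm.1 _ (by linarith), hm.1 s (by linarith)]
    simp only [fQ, Equiv.Perm.mul_apply, tr_inv_apply, add_sub_cancel_right]
    rw [eq_comm, Equiv.Perm.inv_eq_iff_eq]
    simp only [tr_apply, hC.pm_apply]
    have a1 := hPG s (by linarith)
    have a2 := hPG (f i (s + 1)) (by linarith)
    rw [Equiv.Perm.mul_apply] at a1 a2
    rw [a1, a2, e s (by linarith)]
  · have hfs : 1 ≤ f i (s + 1) := by
      have := hfm.monotone (show 5 / 4 ≤ s + 1 by linarith)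
      linarith
    have h0 : 0 ≤ φ i s := by
      have n := abs_le.1 (hφn (1 / 4) (abs_le.2 ⟨by norm_num, by norm_num⟩))
      have := hφm.monotone hs.le
      linarith
    rw [hm.2 _ (by linarith), hm.2 s (by linarith), e' s (by linarith),
      fQ_of_nonneg (hQp i) hC (by linarith)]

end Cocycle

section Assembly

theorem prod_five_commutators {G : Type*} [Group G] {f m T Q h v v' W D c w : G}
    (h1 : m * f * T = Q * T * m) (h2 : Q * v' * T = h * (v * T) * h⁻¹)
    (h3 : v * v'⁻¹ = (W * D * W⁻¹ * D⁻¹) * (c * w * c⁻¹ * w⁻¹)) :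
    f = (fun a b : G => a * b * a⁻¹ * b⁻¹) (m⁻¹ * h * m) (m⁻¹ * v * m) *
      (fun a b : G => a * b * a⁻¹ * b⁻¹) (m⁻¹ * (v * h * v⁻¹) * m) ((m⁻¹ * v) * T * (m⁻¹ * v)⁻¹) *
      (fun a b : G => a * b * a⁻¹ * b⁻¹) (m⁻¹ * W * m) (m⁻¹ * D * m⁻¹⁻¹) *
      (fun a b : G => a * b * a⁻¹ * b⁻¹) (m⁻¹ * c * m) (m⁻¹ * w * m) *
      (fun a b : G => a * b * a⁻¹ * b⁻¹) m⁻¹ T := by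
  have e1 : f = m⁻¹ * (Q * T * m) * T⁻¹ := by rw [← h1]; group
  have e2 : Q = h * (v * T) * h⁻¹ * T⁻¹ * v'⁻¹ := by rw [← h2]; group
  have e3 : v'⁻¹ = v⁻¹ * ((W * D * W⁻¹ * D⁻¹) * (c * w * c⁻¹ * w⁻¹)) := by rw [← h3]; group
  rw [e1, e2, e3]
  group

variable {τ : ℝ} {F F' : DiffIcc ⊤} {g g' : Equiv.Perm ℝ}

theorem sigmoid_mem_Icc (t : ℝ) : Real.sigmoid t ∈ Icc (0 : ℝ) 1 :=
  ⟨(Real.sigmoid_pos t).le, (Real.sigmoid_lt_one t).le⟩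

theorem DiffIcc.invFun_sigmoid
    (h : ∀ s, F.toFun (Real.sigmoid (τ * s)) = Real.sigmoid (τ * g s)) (s : ℝ) :
    F.invFun (Real.sigmoid (τ * s)) = Real.sigmoid (τ * g⁻¹ s) := by
  rw [← F.left_inv (Real.sigmoid (τ * g⁻¹ s)) (sigmoid_mem_Icc _), h, perm_apply_inv]

theorem commFun_sigmoid (h : ∀ s, F.toFun (Real.sigmoid (τ * s)) = Real.sigmoid (τ * g s))
    (h' : ∀ s, F'.toFun (Real.sigmoid (τ * s)) = Real.sigmoid (τ * g' s)) (s : ℝ) :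
    commFun F F' (Real.sigmoid (τ * s)) = Real.sigmoid (τ * (g * g' * g⁻¹ * g'⁻¹) s) := by
  simp only [commFun, Function.comp_apply, Equiv.Perm.mul_apply, DiffIcc.invFun_sigmoid h',
    DiffIcc.invFun_sigmoid h, h, h']

theorem commFun_zero (F F' : DiffIcc ⊤) : commFun F F' 0 = 0 := by
  have h : ∀ F : DiffIcc ⊤, F.invFun 0 = 0 := fun F => by
    have := F.left_inv 0 ⟨le_rfl, zero_le_one⟩
    rwa [F.fix0] at this
  simp only [commFun, Function.comp_apply, h, F.fix0, F'.fix0]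

theorem commFun_one (F F' : DiffIcc ⊤) : commFun F F' 1 = 1 := by
  have h : ∀ F : DiffIcc ⊤, F.invFun 1 = 1 := fun F => by
    have := F.left_inv 1 ⟨zero_le_one, le_rfl⟩
    rwa [F.fix1] at this
  simp only [commFun, Function.comp_apply, h, F.fix1, F'.fix1]

/-- The diffeomorphisms infinitely tangent to the identity at both ends. -/
def DiffITI : Type := {f : DiffIcc ⊤ // ITIat f.toFun 0 ∧ ITIat f.toFun 1}

/-- The filter of neighbourhoods of the identity. -/
def nearId : Filter DiffITI where
  sets := {S | ∃ s : ℕ, ∃ ε > (0 : ℝ), ∀ f : DiffITI, IDistLt s ε f.1.toFun id → f ∈ S}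
  univ_sets := ⟨0, 1, one_pos, fun _ _ => trivial⟩
  sets_of_superset := fun ⟨s, ε, hε, h⟩ hST => ⟨s, ε, hε, fun f hf => hST (h f hf)⟩
  inter_sets := fun ⟨s, ε, hε, h⟩ ⟨s', ε', hε', h'⟩ =>
    ⟨max s s', min ε ε', lt_min hε hε', fun f hf =>
      ⟨h f fun k hk x hx => (hf k (hk.trans (le_max_left _ _)) x hx).trans_le (min_le_left _ _),
      h' f fun k hk x hx => (hf k (hk.trans (le_max_right _ _)) x hx).trans_le (min_le_right _ _)⟩⟩

theorem eventually_nearId {p : DiffITI → Prop} : (∀ᶠ f in nearId, p f) ↔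
    ∃ s : ℕ, ∃ ε > (0 : ℝ), ∀ f : DiffITI, IDistLt s ε f.1.toFun id → p f := Iff.rfl

/-- The displacements of diffeomorphisms near the identity, extended by zero. -/
theorem exists_displacement : ∃ u : DiffITI → ℝ → ℝ, Sml nearId u ∧
    ∀ f, (∀ x ∉ Ioo (0 : ℝ) 1, u f x = 0) ∧ ∀ x ∈ Icc (0 : ℝ) 1, f.1.toFun x = x + u f x := by
  choose u hu h0 h1 h2 using fun f : DiffITI => exists_extension f.1 f.2.1 f.2.2
  exact ⟨u, fun r ε hε => ⟨r, ε, hε, fun f hf => h2 f r ε hf⟩, fun f => ⟨h0 f, h1 f⟩⟩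

theorem Sml.scal {ι : Type*} {l : Filter ι} {z : ι → ℝ → ℝ} (hz : Sml l z) (b : ℝ) :
    Sml l (fun i => scal b (z i)) := by
  refine ((hz.comp_affine b⁻¹ 0).const_mul b).congr (Eventually.of_forall fun i => ?_)
  funext x
  simp only [_root_.scal, add_zero]

/-- Rescaled bumps as families of diffeomorphisms. -/
theorem XP.scal {ι : Type} {l : Filter ι} {z : ι → ℝ → ℝ} (hτ : 0 < τ) (hz : Sml l z)
    (h : ∀ᶠ i in l, (∀ s ≤ 0, z i s = 0) ∧ ∀ s ≥ 2, z i s = 0) {b : ℝ} (hb : 0 < b)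
    (hτb : τ * (2 * b) ≤ 1) : XP l τ (fun i => (pm (scal b (z i)))⁻¹) := by
  refine (XP.of_line hτ hτb (hz.scal b) ?_ ((hz.scal b).dis.mono fun i hi => hi.pm_apply)).inv
  have hb' : 0 < b⁻¹ := inv_pos.2 hb
  filter_upwards [h] with i hi
  have e1 : ∀ s ≤ 0, _root_.scal b (z i) s = 0 := fun s hs => by
    rw [_root_.scal, hi.1 _ (mul_nonpos_of_nonneg_of_nonpos hb'.le hs), mul_zero]
  have e2 : ∀ s ≥ 2 * b, _root_.scal b (z i) s = 0 := fun s hs => by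
    rw [_root_.scal, hi.2 _ (by rw [inv_mul_eq_div, ge_iff_le, le_div_iff₀ hb]; exact hs),
      mul_zero]
  exact ⟨fun s hs => by rw [e1 _ (by linarith), e1 _ (by linarith)],
    fun s hs => by rw [e2 _ hs, e2 _ le_rfl]⟩

theorem exists_dilation_parameter (r : ℕ) {ε : ℝ} (hε : 0 < ε) : ∃ δ > 0, Bb (dD δ) ∧
    (∀ x, |deriv (dD δ) x| ≤ 1 / 4) ∧ Bd r ε (dD δ) := by
  obtain ⟨δ, h1, h2, h3⟩ := ((dD_sml 1 (1 / 4) (by norm_num)).and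
    ((dD_sml r ε hε).and self_mem_nhdsWithin)).exists
  exact ⟨δ, h3, conv_bb h1.1, fun x => (h1.2 x).deriv_apply, h2⟩

theorem exists_translation_parameter (r : ℕ) {ε b : ℝ} (hε : 0 < ε) (hb : 0 < b) : ∃ τ > 0,
    τ * b ≤ 1 ∧ Bb (dT τ) ∧ (∀ x, |deriv (dT τ) x| ≤ 1 / 4) ∧ Bd r ε (dT τ) := by
  obtain ⟨τ, h1, h2, h3⟩ := ((dT_sml 1 (1 / 4) (by norm_num)).and
    ((dT_sml r ε hε).and (Ioc_mem_nhdsGT (show 0 < 1 / b by positivity)))).exists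
  exact ⟨τ, h3.1, (le_div_iff₀ hb).1 h3.2, conv_bb h1.1, fun x => (h1.2 x).deriv_apply, h2⟩

end Assembly

/-- Local perfection of `Diff^∞_+([0,1])` at ITI diffeomorphisms: any diffeomorphism of
`[0,1]` which is ITI at `0` and `1` and close enough to the identity is a product of
five commutators of diffeomorphisms close to the identity. -/
theorem local_perfection_interval :
    ∀ r : ℕ, ∀ ε > (0 : ℝ), ∃ s : ℕ, ∃ ε' > (0 : ℝ),
      ∀ f : DiffIcc ⊤, ITIat f.toFun 0 → ITIat f.toFun 1 → IDistLt s ε' f.toFun id →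
        ∃ a₁ b₁ a₂ b₂ a₃ b₃ a₄ b₄ a₅ b₅ : DiffIcc ⊤,
          IDistLt r ε a₁.toFun id ∧ IDistLt r ε b₁.toFun id ∧
          IDistLt r ε a₂.toFun id ∧ IDistLt r ε b₂.toFun id ∧
          IDistLt r ε a₃.toFun id ∧ IDistLt r ε b₃.toFun id ∧
          IDistLt r ε a₄.toFun id ∧ IDistLt r ε b₄.toFun id ∧
          IDistLt r ε a₅.toFun id ∧ IDistLt r ε b₅.toFun id ∧
          ∀ x ∈ Set.Icc (0:ℝ) 1,
            f.toFun x = (commFun a₁ b₁ ∘ commFun a₂ b₂ ∘ commFun a₃ b₃ ∘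
              commFun a₄ b₄ ∘ commFun a₅ b₅) x := by
  intro r ε hε
  have hε2 : 0 < ε / 2 := by positivity
  obtain ⟨δ, hδ, hDb, hD1, hDr⟩ := exists_dilation_parameter r hε2
  obtain ⟨A₀, hA₀, hconj⟩ := exists_conjugacy
  obtain ⟨K, hK⟩ := pow_unbounded_of_one_lt A₀ (show 1 < 1 + δ by linarith)
  have hK1 : 1 ≤ K := by
    rcases Nat.eq_zero_or_pos K with h | h
    · rw [h, pow_zero] at hK; linarith
    · exact h
  have hpow : ∀ j, 1 ≤ (1 + δ) ^ j := fun j => one_le_pow₀ (by linarith)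
  have hpow' : ∀ j ≤ K, (1 + δ) ^ j ≤ (1 + δ) ^ K := fun j hj =>
    pow_le_pow_right₀ (by linarith) hj
  set A := (1 + δ) ^ K
  have hA1 : 1 ≤ A := hpow K
  set B := ⌈2 * A⌉₊
  have hB : 2 * A ≤ B := Nat.le_ceil _
  have hB' : (B : ℝ) ≤ 2 * A + 1 := (Nat.ceil_lt_add_one (by linarith)).le
  obtain ⟨τ, hτ, hτB, hTb, hT1, hTr⟩ := exists_translation_parameter r hε2
    (show 0 < (B : ℝ) + 4 by linarith)
  have hτ4 : τ * 4 ≤ 1 := by nlinarith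
  have hτB' : τ * B ≤ 1 := by nlinarith
  have hτA : ∀ j ≤ K, τ * (2 * (1 + δ) ^ j) ≤ 1 := fun j hj =>
    (mul_le_mul_of_nonneg_left (by linarith [hpow' j hj]) hτ.le).trans hτB'
  obtain ⟨D, hD, hDm, hDs⟩ := exists_dilation (δ := δ) hτ
    ⟨hDb.smooth, fun x => (hD1 x).trans (by norm_num)⟩
  obtain ⟨u, hu, hfu⟩ := exists_displacement
  obtain ⟨g, -, hg⟩ := XP.of_disp hτ hu (Eventually.of_forall fun f =>
    ⟨(hfu f).1 0 (by simp), (hfu f).1 1 (by simp)⟩)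
  obtain ⟨Q, m, hQ, hQp, hm, hmQ⟩ := XP.exists_cocycle hτ hτ4 hTb hT1 hu
    (hg.mono fun f hf => ⟨hf, (hfu f).1⟩)
  obtain ⟨z, e, c, hz, he, hze⟩ := hconj A hK.le B hB hB' hQ hQp
  have hw : ∀ j ≤ K, XP nearId τ (fun f => (pm (scal ((1 + δ) ^ j) (z f)))⁻¹) := fun j hj =>
    XP.scal hτ hz (hze.mono fun f hf => ⟨hf.1, hf.2.1⟩) (by positivity) (hτA j hj)
  have hW := XP.list_prod (w := fun j f => (pm (scal ((1 + δ) ^ j) (z f)))⁻¹) (List.range K)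
    fun j hj => hw j (List.mem_range.1 hj).le
  have hc := XP.list_prod (w := fun j f => (pm (scal ((1 + δ) ^ (j + 1)) (z f)))⁻¹)
    (List.range (K - 1)) fun j hj => hw (j + 1) (by have := List.mem_range.1 hj; omega)
  have hv := hw 0 (Nat.zero_le _)
  have hwK := hw K le_rfl
  have hh : XP nearId τ (fun f => (pm (e f))⁻¹) := by
    refine (XP.of_line hτ hτB' he ?_ (he.dis.mono fun f hf => hf.pm_apply)).inv
    filter_upwards [hze] with f hf
    exact ⟨fun s hs => by rw [hf.2.2.1 _ (by linarith), hf.2.2.1 _ (by linarith)],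
      fun s hs => by rw [hf.2.2.2.1 _ hs, hf.2.2.2.1 _ le_rfl]⟩
  have hk := hm.inv
  have conj : ∀ {x : DiffITI → Equiv.Perm ℝ}, XP nearId τ x →
      ∀ᶠ f in nearId, Good τ r ε ((m f)⁻¹ * x f * m f) := fun hx =>
    ((hk.mul hx).mul hm).good r hε
  have hgood := (((conj hh).and (conj hv)).and ((conj ((hv.mul hh).mul hv.inv)).and
    ((hk.mul hv).good_conj hε (dT_rlz τ) hTb hT1 hTr))).and (((conj hW).and
    (hk.good_conj hε hD hDb hD1 hDr)).and (((conj hc).and (conj hwK)).and ((hk.good r hε).and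
    (XP.one.good_conj hε (dT_rlz τ) hTb hT1 hTr))))
  have hmain := hgood.and ((hmQ.and hze).and (hg.and hz.dis))
  obtain ⟨s, ε', hε', H⟩ := eventually_nearId.1 hmain
  refine ⟨s, ε', hε', fun f h0 h1 hf => ?_⟩
  obtain ⟨⟨⟨⟨⟨a₁, ha₁, ha₁'⟩, ⟨b₁, hb₁, hb₁'⟩⟩, ⟨a₂, ha₂, ha₂'⟩, ⟨b₂, hb₂, hb₂'⟩⟩,
    ⟨⟨a₃, ha₃, ha₃'⟩, ⟨b₃, hb₃, hb₃'⟩⟩, ⟨⟨a₄, ha₄, ha₄'⟩, ⟨b₄, hb₄, hb₄'⟩⟩,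
    ⟨a₅, ha₅, ha₅'⟩, ⟨b₅, hb₅, hb₅'⟩⟩, ⟨hmQ, hze⟩, hg, hzd⟩ := H ⟨f, h0, h1⟩ hf
  have hfu : ∀ x ∈ Icc (0 : ℝ) 1, f.toFun x = x + u ⟨f, h0, h1⟩ x := (hfu ⟨f, h0, h1⟩).2
  generalize (⟨f, h0, h1⟩ : DiffITI) = i at *
  refine ⟨a₁, b₁, a₂, b₂, a₃, b₃, a₄, b₄, a₅, b₅, ha₁, hb₁, ha₂, hb₂, ha₃, hb₃, ha₄, hb₄, ha₅,
    hb₅, fun x hx => ?_⟩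
  obtain ⟨W', c', hW', hc', hWc⟩ := mul_inv_eq_two_commutators hK1
    (fun j => (pm (scal ((1 + δ) ^ j) (z i)))⁻¹) D fun j hj => by
      have h := scale_conj (a := 1 + δ) (b := (1 + δ) ^ j) (by linarith) (by positivity) hzd hze.1
        hze.2.1 hDm fun s hs hs' => hDs s hs
          ((mul_le_mul_of_nonneg_left hs' hτ.le).trans (hτA j hj.le))
      have h' : pm (scal ((1 + δ) ^ (j + 1)) (z i)) = D * pm (scal ((1 + δ) ^ j) (z i)) * D⁻¹ := by
        rw [h, pow_succ']; group
      rw [h']; group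
  have hz1 : scal ((1 + δ) ^ 0) (z i) = z i := by
    funext x
    simp [scal]
  rw [one_mul, inv_one, mul_one] at hb₅'
  have key := prod_five_commutators hmQ (h := (pm (e i))⁻¹)
    (v := (pm (scal ((1 + δ) ^ 0) (z i)))⁻¹) (by rw [hz1, inv_inv]; exact hze.2.2.2.2) hWc
  rw [hW', hc'] at key
  rcases eq_or_lt_of_le hx.1 with rfl | hx0
  · simp only [Function.comp_apply, commFun_zero, f.fix0]
  rcases eq_or_lt_of_le hx.2 with rfl | hx1
  · simp only [Function.comp_apply, commFun_one, f.fix1]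
  obtain ⟨s, rfl⟩ : ∃ s, Real.sigmoid (τ * s) = x :=
    ⟨τ⁻¹ * lgt x, by rw [mul_inv_cancel_left₀ hτ.ne', sigmoid_lgt hx0 hx1]⟩
  rw [hfu _ hx, ← hg.2.2 s, key]
  simp only [Function.comp_apply, commFun_sigmoid ha₅' hb₅', commFun_sigmoid ha₄' hb₄',
    commFun_sigmoid ha₃' hb₃', commFun_sigmoid ha₂' hb₂', commFun_sigmoid ha₁' hb₁',
    Equiv.Perm.mul_apply]
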